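/- arXiv:1508.04334 — 2 statements merged into one kernel-verified Lean document; each statement's English description precedes it below -/
import Mathlib

section
/- Let f: X → Y be a simplicial map of simplicial complexes. If for every simplex σ of Y the preimage f⁻¹(σ) of the closed simplex is contractible, then f is a homotopy equivalence. -/
open scoped BigOperators

structure ASC (V : Type) where
  faces : Set (Finset V)
  nonempty_of_mem : ∀ ⦃s⦄, s ∈ faces → s.Nonempty
  down_closed : ∀ ⦃s t : Finset V⦄, s ∈ faces → t ⊆ s → t.Nonempty → t ∈ faces

namespace ASC

variable {V W : Type} [DecidableEq V] [DecidableEq W]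

/-- The geometric realization of an abstract simplicial complex, as a subset of `V → ℝ`
(barycentric coordinates, with the product topology on the subtype). -/
def space (K : ASC V) : Set (V → ℝ) :=
  {x | (∀ v, 0 ≤ x v) ∧ ∃ s ∈ K.faces, (∀ v, v ∉ s → x v = 0) ∧ ∑ v ∈ s, x v = 1}

/-- A vertex map is simplicial if it sends faces to faces. -/
def IsSimplicial (K : ASC V) (L : ASC W) (φ : V → W) : Prop :=
  ∀ s ∈ K.faces, s.image φ ∈ L.faces

/-- The map induced on geometric realizations by a vertex map. -/
noncomputable def push (φ : V → W) (x : V → ℝ) : W → ℝ :=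
  fun w => ∑ᶠ v ∈ φ ⁻¹' {w}, x v

/-- The link of a simplex. -/
def link (K : ASC V) (σ : Finset V) : ASC V where
  faces := {t | t ∈ K.faces ∧ Disjoint σ t ∧ σ ∪ t ∈ K.faces}
  nonempty_of_mem := fun _ ht => K.nonempty_of_mem ht.1
  down_closed := by
    rintro t u ⟨h1, h2, h3⟩ hsub hne
    exact ⟨K.down_closed h1 hsub hne, h2.mono_right hsub,
      K.down_closed h3 (Finset.union_subset_union_right hsub)
        ⟨hne.choose, Finset.mem_union_right _ hne.choose_spec⟩⟩

end ASC

/-- `n`-connectedness of a space (`n` an integer): nonempty when `n ≥ -1`, and all homotopy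
groups in dimensions `≤ n` vanish, at every basepoint. -/
def IsConn (X : Type) [TopologicalSpace X] (n : ℤ) : Prop :=
  (-1 ≤ n → Nonempty X) ∧
    ∀ i : ℕ, (i : ℤ) ≤ n → ∀ x : X, Subsingleton (HomotopyGroup (Fin i) X x)


open Set Topology

namespace ASC

section Cells

variable {V W : Type}

/-- The closed simplex spanned by a finite set of vertices. -/
def cell (s : Finset V) : Set (V → ℝ) :=
  {x | (∀ v, 0 ≤ x v) ∧ (∀ v, v ∉ s → x v = 0) ∧ ∑ v ∈ s, x v = 1}

/-- The union of all closed simplices with vertices in `V`. -/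
def allCells (V : Type) : Set (V → ℝ) := {x | ∃ s : Finset V, x ∈ cell s}

theorem mem_space_iff {K : ASC V} {x : V → ℝ} : x ∈ K.space ↔ ∃ s ∈ K.faces, x ∈ cell s := by
  constructor
  · rintro ⟨h0, s, hs, h1, h2⟩
    exact ⟨s, hs, h0, h1, h2⟩
  · rintro ⟨s, hs, h0, h1, h2⟩
    exact ⟨h0, s, hs, h1, h2⟩

theorem space_subset_allCells (K : ASC V) : K.space ⊆ allCells V := fun _ hx =>
  let ⟨s, _, h⟩ := mem_space_iff.1 hx
  ⟨s, h⟩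

theorem cell_subset_space {K : ASC V} {s : Finset V} (hs : s ∈ K.faces) : cell s ⊆ K.space :=
  fun _ hx => mem_space_iff.2 ⟨s, hs, hx⟩

theorem cell_mono {s t : Finset V} (h : s ⊆ t) : cell s ⊆ cell t := by
  rintro x ⟨h0, h1, h2⟩
  exact ⟨h0, fun v hv => h1 v fun hv' => hv (h hv'),
    (Finset.sum_subset h fun v _ hv => h1 v hv).symm.trans h2⟩

theorem isClosed_cell (s : Finset V) : IsClosed (cell s) := by
  have : cell s = (⋂ v, {x : V → ℝ | 0 ≤ x v}) ∩ ((⋂ v, ⋂ (_ : v ∉ s), {x : V → ℝ | x v = 0}) ∩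
      {x : V → ℝ | ∑ v ∈ s, x v = 1}) := by
    ext x; simp [cell]
  rw [this]
  refine (isClosed_iInter fun v => isClosed_le (by fun_prop) (by fun_prop)).inter
    ((isClosed_iInter fun v => isClosed_iInter fun _ => isClosed_eq (by fun_prop)
      (by fun_prop)).inter (isClosed_eq (by fun_prop) (by fun_prop)))

theorem sum_le_one {t T : Finset V} {x : V → ℝ} (hx : x ∈ cell t) : ∑ v ∈ T, x v ≤ 1 := by
  classical
  rw [← (cell_mono (Finset.subset_union_right (s₁ := T)) hx).2.2]
  exact Finset.sum_le_sum_of_subset_of_nonneg Finset.subset_union_left fun v _ _ => hx.1 v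

theorem isCompact_cell (s : Finset V) : IsCompact (cell s) := by
  refine (isCompact_univ_pi fun _ : V => isCompact_Icc (a := (0 : ℝ)) (b := 1)).of_isClosed_subset
    (isClosed_cell s) fun x hx v _ => ⟨hx.1 v, ?_⟩
  simpa using sum_le_one (T := {v}) hx

theorem cell_combo {s : Finset V} {x y : V → ℝ} (hx : x ∈ cell s) (hy : y ∈ cell s) {t : ℝ}
    (h0 : 0 ≤ t) (h1 : t ≤ 1) : (1 - t) • x + t • y ∈ cell s := by
  refine ⟨fun v => ?_, fun v hv => ?_, ?_⟩
  · have := hx.1 v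
    have := hy.1 v
    have : 0 ≤ 1 - t := by linarith
    simp only [Pi.add_apply, Pi.smul_apply, smul_eq_mul]
    positivity
  · simp [hx.2.1 v hv, hy.2.1 v hv]
  · simp [Finset.sum_add_distrib, ← Finset.mul_sum, hx.2.2, hy.2.2]

theorem exists_pos_of_mem_cell {s : Finset V} {x : V → ℝ} (hx : x ∈ cell s) :
    ∃ v ∈ s, 0 < x v := by
  by_contra! h
  have := Finset.sum_nonpos h
  rw [hx.2.2] at this
  linarith

theorem le_one_sub_sum {s : Finset V} {x : V → ℝ} (hx : x ∈ allCells V) {v : V} (hv : v ∉ s) :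
    x v ≤ 1 - ∑ u ∈ s, x u := by
  classical
  obtain ⟨t, ht⟩ := hx
  have := sum_le_one (T := insert v s) ht
  rw [Finset.sum_insert hv] at this
  linarith

/-! ### The map induced by a vertex map -/

theorem push_eq_sum [DecidableEq W] {φ : V → W} {s : Finset V} {x : V → ℝ}
    (hx : ∀ v, v ∉ s → x v = 0) (w : W) :
    push φ x w = ∑ v ∈ s with φ v = w, x v := by
  classical
  unfold push
  rw [finsum_mem_def]
  rw [finsum_eq_sum_of_support_subset (s := s)]
  · rw [Finset.sum_filter]
    refine Finset.sum_congr rfl fun v _ => ?_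
    simp [indicator]
  · intro v hv
    by_contra h
    exact hv (by simp [indicator, hx v h])

theorem push_mem_cell [DecidableEq W] {φ : V → W} {s : Finset V} {x : V → ℝ} (hx : x ∈ cell s) :
    push φ x ∈ cell (s.image φ) := by
  refine ⟨fun w => ?_, fun w hw => ?_, ?_⟩
  · rw [push_eq_sum hx.2.1]
    exact Finset.sum_nonneg fun v _ => hx.1 v
  · rw [push_eq_sum hx.2.1]
    refine Finset.sum_eq_zero fun v hv => ?_
    rw [Finset.mem_filter] at hv
    exact absurd (Finset.mem_image.2 ⟨v, hv.1, hv.2⟩) hw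
  · rw [← hx.2.2]
    simp_rw [push_eq_sum hx.2.1]
    exact Finset.sum_fiberwise_of_maps_to (fun v hv => Finset.mem_image_of_mem φ hv) _

theorem continuousOn_push (φ : V → W) : ContinuousOn (push φ) (allCells V) := by
  classical
  rintro x₀ ⟨s, hs⟩
  refine continuousWithinAt_pi.2 fun w => ?_
  have hA : Continuous fun x : V → ℝ => ∑ v ∈ s with φ v = w, x v := by fun_prop
  have hB : Continuous fun x : V → ℝ => (∑ v ∈ s with φ v = w, x v) + (1 - ∑ v ∈ s, x v) := by
    fun_prop
  have hA' := (hA.tendsto x₀).mono_left (nhdsWithin_le_nhds (s := allCells V))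
  have hB' := (hB.tendsto x₀).mono_left (nhdsWithin_le_nhds (s := allCells V))
  rw [hs.2.2, sub_self, add_zero] at hB'
  rw [ContinuousWithinAt, push_eq_sum hs.2.1]
  refine tendsto_of_tendsto_of_tendsto_of_le_of_le' hA' hB' ?_ ?_
  all_goals
    refine eventually_nhdsWithin_of_forall fun x hx => ?_
    obtain ⟨t, ht⟩ := hx
    have ht' := cell_mono (Finset.subset_union_right (s₁ := s)) ht
    rw [push_eq_sum ht'.2.1]
  · exact Finset.sum_le_sum_of_subset_of_nonneg
      (Finset.filter_subset_filter _ Finset.subset_union_left) fun v _ _ => ht.1 v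
  · rw [← ht'.2.2]
    have h1 := Finset.sum_filter_add_sum_filter_not s (fun v => φ v = w) x
    have h2 := Finset.sum_filter_add_sum_filter_not (s ∪ t) (fun v => φ v = w) x
    have h3 : ∑ v ∈ s with ¬ φ v = w, x v ≤ ∑ v ∈ s ∪ t with ¬ φ v = w, x v :=
      Finset.sum_le_sum_of_subset_of_nonneg
        (Finset.filter_subset_filter _ Finset.subset_union_left) fun v _ _ => ht.1 v
    linarith

/-! ### A self-map of the realization that locally takes values in a single simplex -/

/-- Half of the largest barycentric coordinate is subtracted from all coordinates, negative
values are replaced by zero, and the result is normalized. -/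
noncomputable def concentrate (x : V → ℝ) : V → ℝ := fun v =>
  max (x v - (⨆ u, x u) / 2) 0 / ∑ᶠ w, max (x w - (⨆ u, x u) / 2) 0

theorem le_iSup_of_mem {x : V → ℝ} (hx : x ∈ allCells V) (v : V) : x v ≤ ⨆ u, x u := by
  obtain ⟨s, hs⟩ := hx
  refine le_ciSup (f := x) ⟨1, ?_⟩ v
  rintro _ ⟨u, rfl⟩
  simpa using sum_le_one (T := {u}) hs

theorem iSup_eq_sup' {s : Finset V} {x : V → ℝ} (hx : x ∈ allCells V) {v₀ : V} (h₀ : v₀ ∈ s)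
    (h : ∀ v, v ∉ s → x v ≤ x v₀) : ⨆ u, x u = s.sup' ⟨v₀, h₀⟩ x := by
  have : Nonempty V := ⟨v₀⟩
  refine le_antisymm (ciSup_le fun v => ?_) (Finset.sup'_le _ _ fun v _ => le_iSup_of_mem hx v)
  by_cases hv : v ∈ s
  · exact Finset.le_sup' x hv
  · exact (h v hv).trans (Finset.le_sup' x h₀)

theorem iSup_pos {x : V → ℝ} (hx : x ∈ allCells V) : 0 < ⨆ u, x u :=
  let ⟨_, hs⟩ := hx
  let ⟨v, _, hv⟩ := exists_pos_of_mem_cell hs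
  hv.trans_le (le_iSup_of_mem hx v)

theorem finsum_truncation_eq {s : Finset V} {x : V → ℝ}
    (h : ∀ v, v ∉ s → x v ≤ (⨆ u, x u) / 2) :
    ∑ᶠ w, max (x w - (⨆ u, x u) / 2) 0 = ∑ w ∈ s, max (x w - (⨆ u, x u) / 2) 0 := by
  refine finsum_eq_sum_of_support_subset _ fun v hv => ?_
  by_contra hvs
  exact hv (max_eq_right (by linarith [h v hvs]))

theorem sum_truncation_pos {s : Finset V} {x : V → ℝ} (hx : x ∈ allCells V)
    (h : ∀ v, v ∉ s → x v ≤ (⨆ u, x u) / 2) :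
    0 < ∑ w ∈ s, max (x w - (⨆ u, x u) / 2) 0 := by
  have hM := iSup_pos hx
  obtain ⟨t, ht⟩ := id hx
  obtain ⟨v₀, -, -⟩ := exists_pos_of_mem_cell ht
  have : Nonempty V := ⟨v₀⟩
  obtain ⟨v, hv⟩ := exists_lt_of_lt_ciSup (half_lt_self hM)
  have hvs : v ∈ s := by
    by_contra hvs
    exact (h v hvs).not_gt hv
  exact Finset.sum_pos' (fun _ _ => le_max_right _ _) ⟨v, hvs, lt_max_of_lt_left (by linarith)⟩

theorem concentrate_mem_cell_of_le {s : Finset V} {x : V → ℝ} (hx : x ∈ allCells V)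
    (h : ∀ v, v ∉ s → x v ≤ (⨆ u, x u) / 2) : concentrate x ∈ cell s := by
  have hpos := sum_truncation_pos hx h
  refine ⟨fun v => ?_, fun v hv => ?_, ?_⟩
  · rw [concentrate, finsum_truncation_eq h]
    exact div_nonneg (le_max_right _ _) hpos.le
  · rw [concentrate, max_eq_right (by linarith [h v hv]), zero_div]
  · simp only [concentrate]
    rw [finsum_truncation_eq h, ← Finset.sum_div, div_self hpos.ne']

theorem concentrate_mem_cell {s : Finset V} {x : V → ℝ} (hx : x ∈ cell s) :
    concentrate x ∈ cell s :=
  concentrate_mem_cell_of_le ⟨s, hx⟩ fun v hv => by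
    rw [hx.2.1 v hv]
    exact (half_pos (iSup_pos ⟨s, hx⟩)).le

theorem eventually_le_half {s : Finset V} {x₀ : V → ℝ} (hx : x₀ ∈ cell s) :
    ∃ v₀ ∈ s, ∀ᶠ x in 𝓝[allCells V] x₀, ∀ v, v ∉ s → x v ≤ x v₀ / 2 := by
  obtain ⟨v₀, hv₀, hpos⟩ := exists_pos_of_mem_cell hx
  refine ⟨v₀, hv₀, ?_⟩
  have hA : Continuous fun x : V → ℝ => 1 - ∑ v ∈ s, x v := by fun_prop
  have hB : Continuous fun x : V → ℝ => x v₀ / 2 := by fun_prop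
  have : ∀ᶠ x in 𝓝 x₀, 1 - ∑ v ∈ s, x v < x v₀ / 2 :=
    hA.continuousAt.eventually_lt hB.continuousAt (by rw [hx.2.2]; linarith)
  filter_upwards [nhdsWithin_le_nhds this, self_mem_nhdsWithin] with x h hx' v hv
  exact (le_one_sub_sum hx' hv).trans h.le

theorem eventually_le_half_iSup {s : Finset V} {x₀ : V → ℝ} (hx : x₀ ∈ cell s) :
    ∀ᶠ x in 𝓝[allCells V] x₀, ∀ v, v ∉ s → x v ≤ (⨆ u, x u) / 2 := by
  obtain ⟨v₀, -, h⟩ := eventually_le_half hx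
  filter_upwards [h, self_mem_nhdsWithin] with x h hx' v hv
  linarith [h v hv, le_iSup_of_mem hx' v₀]

theorem eventually_concentrate_mem_cell {s : Finset V} {x₀ : V → ℝ} (hx : x₀ ∈ cell s) :
    ∀ᶠ x in 𝓝[allCells V] x₀, concentrate x ∈ cell s := by
  filter_upwards [eventually_le_half_iSup hx, self_mem_nhdsWithin] with x h hx'
  exact concentrate_mem_cell_of_le hx' h

theorem continuousOn_iSup : ContinuousOn (fun x : V → ℝ => ⨆ u, x u) (allCells V) := by
  rintro x₀ ⟨s, hs⟩
  obtain ⟨v₀, hv₀, h⟩ := eventually_le_half hs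
  have hc : Continuous fun x : V → ℝ => s.sup' ⟨v₀, hv₀⟩ x :=
    Continuous.finset_sup'_apply _ fun v _ => continuous_apply v
  have heq : (fun x : V → ℝ => ⨆ u, x u) =ᶠ[𝓝[allCells V] x₀] fun x => s.sup' ⟨v₀, hv₀⟩ x := by
    filter_upwards [h, self_mem_nhdsWithin] with x h hx'
    refine iSup_eq_sup' hx' hv₀ fun v hv => ?_
    obtain ⟨t, ht⟩ := hx'
    linarith [h v hv, ht.1 v₀]
  exact hc.continuousWithinAt.congr_of_eventuallyEq heq (heq.self_of_nhdsWithin ⟨s, hs⟩)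

theorem continuousOn_concentrate : ContinuousOn concentrate (allCells V) := by
  rintro x₀ ⟨s, hs⟩
  have hmem : x₀ ∈ allCells V := ⟨s, hs⟩
  have h := eventually_le_half_iSup hs
  have h₀ := h.self_of_nhdsWithin hmem
  have hM := continuousOn_iSup x₀ hmem
  have hT : ∀ v, ContinuousWithinAt (fun x : V → ℝ => max (x v - (⨆ u, x u) / 2) 0)
      (allCells V) x₀ := fun v =>
    ((continuous_apply v).continuousWithinAt.sub (hM.div_const 2)).max continuousWithinAt_const
  refine continuousWithinAt_pi.2 fun v => ?_
  have heq : (fun x : V → ℝ => concentrate x v) =ᶠ[𝓝[allCells V] x₀] fun x =>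
      max (x v - (⨆ u, x u) / 2) 0 / ∑ w ∈ s, max (x w - (⨆ u, x u) / 2) 0 := by
    filter_upwards [h] with x h
    rw [concentrate, finsum_truncation_eq h]
  refine ContinuousWithinAt.congr_of_eventuallyEq ?_ heq (heq.self_of_nhdsWithin hmem)
  exact (hT v).div (tendsto_finsetSum s fun w _ => hT w) (sum_truncation_pos hmem h₀).ne'

end Cells

end ASC

namespace ASC

/-! ### Extension of maps over cones with contractible carriers -/

section Extension

variable {V Z : Type}

theorem exists_contraction [TopologicalSpace Z] (C : Set Z) [ContractibleSpace C] :
    ∃ h : Z → ℝ → Z, ContinuousOn (Function.uncurry h) (C ×ˢ univ) ∧ (∀ z ∈ C, h z 0 = z) ∧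
      (∀ z z', h z 1 = h z' 1) ∧ ∀ z t, h z t ∈ C := by
  classical
  obtain ⟨c, ⟨H⟩⟩ := id_nullhomotopic C
  refine ⟨fun z t => if hz : z ∈ C then (H (projIcc 0 1 zero_le_one t, ⟨z, hz⟩) : Z) else c,
    ?_, fun z hz => ?_, fun z z' => ?_, fun z t => ?_⟩
  · rw [continuousOn_iff_continuous_domRestrict]
    have : Continuous fun p : ↥(C ×ˢ (univ : Set ℝ)) =>
        (H (projIcc 0 1 zero_le_one p.1.2, ⟨p.1.1, p.2.1⟩) : Z) := by
      have := continuous_projIcc (a := (0 : ℝ)) (b := 1) (h := zero_le_one)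
      fun_prop
    refine this.congr fun p => ?_
    have hp : p.1.1 ∈ C := p.2.1
    simp [Function.uncurry, hp]
  · simp [hz]
  · have : ∀ z : Z, (if hz : z ∈ C then (H (projIcc 0 1 zero_le_one (1 : ℝ), ⟨z, hz⟩) : Z) else c)
        = c := by
      intro z
      split_ifs <;> simp
    exact (this z).trans (this z').symm
  · dsimp only
    split_ifs
    · exact Subtype.coe_prop _
    · exact c.2

open Classical in
/-- The support of a point as a finite set. -/
noncomputable def supp (y : V → ℝ) : Finset V :=
  if h : (Function.support y).Finite then h.toFinset else ∅

theorem supp_eq {y : V → ℝ} {s : Finset V} (h : ∀ v, y v ≠ 0 ↔ v ∈ s) : supp y = s := by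
  have hs : Function.support y = s := by ext v; simp [h]
  have hf : (Function.support y).Finite := hs ▸ s.finite_toSet
  rw [supp, dif_pos hf]
  ext v; simp [h]

theorem mem_supp {y : V → ℝ} {s : Finset V} (hy : y ∈ cell s) {v : V} : v ∈ supp y ↔ y v ≠ 0 := by
  classical
  rw [supp_eq (s := s.filter fun v => y v ≠ 0)]
  · simp only [Finset.mem_filter, and_iff_right_iff_imp]
    exact fun h => by_contra fun hv => h (hy.2.1 v hv)
  · intro v
    simp only [Finset.mem_filter, iff_and_self]
    exact fun h => by_contra fun hv => h (hy.2.1 v hv)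

theorem supp_subset {y : V → ℝ} {s : Finset V} (hy : y ∈ cell s) : supp y ⊆ s := fun v hv =>
  by_contra fun h => (mem_supp hy).1 hv (hy.2.1 v h)

theorem supp_nonempty {y : V → ℝ} {s : Finset V} (hy : y ∈ cell s) : (supp y).Nonempty :=
  let ⟨v, _, hv⟩ := exists_pos_of_mem_cell hy
  ⟨v, (mem_supp hy).2 hv.ne'⟩

open Classical in
/-- The barycenter of a simplex. -/
noncomputable def barycenter (s : Finset V) : V → ℝ := fun v => if v ∈ s then (s.card : ℝ)⁻¹ else 0

theorem barycenter_mem_cell {s : Finset V} (hs : s.Nonempty) : barycenter s ∈ cell s := by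
  refine ⟨fun v => ?_, fun v hv => by simp [barycenter, hv], ?_⟩
  · unfold barycenter
    split_ifs <;> positivity
  · have : (s.card : ℝ) ≠ 0 := by exact_mod_cast hs.card_pos.ne'
    simp [barycenter, this]

/-- The part of `1` taken by the barycenter when `y` is written as a convex combination of the
barycenter of its supporting simplex and a boundary point. -/
noncomputable def coneHeight (y : V → ℝ) : ℝ := (supp y).card * ⨅ v : supp y, y v

/-- The radial projection away from the barycenter to the boundary of the supporting simplex. -/
noncomputable def coneBase (y : V → ℝ) : V → ℝ :=
  (1 - coneHeight y)⁻¹ • (y - coneHeight y • barycenter (supp y))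

open Classical in
/-- The map defined on `L` by `g₀` and on the other simplices by coning off, where `h s`
prescribes the cone over the boundary of `s`. -/
noncomputable def coneExtend (L : Set (Finset V)) (g₀ : (V → ℝ) → Z)
    (h : Finset V → Z → ℝ → Z) (y : V → ℝ) : Z :=
  if supp y ∈ L then g₀ y
  else if _ : (supp (coneBase y)).card < (supp y).card then
    h (supp y) (coneExtend L g₀ h (coneBase y)) (coneHeight y)
  else g₀ y
termination_by (supp y).card

/-- The boundary of a closed simplex. -/
def cellBoundary (s : Finset V) : Set (V → ℝ) := {z | z ∈ cell s ∧ ∃ v ∈ s, z v = 0}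

theorem exists_cone_coordinates {s : Finset V} {y : V → ℝ} (hy : y ∈ cell s) :
    ∃ z : V → ℝ, ∃ t ∈ Icc (0 : ℝ) 1, y = (1 - t) • z + t • barycenter s ∧
      (t < 1 → z ∈ cellBoundary s) := by
  obtain ⟨u, hu, -⟩ := exists_pos_of_mem_cell hy
  have hs : s.Nonempty := ⟨u, hu⟩
  have hc : (0 : ℝ) < s.card := by exact_mod_cast hs.card_pos
  obtain ⟨v, hv, hmin⟩ := s.exists_min_image y hs
  have hb := barycenter_mem_cell hs
  have hle : s.card * y v ≤ 1 := by
    rw [← hy.2.2, ← nsmul_eq_mul]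
    exact Finset.card_nsmul_le_sum _ _ _ hmin
  have hnn : 0 ≤ s.card * y v := mul_nonneg hc.le (hy.1 v)
  have hbv : ∀ w ∈ s, s.card * y v * barycenter s w = y v := fun w hw => by
    simp only [barycenter, hw, if_true]
    field_simp
  obtain hlt | heq := hle.lt_or_eq
  · have hne : 1 - s.card * y v ≠ 0 := by linarith
    have hp : 0 < 1 - s.card * y v := by linarith
    refine ⟨(1 - s.card * y v)⁻¹ • (y - (s.card * y v) • barycenter s), s.card * y v, ⟨hnn, hle⟩,
      ?_, fun _ => ⟨⟨fun w => ?_, fun w hw => ?_, ?_⟩, v, hv, ?_⟩⟩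
    · rw [smul_smul, mul_inv_cancel₀ hne, one_smul, sub_add_cancel]
    · by_cases hw : w ∈ s
      · simp only [Pi.smul_apply, Pi.sub_apply, smul_eq_mul, hbv w hw]
        exact mul_nonneg (inv_nonneg.2 hp.le) (by linarith [hmin w hw])
      · simp [hy.2.1 w hw, hb.2.1 w hw]
    · simp [hy.2.1 w hw, hb.2.1 w hw]
    · simp only [Pi.smul_apply, Pi.sub_apply, smul_eq_mul]
      rw [← Finset.mul_sum, Finset.sum_sub_distrib, ← Finset.mul_sum, hy.2.2, hb.2.2, mul_one,
        inv_mul_cancel₀ hne]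
    · simp only [Pi.smul_apply, Pi.sub_apply, smul_eq_mul, hbv v hv]
      simp
  · refine ⟨y, 1, by simp, ?_, fun h => absurd h (lt_irrefl _)⟩
    have hsum : ∑ w ∈ s, (y w - y v) = 0 := by
      rw [Finset.sum_sub_distrib, hy.2.2, Finset.sum_const, nsmul_eq_mul, heq, sub_self]
    rw [Finset.sum_eq_zero_iff_of_nonneg fun w hw => sub_nonneg.2 (hmin w hw)] at hsum
    simp only [sub_self, zero_smul, zero_add, one_smul]
    funext w
    by_cases hw : w ∈ s
    · have := hbv w hw
      rw [heq, one_mul] at this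
      linarith [hsum w hw]
    · rw [hy.2.1 w hw, hb.2.1 w hw]

theorem coneExtend_combo {L : Set (Finset V)} {g₀ : (V → ℝ) → Z} {h : Finset V → Z → ℝ → Z}
    {s : Finset V} (hs : s.Nonempty) (hL : s ∉ L) (h1 : ∀ z z', h s z 1 = h s z' 1)
    {z : V → ℝ} {t : ℝ} (ht0 : 0 < t) (ht1 : t ≤ 1) (hz : t < 1 → z ∈ cellBoundary s) :
    coneExtend L g₀ h ((1 - t) • z + t • barycenter s) = h s (coneExtend L g₀ h z) t := by
  have hc : (0 : ℝ) < s.card := by exact_mod_cast hs.card_pos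
  have hb := barycenter_mem_cell hs
  set y := (1 - t) • z + t • barycenter s with hy
  have hys : ∀ v ∈ s, y v = (1 - t) * z v + t * (s.card : ℝ)⁻¹ := fun v hv => by
    simp [hy, barycenter, hv]
  have hznn : ∀ v, 0 ≤ (1 - t) * z v := fun v => by
    obtain h | rfl := ht1.lt_or_eq
    · exact mul_nonneg (by linarith) ((hz h).1.1 v)
    · simp
  have hz0 : ∃ v ∈ s, (1 - t) * z v = 0 := by
    obtain h | rfl := ht1.lt_or_eq
    · obtain ⟨v, hv, h0⟩ := (hz h).2
      exact ⟨v, hv, by simp [h0]⟩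
    · obtain ⟨v, hv⟩ := hs
      exact ⟨v, hv, by simp⟩
  have htc : 0 < t * (s.card : ℝ)⁻¹ := by positivity
  have hsupp : supp y = s := by
    refine supp_eq fun v => ⟨fun hv => ?_, fun hv => ?_⟩
    · by_contra hvs
      refine hv ?_
      have : (1 - t) * z v = 0 := by
        obtain h | rfl := ht1.lt_or_eq
        · rw [(hz h).1.2.1 v hvs, mul_zero]
        · simp
      simp [hy, this, hb.2.1 v hvs]
    · rw [hys v hv]
      linarith [hznn v]
  have hheight : coneHeight y = t := by
    rw [coneHeight, hsupp]
    have : ⨅ v : s, y v = t * (s.card : ℝ)⁻¹ := by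
      obtain ⟨v, hv, h0⟩ := hz0
      have : Nonempty s := ⟨⟨v, hv⟩⟩
      refine le_antisymm ?_ (le_ciInf fun w => by rw [hys w w.2]; linarith [hznn w])
      have hbdd : BddBelow (range fun w : s => y w) := by
        refine ⟨0, ?_⟩
        rintro _ ⟨w, rfl⟩
        dsimp only
        rw [hys w w.2]
        linarith [hznn w]
      refine (ciInf_le hbdd ⟨v, hv⟩).trans ?_
      dsimp only
      rw [hys v hv, h0, zero_add]
    rw [this]
    field_simp
  have hbase : coneBase y = (1 - t)⁻¹ • (1 - t) • z := by
    rw [coneBase, hheight, hsupp, hy, add_sub_cancel_right]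
  rw [coneExtend, hsupp, if_neg hL, hheight, hbase]
  obtain hlt | rfl := ht1.lt_or_eq
  · have hzs := hz hlt
    rw [inv_smul_smul₀ (by linarith : 1 - t ≠ 0), dif_pos]
    refine Finset.card_lt_card (Finset.ssubset_iff_subset_ne.2 ⟨supp_subset hzs.1, fun h => ?_⟩)
    obtain ⟨v, hv, h0⟩ := hzs.2
    rw [← h] at hv
    exact (mem_supp hzs.1).1 hv h0
  · rw [dif_pos]
    · exact h1 _ _
    · rw [supp_eq (s := ∅) (by simp), Finset.card_empty]
      exact hs.card_pos

theorem continuousOn_image_of_comp {P Q : Type} [TopologicalSpace P] [T2Space P]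
    [TopologicalSpace Q] [T2Space Q] [TopologicalSpace Z] {q : P → Q} {A : Set P} {G : Q → Z}
    (hA : IsCompact A) (hq : ContinuousOn q A) (hG : ContinuousOn (G ∘ q) A) :
    ContinuousOn G (q '' A) := by
  rw [continuousOn_iff_isClosed]
  intro F hF
  have hcl := hG.preimage_isClosed_of_isClosed hA.isClosed hF
  refine ⟨q '' (A ∩ (G ∘ q) ⁻¹' F),
    ((hA.of_isClosed_subset hcl inter_subset_left).image_of_continuousOn
      (hq.mono inter_subset_left)).isClosed, ?_⟩
  ext y
  constructor
  · rintro ⟨hy, x, hx, rfl⟩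
    exact ⟨⟨x, ⟨hx, hy⟩, rfl⟩, x, hx, rfl⟩
  · rintro ⟨⟨x, ⟨hx, hy⟩, rfl⟩, -⟩
    exact ⟨hy, x, hx, rfl⟩

theorem cellBoundary_eq [DecidableEq V] (s : Finset V) :
    cellBoundary s = ⋃ v : s, cell (s.erase v) := by
  ext z
  simp only [cellBoundary, mem_ofPred_eq, mem_iUnion]
  constructor
  · rintro ⟨hz, v, hv, h0⟩
    refine ⟨⟨v, hv⟩, hz.1, fun w hw => ?_, ?_⟩
    · by_cases hws : w ∈ s
      · obtain rfl : w = v := by simpa [hws] using hw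
        exact h0
      · exact hz.2.1 w hws
    · have := hz.2.2
      rw [← Finset.add_sum_erase s _ hv, h0, zero_add] at this
      exact this
  · rintro ⟨⟨v, hv⟩, hz⟩
    exact ⟨cell_mono (Finset.erase_subset _ _) hz, v, hv, hz.2.1 v (by simp)⟩

theorem coneExtend_cell (K : ASC V) [TopologicalSpace Z] {L : Set (Finset V)}
    (hL : ∀ ⦃s t : Finset V⦄, s ∈ L → t ⊆ s → t.Nonempty → t ∈ L) {C : Finset V → Set Z}
    (hC : ∀ ⦃s t : Finset V⦄, t ∈ K.faces → s ⊆ t → C s ⊆ C t)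
    {g₀ : (V → ℝ) → Z} (hg₀ : ∀ s ∈ L, ContinuousOn g₀ (cell s))
    (hg₀C : ∀ s ∈ L, MapsTo g₀ (cell s) (C s)) {h : Finset V → Z → ℝ → Z}
    (hcont : ∀ s ∈ K.faces, ContinuousOn (Function.uncurry (h s)) (C s ×ˢ univ))
    (h0 : ∀ s ∈ K.faces, ∀ z ∈ C s, h s z 0 = z)
    (h1 : ∀ s ∈ K.faces, ∀ z z', h s z 1 = h s z' 1)
    (hmem : ∀ s ∈ K.faces, ∀ z t, h s z t ∈ C s) (n : ℕ) :
    ∀ s ∈ K.faces, s.card = n →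
      ContinuousOn (coneExtend L g₀ h) (cell s) ∧ MapsTo (coneExtend L g₀ h) (cell s) (C s) := by
  classical
  induction n using Nat.strong_induction_on with
  | _ n ih =>
  intro s hs hn
  by_cases hsL : s ∈ L
  · have heq : EqOn (coneExtend L g₀ h) g₀ (cell s) := fun y hy => by
      rw [coneExtend, if_pos (hL hsL (supp_subset hy) (supp_nonempty hy))]
    exact ⟨(hg₀ s hsL).congr heq, (hg₀C s hsL).congr heq.symm⟩
  set G := coneExtend L g₀ h
  have hne := K.nonempty_of_mem hs
  have hcone : ∀ {z : V → ℝ} {t : ℝ}, 0 < t → t ≤ 1 → (t < 1 → z ∈ cellBoundary s) →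
      G ((1 - t) • z + t • barycenter s) = h s (G z) t :=
    fun {z t} => coneExtend_combo hne hsL (h1 s hs)
  have hface : ∀ v : s, ContinuousOn G (cell (s.erase v)) ∧
      MapsTo G (cell (s.erase v)) (C s) := by
    rintro ⟨v, hv⟩
    obtain he | he := (s.erase v).eq_empty_or_nonempty
    · have : cell (s.erase v) = ∅ := by
        rw [he, eq_empty_iff_forall_notMem]
        intro x hx
        simpa using hx.2.2
      rw [this]
      exact ⟨continuousOn_empty _, mapsTo_empty _ _⟩
    · have := ih _ (hn ▸ Finset.card_erase_lt_of_mem hv) _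
        (K.down_closed hs (Finset.erase_subset v s) he) rfl
      exact ⟨this.1, this.2.mono_right (hC hs (Finset.erase_subset v s))⟩
  have hbc : ContinuousOn G (cellBoundary s) := by
    rw [cellBoundary_eq]
    exact (locallyFinite_of_finite _).continuousOn_iUnion (fun v => isClosed_cell _)
      fun v => (hface v).1
  have hbm : MapsTo G (cellBoundary s) (C s) := by
    rw [cellBoundary_eq, mapsTo_iUnion]
    exact fun v => (hface v).2
  refine ⟨?_, fun y hy => ?_⟩
  · obtain he | ⟨z₀, hz₀⟩ := (cellBoundary s).eq_empty_or_nonempty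
    · refine (Set.Subsingleton.continuousOn (s := {barycenter s}) (by simp) G).mono fun y hy => ?_
      obtain ⟨z, t, ht, rfl, hz⟩ := exists_cone_coordinates hy
      obtain hlt | rfl := ht.2.lt_or_eq
      · simpa [he] using hz hlt
      · simp
    have hcomp : IsCompact (cellBoundary s ×ˢ Icc (0 : ℝ) 1) := by
      refine IsCompact.prod ?_ isCompact_Icc
      rw [cellBoundary_eq]
      exact isCompact_iUnion fun v => isCompact_cell _
    have hsub : cell s ⊆ (fun p : (V → ℝ) × ℝ => (1 - p.2) • p.1 + p.2 • barycenter s) ''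
        (cellBoundary s ×ˢ Icc (0 : ℝ) 1) := fun y hy => by
      obtain ⟨z, t, ht, rfl, hz⟩ := exists_cone_coordinates hy
      obtain hlt | rfl := ht.2.lt_or_eq
      · exact ⟨(z, t), ⟨hz hlt, ht⟩, rfl⟩
      · exact ⟨(z₀, 1), ⟨hz₀, ht⟩, by simp⟩
    refine (continuousOn_image_of_comp hcomp (by fun_prop) ?_).mono hsub
    have : ContinuousOn (fun p : (V → ℝ) × ℝ => h s (G p.1) p.2)
        (cellBoundary s ×ˢ Icc (0 : ℝ) 1) := by
      refine (hcont s hs).comp (f := fun p : (V → ℝ) × ℝ => (G p.1, p.2)) ?_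
        fun p hp => ⟨hbm hp.1, mem_univ _⟩
      exact (hbc.comp continuousOn_fst fun p hp => hp.1).prodMk continuousOn_snd
    refine this.congr fun p hp => ?_
    obtain hlt | heq := hp.2.1.lt_or_eq
    · exact hcone hlt hp.2.2 fun _ => hp.1
    · simp only [Function.comp, ← heq, sub_zero, one_smul, zero_smul, add_zero]
      exact (h0 s hs _ (hbm hp.1)).symm
  · obtain ⟨z, t, ht, rfl, hz⟩ := exists_cone_coordinates hy
    obtain hlt | rfl := ht.1.lt_or_eq
    · rw [hcone hlt ht.2 hz]
      exact hmem s hs _ _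
    · simpa using hbm (hz zero_lt_one)

/-- A map on a subcomplex that is continuous on every closed simplex and carried by contractible
sets extends to the whole complex. -/
theorem exists_extension (K : ASC V) [TopologicalSpace Z] {L : Set (Finset V)}
    (hL : ∀ ⦃s t : Finset V⦄, s ∈ L → t ⊆ s → t.Nonempty → t ∈ L) {C : Finset V → Set Z}
    (hC : ∀ ⦃s t : Finset V⦄, t ∈ K.faces → s ⊆ t → C s ⊆ C t)
    (hcontr : ∀ s ∈ K.faces, ContractibleSpace (C s))
    {g₀ : (V → ℝ) → Z} (hg₀ : ∀ s ∈ L, ContinuousOn g₀ (cell s))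
    (hg₀C : ∀ s ∈ L, MapsTo g₀ (cell s) (C s)) :
    ∃ G : (V → ℝ) → Z, (∀ s ∈ K.faces, ContinuousOn G (cell s)) ∧
      (∀ s ∈ K.faces, MapsTo G (cell s) (C s)) ∧ ∀ s ∈ L, EqOn G g₀ (cell s) := by
  have : ∀ s : Finset V, ∃ h : Z → ℝ → Z, s ∈ K.faces →
      ContinuousOn (Function.uncurry h) (C s ×ˢ univ) ∧ (∀ z ∈ C s, h z 0 = z) ∧
      (∀ z z', h z 1 = h z' 1) ∧ ∀ z t, h z t ∈ C s := fun s => by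
    by_cases hs : s ∈ K.faces
    · have := hcontr s hs
      obtain ⟨h, hh⟩ := exists_contraction (C s)
      exact ⟨h, fun _ => hh⟩
    · exact ⟨fun z _ => z, fun h => absurd h hs⟩
  choose h hh using this
  have key := fun s hs => coneExtend_cell K hL hC hg₀ hg₀C (fun s hs => (hh s hs).1)
    (fun s hs => (hh s hs).2.1) (fun s hs => (hh s hs).2.2.1) (fun s hs => (hh s hs).2.2.2)
    s.card s hs rfl
  refine ⟨coneExtend L g₀ h, fun s hs => (key s hs).1, fun s hs => (key s hs).2,
    fun s hs y hy => ?_⟩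
  rw [coneExtend, if_pos (hL hs (supp_subset hy) (supp_nonempty hy))]

end Extension

end ASC

namespace ASC

/-! ### Homotopies -/

section Homotopies

variable {V W T Z : Type} [TopologicalSpace T] [TopologicalSpace Z]

theorem continuous_comp_of_eventually_mem_cell {K : ASC V} {G : (V → ℝ) → Z}
    (hG : ∀ s ∈ K.faces, ContinuousOn G (cell s)) {u : T → V → ℝ} (hu : Continuous u)
    (h : ∀ t, ∃ s ∈ K.faces, ∀ᶠ t' in 𝓝 t, u t' ∈ cell s) : Continuous fun t => G (u t) := by
  refine continuous_iff_continuousAt.2 fun t => ?_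
  obtain ⟨s, hs, ht⟩ := h t
  have hmem : u ⁻¹' cell s ∈ 𝓝 t := ht
  exact ((hG s hs).comp hu.continuousOn (mapsTo_preimage u (cell s))).continuousAt hmem

theorem homotopic_of_mem_cell {K : ASC V} (a b : C(T, K.space))
    (h : ∀ t, ∃ s ∈ K.faces, (a t : V → ℝ) ∈ cell s ∧ (b t : V → ℝ) ∈ cell s) :
    a.Homotopic b := by
  refine ⟨⟨⟨fun p => ⟨(1 - (p.1 : ℝ)) • (a p.2 : V → ℝ) + (p.1 : ℝ) • (b p.2 : V → ℝ), ?_⟩, ?_⟩,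
    fun t => ?_, fun t => ?_⟩⟩
  · obtain ⟨s, hs, ha, hb⟩ := h p.2
    exact cell_subset_space hs (cell_combo ha hb p.1.2.1 p.1.2.2)
  · fun_prop
  · ext; simp
  · ext; simp

/-- The complex on `V × Bool` of all sets of vertices projecting to a face of `K`; its realization
contains the cylinder over the realization of `K`. -/
def cylinder [DecidableEq V] (K : ASC V) : ASC (V × Bool) where
  faces := {s | s.image Prod.fst ∈ K.faces}
  nonempty_of_mem := fun _ hs => Finset.image_nonempty.1 (K.nonempty_of_mem hs)
  down_closed := fun _ _ hs hts ht =>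
    K.down_closed hs (Finset.image_subset_image hts) (ht.image _)

theorem product_mem_cylinder_faces [DecidableEq V] {K : ASC V} {s : Finset V} (hs : s ∈ K.faces)
    {I : Finset Bool} (hI : I.Nonempty) : s ×ˢ I ∈ K.cylinder.faces := by
  change (s ×ˢ I).image Prod.fst ∈ K.faces
  rwa [Finset.product_image_fst hI]

/-- The point at height `t` over `x` in the cylinder. -/
def cylinderPoint (t : ℝ) (x : V → ℝ) : V × Bool → ℝ
  | (v, false) => (1 - t) * x v
  | (v, true) => t * x v

theorem continuous_cylinderPoint :
    Continuous fun p : ℝ × (V → ℝ) => cylinderPoint p.1 p.2 := by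
  refine continuous_pi ?_
  rintro ⟨v, _ | _⟩ <;> simp only [cylinderPoint] <;> fun_prop

theorem cylinderPoint_mem_cell {s : Finset V} {x : V → ℝ} (hx : x ∈ cell s)
    {t : ℝ} (h0 : 0 ≤ t) (h1 : t ≤ 1) :
    cylinderPoint t x ∈ cell (s ×ˢ (Finset.univ : Finset Bool)) := by
  refine ⟨?_, ?_, ?_⟩
  · rintro ⟨v, _ | _⟩
    · exact mul_nonneg (sub_nonneg.2 h1) (hx.1 v)
    · exact mul_nonneg h0 (hx.1 v)
  · rintro ⟨v, _ | _⟩ hv <;> simp [cylinderPoint, hx.2.1 v (by simpa using hv)]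
  · rw [Finset.sum_product]
    simp only [Fintype.sum_bool, cylinderPoint]
    exact (Finset.sum_congr rfl fun v _ => by ring).trans hx.2.2

theorem cylinderPoint_zero_mem_cell {s : Finset V} {x : V → ℝ} (hx : x ∈ cell s) :
    cylinderPoint 0 x ∈ cell (s ×ˢ {false}) := by
  refine ⟨(cylinderPoint_mem_cell hx le_rfl zero_le_one).1, ?_, ?_⟩
  · rintro ⟨v, _ | _⟩ hv
    · simp [cylinderPoint, hx.2.1 v (by simpa using hv)]
    · simp [cylinderPoint]
  · rw [Finset.sum_product]
    simp [cylinderPoint, hx.2.2]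

theorem cylinderPoint_one_mem_cell {s : Finset V} {x : V → ℝ} (hx : x ∈ cell s) :
    cylinderPoint 1 x ∈ cell (s ×ˢ {true}) := by
  refine ⟨(cylinderPoint_mem_cell hx zero_le_one le_rfl).1, ?_, ?_⟩
  · rintro ⟨v, _ | _⟩ hv
    · simp [cylinderPoint]
    · simp [cylinderPoint, hx.2.1 v (by simpa using hv)]
  · rw [Finset.sum_product]
    simp [cylinderPoint, hx.2.2]

theorem slice_mem_cell [DecidableEq V] {s : Finset (V × Bool)} {i : Bool}
    (hs : ∀ p ∈ s, p.2 = i) {y : V × Bool → ℝ} (hy : y ∈ cell s) :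
    (fun v => y (v, i)) ∈ cell (s.image Prod.fst) := by
  refine ⟨fun v => hy.1 _, fun v hv => hy.2.1 _ fun h => hv (Finset.mem_image_of_mem _ h), ?_⟩
  rw [← hy.2.2, Finset.sum_image]
  · exact Finset.sum_congr rfl fun p hp => by rw [← hs p hp]
  · intro p hp q hq hpq
    exact Prod.ext hpq ((hs p hp).trans (hs q hq).symm)

/-- Two maps that are continuous on closed simplices and carried by contractible sets are related
by a homotopy that is continuous on closed simplices of the cylinder. -/
theorem exists_cylinder_homotopy [DecidableEq V] (K : ASC V) {C : Finset V → Set Z}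
    (hC : ∀ ⦃s t : Finset V⦄, t ∈ K.faces → s ⊆ t → C s ⊆ C t)
    (hcontr : ∀ s ∈ K.faces, ContractibleSpace (C s)) {a b : (V → ℝ) → Z}
    (ha : ∀ s ∈ K.faces, ContinuousOn a (cell s)) (haC : ∀ s ∈ K.faces, MapsTo a (cell s) (C s))
    (hb : ∀ s ∈ K.faces, ContinuousOn b (cell s)) (hbC : ∀ s ∈ K.faces, MapsTo b (cell s) (C s)) :
    ∃ H : (V × Bool → ℝ) → Z, (∀ s ∈ K.cylinder.faces, ContinuousOn H (cell s)) ∧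
      (∀ x ∈ K.space, H (cylinderPoint 0 x) = a x) ∧
      ∀ x ∈ K.space, H (cylinderPoint 1 x) = b x := by
  classical
  let L : Set (Finset (V × Bool)) :=
    {s | s ∈ K.cylinder.faces ∧ ((∀ p ∈ s, p.2 = false) ∨ ∀ p ∈ s, p.2 = true)}
  let g₀ : (V × Bool → ℝ) → Z := fun y =>
    if ∀ v, y (v, true) = 0 then a fun v => y (v, false) else b fun v => y (v, true)
  have hfalse : ∀ {s : Finset (V × Bool)}, (∀ p ∈ s, p.2 = false) →
      EqOn g₀ (fun y => a fun v => y (v, false)) (cell s) := fun {s} hs y hy =>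
    if_pos fun v => hy.2.1 _ fun h => by simpa using hs _ h
  have htrue : ∀ {s : Finset (V × Bool)}, (∀ p ∈ s, p.2 = true) →
      EqOn g₀ (fun y => b fun v => y (v, true)) (cell s) := fun {s} hs y hy => by
    refine if_neg fun h => ?_
    obtain ⟨⟨v, i⟩, hp, hpos⟩ := exists_pos_of_mem_cell hy
    obtain rfl : i = true := hs _ hp
    exact hpos.ne' (h v)
  have hL : ∀ ⦃s t : Finset (V × Bool)⦄, s ∈ L → t ⊆ s → t.Nonempty → t ∈ L :=
    fun s t hs hts ht => ⟨K.cylinder.down_closed hs.1 hts ht,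
      hs.2.imp (fun h p hp => h p (hts hp)) fun h p hp => h p (hts hp)⟩
  obtain ⟨H, hH, -, hHL⟩ := exists_extension K.cylinder hL
    (C := fun s => C (s.image Prod.fst)) (fun s t ht hst => hC ht (Finset.image_subset_image hst))
    (fun s hs => hcontr _ hs) (g₀ := g₀)
    (by
      rintro s ⟨hs, h | h⟩
      · have hc : ContinuousOn (fun y : V × Bool → ℝ => a fun v => y (v, false)) (cell s) :=
          (ha _ hs).comp (f := fun (y : V × Bool → ℝ) v => y (v, false)) (by fun_prop)
            fun y hy => slice_mem_cell h hy
        exact hc.congr (hfalse h)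
      · have hc : ContinuousOn (fun y : V × Bool → ℝ => b fun v => y (v, true)) (cell s) :=
          (hb _ hs).comp (f := fun (y : V × Bool → ℝ) v => y (v, true)) (by fun_prop)
            fun y hy => slice_mem_cell h hy
        exact hc.congr (htrue h))
    (by
      rintro s ⟨hs, h | h⟩ y hy
      · rw [hfalse h hy]
        exact haC _ hs (slice_mem_cell h hy)
      · rw [htrue h hy]
        exact hbC _ hs (slice_mem_cell h hy))
  refine ⟨H, hH, fun x hx => ?_, fun x hx => ?_⟩
  all_goals obtain ⟨s, hs, hxs⟩ := mem_space_iff.1 hx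
  · have hlev : ∀ p ∈ s ×ˢ {false}, p.2 = false := by simp
    have hmem := cylinderPoint_zero_mem_cell hxs
    have hface : s ×ˢ {false} ∈ L :=
      ⟨product_mem_cylinder_faces hs (Finset.singleton_nonempty _), .inl hlev⟩
    rw [hHL _ hface hmem, hfalse hlev hmem]
    simp [cylinderPoint]
  · have hlev : ∀ p ∈ s ×ˢ {true}, p.2 = true := by simp
    have hmem := cylinderPoint_one_mem_cell hxs
    have hface : s ×ˢ {true} ∈ L :=
      ⟨product_mem_cylinder_faces hs (Finset.singleton_nonempty _), .inr hlev⟩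
    rw [hHL _ hface hmem, htrue hlev hmem]
    simp [cylinderPoint]

end Homotopies

section Maps

variable {V W : Type}

/-- The map of realizations induced by a simplicial map. -/
noncomputable def pushMap [DecidableEq W] {X : ASC V} {Y : ASC W} {φ : V → W}
    (hφ : X.IsSimplicial Y φ) : C(X.space, Y.space) where
  toFun x := ⟨push φ x, by
    obtain ⟨s, hs, hx⟩ := mem_space_iff.1 x.2
    exact cell_subset_space (hφ s hs) (push_mem_cell hx)⟩
  continuous_toFun := by
    have := (continuousOn_push φ).mono X.space_subset_allCells
    exact this.domRestrict.subtype_mk _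

/-- `concentrate` as a self-map of the realization. -/
noncomputable def concentrateMap (K : ASC V) : C(K.space, K.space) where
  toFun x := ⟨concentrate x, by
    obtain ⟨s, hs, hx⟩ := mem_space_iff.1 x.2
    exact cell_subset_space hs (concentrate_mem_cell hx)⟩
  continuous_toFun := by
    have := continuousOn_concentrate.mono K.space_subset_allCells
    exact this.domRestrict.subtype_mk _

theorem continuous_coe_concentrateMap (K : ASC V) :
    Continuous fun x : K.space => (concentrateMap K x : V → ℝ) :=
  continuous_subtype_val.comp (map_continuous _)

theorem eventually_concentrateMap_mem_cell {K : ASC V} (x₀ : K.space) {s : Finset V}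
    (hx : (x₀ : V → ℝ) ∈ cell s) : ∀ᶠ x in 𝓝 x₀, (concentrateMap K x : V → ℝ) ∈ cell s := by
  have h := nhdsWithin_mono _ K.space_subset_allCells (eventually_concentrate_mem_cell hx)
  rw [← map_nhds_subtype_val] at h
  exact h

theorem mem_cell_of_forall_eq_zero {K : ASC V} {x : V → ℝ} (hx : x ∈ K.space) {s : Finset V}
    (h : ∀ v, v ∉ s → x v = 0) : x ∈ cell s := by
  classical
  obtain ⟨t, -, ht⟩ := mem_space_iff.1 hx
  refine ⟨ht.1, h, ?_⟩
  rw [← (cell_mono (Finset.subset_union_left (s₂ := s)) ht).2.2]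
  exact Finset.sum_subset Finset.subset_union_right fun v _ hv => h v hv

variable [DecidableEq V] [DecidableEq W] {X : ASC V} {Y : ASC W} {φ : V → W}

theorem homotopic_comp_pushMap (hφ : X.IsSimplicial Y φ)
    (hcontr : ∀ σ ∈ Y.faces,
      ContractibleSpace ↥{x : ↥X.space | ∀ w, w ∉ σ → push φ (x : V → ℝ) w = 0})
    {G : (W → ℝ) → X.space} (hG : ∀ σ ∈ Y.faces, ContinuousOn G (cell σ))
    (hGC : ∀ σ ∈ Y.faces, MapsTo G (cell σ) {x | ∀ w, w ∉ σ → push φ (x : V → ℝ) w = 0})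
    (g : C(Y.space, X.space)) (hg : ∀ y, g y = G (concentrateMap Y y)) :
    (g.comp (pushMap hφ)).Homotopic (ContinuousMap.id X.space) := by
  classical
  obtain hX | ⟨⟨x₀⟩⟩ := isEmpty_or_nonempty X.space
  · rw [Subsingleton.elim (g.comp (pushMap hφ)) (ContinuousMap.id X.space)]
  let a : (V → ℝ) → X.space := fun x => if h : x ∈ X.space then ⟨x, h⟩ else x₀
  have haeq : ∀ x : X.space, a x = x := fun x => dif_pos x.2
  have hpush : ∀ s ∈ X.faces, MapsTo (push φ) (cell s) (cell (s.image φ)) :=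
    fun s _ x hx => push_mem_cell hx
  obtain ⟨H, hH, hH0, hH1⟩ := exists_cylinder_homotopy X
    (C := fun s => {x : X.space | ∀ w, w ∉ s.image φ → push φ (x : V → ℝ) w = 0})
    (fun s t _ hst x hx w hw => hx w fun h => hw (Finset.image_subset_image hst h))
    (fun s hs => hcontr _ (hφ s hs)) (a := a) (b := fun x => G (push φ x))
    (fun s hs => Topology.IsInducing.subtypeVal.continuousOn_iff.2
      (continuousOn_id.congr fun x hx => congrArg Subtype.val
        (haeq ⟨x, cell_subset_space hs hx⟩)))
    (fun s hs x hx w hw => by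
      rw [haeq ⟨x, cell_subset_space hs hx⟩]
      exact (hpush s hs hx).2.1 w hw)
    (fun s hs => (hG _ (hφ s hs)).comp
      ((continuousOn_push φ).mono fun x hx => ⟨s, hx⟩) (hpush s hs))
    (fun s hs x hx => hGC _ (hφ s hs) (hpush s hs hx))
  have hc₁ : Continuous fun p : unitInterval × X.space =>
      H (cylinderPoint p.1 (concentrateMap X p.2 : V → ℝ)) := by
    refine continuous_comp_of_eventually_mem_cell hH
      (continuous_cylinderPoint.comp ((continuous_subtype_val.comp continuous_fst).prodMk
        ((continuous_coe_concentrateMap X).comp continuous_snd))) fun p => ?_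
    obtain ⟨s, hs, hx⟩ := mem_space_iff.1 p.2.2
    refine ⟨s ×ˢ Finset.univ, product_mem_cylinder_faces hs Finset.univ_nonempty, ?_⟩
    filter_upwards [continuous_snd.continuousAt.eventually
      (eventually_concentrateMap_mem_cell p.2 hx)] with q hq
    exact cylinderPoint_mem_cell hq q.1.2.1 q.1.2.2
  have hc₂ : Continuous fun p : unitInterval × X.space =>
      G ((1 - (p.1 : ℝ)) • (pushMap hφ (concentrateMap X p.2) : W → ℝ) +
        (p.1 : ℝ) • (concentrateMap Y (pushMap hφ p.2) : W → ℝ)) := by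
    have hl : Continuous fun p : unitInterval × X.space =>
        (pushMap hφ (concentrateMap X p.2) : W → ℝ) := continuous_subtype_val.comp
      ((map_continuous ((pushMap hφ).comp (concentrateMap X))).comp continuous_snd)
    have hr : Continuous fun p : unitInterval × X.space =>
        (concentrateMap Y (pushMap hφ p.2) : W → ℝ) := continuous_subtype_val.comp
      ((map_continuous ((concentrateMap Y).comp (pushMap hφ))).comp continuous_snd)
    have ht : Continuous fun p : unitInterval × X.space => (p.1 : ℝ) :=
      continuous_subtype_val.comp continuous_fst
    refine continuous_comp_of_eventually_mem_cell hG
      (((continuous_const.sub ht).smul hl).add (ht.smul hr)) fun p => ?_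
    obtain ⟨s, hs, hx⟩ := mem_space_iff.1 p.2.2
    refine ⟨s.image φ, hφ s hs, ?_⟩
    filter_upwards [continuous_snd.continuousAt.eventually
        (eventually_concentrateMap_mem_cell p.2 hx),
      ((pushMap hφ).continuous.comp continuous_snd).continuousAt.eventually
        (eventually_concentrateMap_mem_cell (pushMap hφ p.2) (push_mem_cell hx))] with q hq hq'
    exact cell_combo (push_mem_cell hq) hq' q.1.2.1 q.1.2.2
  let m : C(X.space, X.space) :=
    ⟨fun x => G (pushMap hφ (concentrateMap X x)), by
      simpa [Function.comp_def] using hc₂.comp (.prodMk_right 0)⟩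
  have h₁ : (concentrateMap X).Homotopic (ContinuousMap.id X.space) :=
    homotopic_of_mem_cell _ _ fun x =>
      let ⟨s, hs, hx⟩ := mem_space_iff.1 x.2
      ⟨s, hs, concentrate_mem_cell hx, hx⟩
  have h₂ : (concentrateMap X).Homotopic m :=
    ⟨⟨⟨_, hc₁⟩, fun x => (hH0 _ (concentrateMap X x).2).trans (haeq _),
      fun x => hH1 _ (concentrateMap X x).2⟩⟩
  have h₃ : m.Homotopic (g.comp (pushMap hφ)) :=
    ⟨⟨⟨_, hc₂⟩, fun x => by simp [m], fun x => by simp [hg]⟩⟩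
  exact h₃.symm.trans (h₂.symm.trans h₁)

end Maps

end ASC

/-- A simplicial map whose preimages of all closed simplices are contractible is a homotopy
equivalence of geometric realizations. -/
theorem homotopyEquiv_of_contractible_preimages {V W : Type} [DecidableEq V] [DecidableEq W]
    (X : ASC V) (Y : ASC W) (φ : V → W) (hφ : X.IsSimplicial Y φ)
    (hcontr : ∀ σ ∈ Y.faces,
      ContractibleSpace ↥{x : ↥X.space | ∀ w, w ∉ σ → ASC.push φ (x : V → ℝ) w = 0}) :
    ∃ e : ContinuousMap.HomotopyEquiv (↥X.space) (↥Y.space),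
      ∀ x : ↥X.space, (e.toFun x : W → ℝ) = ASC.push φ (x : V → ℝ) := by
  classical
  obtain hX | ⟨⟨x₀⟩⟩ := isEmpty_or_nonempty X.space
  · have hY : IsEmpty Y.space := ⟨fun y => by
      obtain ⟨σ, hσ, -⟩ := ASC.mem_space_iff.1 y.2
      have := hcontr σ hσ
      obtain ⟨x⟩ : Nonempty {x : X.space | ∀ w, w ∉ σ → ASC.push φ (x : V → ℝ) w = 0} :=
        inferInstance
      exact hX.false x.1⟩
    exact ⟨(Homeomorph.empty : X.space ≃ₜ Y.space).toHomotopyEquiv, fun x => hX.elim x⟩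
  obtain ⟨G, hG, hGC, -⟩ := ASC.exists_extension Y (L := ∅) (by simp)
    (C := fun σ => {x : X.space | ∀ w, w ∉ σ → ASC.push φ (x : V → ℝ) w = 0})
    (fun σ τ _ hστ x hx w hw => hx w fun h => hw (hστ h)) hcontr (g₀ := fun _ => x₀)
    (by simp) (by simp)
  let g : C(Y.space, X.space) := ⟨fun y => G (ASC.concentrateMap Y y),
    ASC.continuous_comp_of_eventually_mem_cell hG (ASC.continuous_coe_concentrateMap Y) fun y =>
      let ⟨σ, hσ, hy⟩ := ASC.mem_space_iff.1 y.2
      ⟨σ, hσ, ASC.eventually_concentrateMap_mem_cell y hy⟩⟩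
  refine ⟨⟨ASC.pushMap hφ, g, ASC.homotopic_comp_pushMap hφ hcontr hG hGC g fun _ => rfl,
    ASC.homotopic_of_mem_cell _ _ fun y => ?_⟩, fun _ => rfl⟩
  obtain ⟨σ, hσ, hy⟩ := ASC.mem_space_iff.1 y.2
  exact ⟨σ, hσ, ASC.mem_cell_of_forall_eq_zero (ASC.pushMap hφ (g y)).2
    (hGC σ hσ (ASC.concentrate_mem_cell hy)), hy⟩
end

section
/- Let Y be a subcomplex of a simplicial complex X, with a distinguished set of 'bad' simplices in X − Y satisfying: (1) every simplex of X with no bad face lies in Y, and (2) the join of any two bad faces of a simplex of X is bad. For a bad simplex σ, let G_σ ⊆ lk(σ) be the subcomplex of simplices τ such that every bad face of τ ∗ σ is contained in σ. If for some integer n ≥ 0, G_σ is (n − dim σ − 1)-connected for every bad simplex σ, then the pair (X, Y) is n-connected, i.e., π_i(X, Y) = 0 for all i ≤ n and all basepoints. -/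
open scoped BigOperators

/-- The subcomplex `G_σ` of the link of a bad simplex `σ`, consisting of the simplices `τ`
that are good for `σ`: every bad face of `τ ∗ σ` is contained in `σ`. -/
def goodFor {V : Type} [DecidableEq V] (K : ASC V) (Bad : Set (Finset V)) (σ : Finset V) :
    ASC V where
  faces := {t | t ∈ (K.link σ).faces ∧ ∀ u, u ⊆ t ∪ σ → u.Nonempty → u ∈ Bad → u ⊆ σ}
  nonempty_of_mem := fun _ h => (K.link σ).nonempty_of_mem h.1
  down_closed := by
    rintro t u ⟨ht1, ht2⟩ hsub hne
    exact ⟨(K.link σ).down_closed ht1 hsub hne,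
      fun w hw hwne hwb => ht2 w (hw.trans (Finset.union_subset_union_left hsub)) hwne hwb⟩

/-- The pair `(X, Y)` is `n`-connected: for every `i ≤ n`, every map of the `i`-disk into `X`
taking the boundary sphere into `Y` is homotopic, rel the boundary sphere, to a map with image
in `Y` (i.e. `π_i(X, Y) = 0` for all `i ≤ n` and all basepoints). -/
def PairConnUpTo (X : Type) [TopologicalSpace X] (Y : Set X) (n : ℕ) : Prop :=
  ∀ i : ℕ, i ≤ n →
    ∀ f : C(↥(Metric.closedBall (0 : EuclideanSpace ℝ (Fin i)) 1), X),
      (∀ x : ↥(Metric.closedBall (0 : EuclideanSpace ℝ (Fin i)) 1),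
          (x : EuclideanSpace ℝ (Fin i)) ∈ Metric.sphere (0 : EuclideanSpace ℝ (Fin i)) 1 →
          f x ∈ Y) →
      ∃ g : C(↥(Metric.closedBall (0 : EuclideanSpace ℝ (Fin i)) 1), X),
        (∀ x, g x ∈ Y) ∧
        f.HomotopicRel g
          {x : ↥(Metric.closedBall (0 : EuclideanSpace ℝ (Fin i)) 1) |
            (x : EuclideanSpace ℝ (Fin i)) ∈ Metric.sphere (0 : EuclideanSpace ℝ (Fin i)) 1}

namespace LinkArgument

open Set Metric Topology

/-- Every map from the unit sphere of `ℝᵐ` to `A` extends to a map from the unit ball to `A`. -/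
def SphereExt {T : Type} [TopologicalSpace T] (A : Set T) (m : ℕ) : Prop :=
  ∀ f : EuclideanSpace ℝ (Fin m) → T, ContinuousOn f (sphere 0 1) → MapsTo f (sphere 0 1) A →
    ∃ g, ContinuousOn g (closedBall 0 1) ∧ MapsTo g (closedBall 0 1) A ∧
      EqOn g f (sphere 0 1)

/-- A convex body is homeomorphic to the Euclidean ball of the same dimension, by a homeomorphism
of the ambient spaces. -/
theorem exists_homeomorph_euclidean {E : Type} [NormedAddCommGroup E] [NormedSpace ℝ E]
    [FiniteDimensional ℝ E] {m : ℕ} (hm : Module.finrank ℝ E = m) {s : Set E}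
    (hc : Convex ℝ s) (hs : IsCompact s) (hi : (interior s).Nonempty) :
    ∃ h : E ≃ₜ EuclideanSpace ℝ (Fin m),
      (∀ x, h x ∈ closedBall (0 : EuclideanSpace ℝ (Fin m)) 1 ↔ x ∈ s) ∧
      (∀ x, h x ∈ sphere (0 : EuclideanSpace ℝ (Fin m)) 1 ↔ x ∈ frontier s) := by
  let e : E ≃L[ℝ] EuclideanSpace ℝ (Fin m) := ContinuousLinearEquiv.ofFinrankEq (by simp [hm])
  have hinterior : (interior (e '' s)).Nonempty := by
    have := e.toHomeomorph.image_interior s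
    simp only [ContinuousLinearEquiv.coe_toHomeomorph] at this
    rw [← this]
    exact hi.image _
  have hcpt : IsCompact (e '' s) := hs.image e.continuous
  obtain ⟨k, -, h2, h3⟩ := exists_homeomorph_image_interior_closure_frontier_eq_unitBall
    (hc.linear_image e.toLinearEquiv.toLinearMap) hinterior hcpt.isBounded
  have h2' : k '' (e '' s) = closedBall 0 1 := by
    rw [← h2]
    congr 1
    exact hcpt.isClosed.closure_eq.symm
  have h3' : k '' (e '' frontier s) = sphere 0 1 := by
    rw [← h3]
    congr 1
    exact e.toHomeomorph.image_frontier s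
  refine ⟨e.toHomeomorph.trans k, fun x => ?_, fun x => ?_⟩
  · rw [← h2']
    simp
  · rw [← h3']
    simp

section SphereExt

variable {T : Type} [TopologicalSpace T] {A : Set T} {m : ℕ}

theorem SphereExt.convexBody (hA : SphereExt A m)
    {E : Type} [NormedAddCommGroup E] [NormedSpace ℝ E]
    [FiniteDimensional ℝ E] (hm : Module.finrank ℝ E = m) {s : Set E}
    (hc : Convex ℝ s) (hs : IsCompact s) (hi : (interior s).Nonempty) (f : E → T)
    (hf : ContinuousOn f (frontier s)) (hfA : MapsTo f (frontier s) A) :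
    ∃ g, ContinuousOn g s ∧ MapsTo g s A ∧ EqOn g f (frontier s) := by
  obtain ⟨h, h1, h2⟩ := exists_homeomorph_euclidean hm hc hs hi
  have hsymm : MapsTo h.symm (sphere 0 1) (frontier s) := fun y hy => by
    rw [← h2]; simpa using hy
  obtain ⟨g, hg, hgA, hgf⟩ := hA (f ∘ h.symm)
    (hf.comp h.symm.continuous.continuousOn hsymm) (hfA.comp hsymm)
  refine ⟨g ∘ h, hg.comp h.continuous.continuousOn fun x hx => (h1 x).2 hx,
    hgA.comp fun x hx => (h1 x).2 hx, fun x hx => ?_⟩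
  have := hgf ((h2 x).2 hx)
  simpa using this

/-- Extending a map from the sphere is possible as soon as a homotopic map extends. -/
theorem exists_extension_of_homotopy {f : EuclideanSpace ℝ (Fin m) → T}
    {H : EuclideanSpace ℝ (Fin m) × ℝ → T} (hH : ContinuousOn H (sphere 0 1 ×ˢ Icc 0 1))
    (hHA : MapsTo H (sphere 0 1 ×ˢ Icc 0 1) A) (hH0 : ∀ x ∈ sphere 0 1, H (x, 0) = f x)
    {g : EuclideanSpace ℝ (Fin m) → T} (hg : ContinuousOn g (closedBall 0 1))
    (hgA : MapsTo g (closedBall 0 1) A) (hH1 : ∀ x ∈ sphere 0 1, H (x, 1) = g x) :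
    ∃ g, ContinuousOn g (closedBall 0 1) ∧ MapsTo g (closedBall 0 1) A ∧
      EqOn g f (sphere 0 1) := by
  classical
  set B : Set (EuclideanSpace ℝ (Fin m)) := closedBall 0 1
  let s1 : Set (EuclideanSpace ℝ (Fin m)) := {x | 1 / 2 ≤ ‖x‖ ∧ ‖x‖ ≤ 1}
  let s2 : Set (EuclideanSpace ℝ (Fin m)) := {x | ‖x‖ ≤ 1 / 2}
  let g1 : EuclideanSpace ℝ (Fin m) → T := fun x => H (‖x‖⁻¹ • x, 2 - 2 * ‖x‖)
  let g2 : EuclideanSpace ℝ (Fin m) → T := fun x => g ((2 : ℝ) • x)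
  have hB : B = s1 ∪ s2 := by
    ext x
    simp only [B, s1, s2, mem_closedBall_zero_iff, mem_union, mem_ofPred_eq]
    constructor
    · intro h
      rcases le_total (1 / 2) ‖x‖ with h' | h'
      · exact Or.inl ⟨h', h⟩
      · exact Or.inr h'
    · rintro (h | h)
      · exact h.2
      · linarith
  have hs1 : IsClosed s1 :=
    (isClosed_le continuous_const continuous_norm).inter
      (isClosed_le continuous_norm continuous_const)
  have hs2 : IsClosed s2 := isClosed_le continuous_norm continuous_const
  have hm1 : MapsTo (fun x : EuclideanSpace ℝ (Fin m) => (‖x‖⁻¹ • x, 2 - 2 * ‖x‖)) s1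
      (sphere 0 1 ×ˢ Icc 0 1) := by
    intro x hx
    have h0 : (0 : ℝ) < ‖x‖ := by linarith [hx.1]
    refine ⟨?_, ?_, ?_⟩
    · simp [norm_smul, h0.ne']
    · linarith [hx.2]
    · linarith [hx.1]
  have hm2 : MapsTo (fun x : EuclideanSpace ℝ (Fin m) => (2 : ℝ) • x) s2 B := by
    intro x hx
    simp only [B, mem_closedBall_zero_iff, norm_smul, Real.norm_ofNat]
    have : ‖x‖ ≤ 1 / 2 := hx
    linarith
  have hg1 : ContinuousOn g1 s1 := by
    refine hH.comp ?_ hm1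
    have hne : ∀ x ∈ s1, ‖x‖ ≠ 0 := by
      intro x hx h0
      have := hx.1
      rw [h0] at this
      norm_num at this
    exact ((continuous_norm.continuousOn.inv₀ hne).smul continuousOn_id).prodMk (by fun_prop)
  have hg2 : ContinuousOn g2 s2 := hg.comp (by fun_prop) hm2
  have heq : ∀ x ∈ s1, x ∈ s2 → g1 x = g2 x := by
    intro x hx hx'
    have h : ‖x‖ = 1 / 2 := le_antisymm hx' hx.1
    have h2 : (2 : ℝ) • x ∈ sphere (0 : EuclideanSpace ℝ (Fin m)) 1 := by
      simp [norm_smul, h]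
    simp only [g1, g2, h]
    rw [← hH1 _ h2]
    norm_num
  let G : EuclideanSpace ℝ (Fin m) → T := fun x => if x ∈ s1 then g1 x else g2 x
  have hG1 : EqOn G g1 s1 := fun x hx => if_pos hx
  have hG2 : EqOn G g2 s2 := fun x hx => by
    by_cases h : x ∈ s1
    · rw [hG1 h, heq x h hx]
    · exact if_neg h
  refine ⟨G, ?_, ?_, ?_⟩
  · rw [hB]
    exact (hg1.congr hG1).union_of_isClosed (hg2.congr hG2) hs1 hs2
  · intro x hx
    rw [hB] at hx
    rcases hx with hx | hx
    · rw [hG1 hx]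
      exact hHA (hm1 hx)
    · rw [hG2 hx]
      exact hgA (hm2 hx)
  · intro x hx
    have h : ‖x‖ = 1 := by simpa using hx
    rw [hG1 ⟨by norm_num [h], h.le⟩, ← hH0 x hx]
    simp [g1, h]

theorem SphereExt.of_homotopy_retract {T' : Type} [TopologicalSpace T'] {B : Set T'}
    (hB : SphereExt B m) {φ : T → T'} {ψ : T' → T} (hφ : ContinuousOn φ A) (hφm : MapsTo φ A B)
    (hψ : ContinuousOn ψ B) (hψm : MapsTo ψ B A) {K : T × ℝ → T}
    (hK : ContinuousOn K (A ×ˢ Icc 0 1)) (hKm : MapsTo K (A ×ˢ Icc 0 1) A)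
    (hK0 : ∀ x ∈ A, K (x, 0) = x) (hK1 : ∀ x ∈ A, K (x, 1) = ψ (φ x)) : SphereExt A m := by
  intro f hf hfA
  obtain ⟨g, hg, hgB, hgf⟩ := hB (φ ∘ f) (hφ.comp hf hfA) (hφm.comp hfA)
  have hm : MapsTo (fun p : EuclideanSpace ℝ (Fin m) × ℝ => (f p.1, p.2))
      (sphere 0 1 ×ˢ Icc 0 1) (A ×ˢ Icc 0 1) := fun p hp => ⟨hfA hp.1, hp.2⟩
  refine exists_extension_of_homotopy
    (H := fun p => K (f p.1, p.2)) (hK.comp ?_ hm) (hKm.comp hm)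
    (fun x hx => hK0 _ (hfA hx)) (hψ.comp hg hgB) (hψm.comp hgB)
    fun x hx => ?_
  · exact (hf.comp continuousOn_fst fun p hp => hp.1).prodMk continuousOn_snd
  · simp only [Function.comp]
    rw [hK1 _ (hfA hx), hgf hx]
    rfl

/-- A linear version of `SphereExt.of_homotopy_retract`. -/
theorem SphereExt.of_linear_homotopy {E : Type} [AddCommGroup E] [Module ℝ E] [TopologicalSpace E]
    [IsTopologicalAddGroup E] [ContinuousSMul ℝ E] {A : Set E}
    {T' : Type} [TopologicalSpace T'] {B : Set T'}
    (hB : SphereExt B m) {φ : E → T'} {ψ : T' → E} (hφ : ContinuousOn φ A) (hφm : MapsTo φ A B)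
    (hψ : ContinuousOn ψ B) (hψm : MapsTo ψ B A)
    (h : ∀ x ∈ A, ∀ t ∈ Icc (0 : ℝ) 1, (1 - t) • x + t • ψ (φ x) ∈ A) : SphereExt A m := by
  refine hB.of_homotopy_retract hφ hφm hψ hψm
    (K := fun p => (1 - p.2) • p.1 + p.2 • ψ (φ p.1)) ?_ (fun p hp => h _ hp.1 _ hp.2) (by simp)
    (by simp)
  have h1 : ContinuousOn (fun p : E × ℝ => ψ (φ p.1)) (A ×ˢ Icc 0 1) :=
    (hψ.comp hφ hφm).comp continuousOn_fst fun p hp => hp.1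
  have h2 : ContinuousOn (fun p : E × ℝ => (1 - p.2) • p.1) (A ×ˢ Icc 0 1) :=
    (Continuous.smul (by fun_prop) (by fun_prop)).continuousOn
  exact h2.add (continuousOn_snd.smul h1)

theorem SphereExt.of_starConvex {E : Type} [AddCommGroup E] [Module ℝ E] [TopologicalSpace E]
    [IsTopologicalAddGroup E] [ContinuousSMul ℝ E] {A : Set E} {p : E} (hp : p ∈ A)
    (h : ∀ x ∈ A, ∀ t ∈ Icc (0 : ℝ) 1, (1 - t) • x + t • p ∈ A) : SphereExt A m := by
  have hU : SphereExt (univ : Set Unit) m := fun f _ _ =>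
    ⟨fun _ => (), continuousOn_const, fun _ _ => mem_univ _, fun _ _ => rfl⟩
  exact hU.of_linear_homotopy (φ := fun _ => ()) (ψ := fun _ => p) continuousOn_const
    (fun _ _ => mem_univ _) continuousOn_const (fun _ _ => hp) h

end SphereExt

section Grid

variable {ι : Type}

/-- The closed cells of the integer grid in `ℝ^ι`: in each coordinate, an even code `2 * a` stands
for the point `a` and an odd code `2 * a + 1` for the interval `[a, a + 1]`. -/
def cell (c : ι → ℤ) : Set (ι → ℝ) :=
  {x | ∀ k, ((c k / 2 : ℤ) : ℝ) ≤ x k ∧ x k ≤ (((c k + 1) / 2 : ℤ) : ℝ)}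

/-- The code of the smallest grid cell containing a point. -/
noncomputable def code (x : ι → ℝ) (k : ι) : ℤ := ⌊x k⌋ + ⌈x k⌉

/-- The cell with code `d` is a face of the cell with code `c`. -/
def Face (d c : ι → ℤ) : Prop := ∀ k, c k / 2 ≤ d k / 2 ∧ (d k + 1) / 2 ≤ (c k + 1) / 2

theorem code_div (x : ι → ℝ) (k : ι) : code x k / 2 = ⌊x k⌋ ∧ (code x k + 1) / 2 = ⌈x k⌉ := by
  have h1 := Int.floor_le_ceil (x k)
  have h2 := Int.ceil_le_floor_add_one (x k)
  unfold code
  omega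

theorem mem_cell_code (x : ι → ℝ) : x ∈ cell (code x) := fun k => by
  rw [(code_div x k).1, (code_div x k).2]
  exact ⟨Int.floor_le _, Int.le_ceil _⟩

theorem face_code_of_mem {x : ι → ℝ} {c : ι → ℤ} (h : x ∈ cell c) : Face (code x) c := fun k => by
  rw [(code_div x k).1, (code_div x k).2]
  exact ⟨Int.le_floor.2 (h k).1, Int.ceil_le.2 (h k).2⟩

theorem Face.cell_subset {d c : ι → ℤ} (h : Face d c) : cell d ⊆ cell c := fun _ hx k =>
  ⟨le_trans (by exact_mod_cast (h k).1) (hx k).1, (hx k).2.trans (by exact_mod_cast (h k).2)⟩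

theorem Face.refl (c : ι → ℤ) : Face c c := fun _ => ⟨le_rfl, le_rfl⟩

theorem Face.trans {e d c : ι → ℤ} (h : Face e d) (h' : Face d c) : Face e c := fun k =>
  ⟨(h' k).1.trans (h k).1, (h k).2.trans (h' k).2⟩

theorem isClosed_cell (c : ι → ℤ) : IsClosed (cell c) := by
  have : cell c = ⋂ k, {x | ((c k / 2 : ℤ) : ℝ) ≤ x k ∧ x k ≤ (((c k + 1) / 2 : ℤ) : ℝ)} := by
    ext x
    simp [cell]
  rw [this]
  exact isClosed_iInter fun k => (isClosed_le continuous_const (continuous_apply k)).inter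
    (isClosed_le (continuous_apply k) continuous_const)

theorem code_eq_of_mem_interior {c : ι → ℤ} {x : ι → ℝ} (hx : x ∈ cell c)
    (h : ∀ k, Odd (c k) → ((c k / 2 : ℤ) : ℝ) < x k ∧ x k < (((c k + 1) / 2 : ℤ) : ℝ)) :
    code x = c := by
  funext k
  have h1 := face_code_of_mem hx k
  have h2 := code_div x k
  have h3 := Int.floor_le_ceil (x k)
  have h4 := Int.ceil_le_floor_add_one (x k)
  rcases Int.even_or_odd (c k) with hc | hc
  · rw [Int.even_iff] at hc
    omega
  · have h5 := Int.lt_ceil.2 (h k hc).1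
    have h6 := Int.floor_lt.2 (h k hc).2
    rw [Int.odd_iff] at hc
    omega

variable [Fintype ι]

/-- The number of odd entries of a code, which is the dimension of the cell. -/
noncomputable def cellDim (c : ι → ℤ) : ℕ := Fintype.card {k // Odd (c k)}

theorem Face.cellDim_lt {d c : ι → ℤ} (h : Face d c) (hne : d ≠ c) : cellDim d < cellDim c := by
  classical
  unfold cellDim
  rw [Fintype.card_subtype, Fintype.card_subtype]
  refine Finset.card_lt_card (Finset.ssubset_iff_subset_ne.2 ⟨fun k hk => ?_, fun heq => hne ?_⟩)
  · simp only [Finset.mem_filter_univ, Int.odd_iff] at hk ⊢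
    have := h k
    omega
  · funext k
    have h1 := h k
    have h2 := Finset.ext_iff.1 heq k
    simp only [Finset.mem_filter_univ, Int.odd_iff] at h2
    omega

theorem frontier_Icc_pi {κ : Type} [Fintype κ] {a b : κ → ℝ} {x : κ → ℝ} :
    x ∈ frontier (Icc a b) ↔ x ∈ Icc a b ∧ ∃ k, x k = a k ∨ x k = b k := by
  have hi : interior (Icc a b) = univ.pi fun k => Ioo (a k) (b k) := by
    rw [← pi_univ_Icc, interior_pi_set finite_univ]
    simp
  rw [frontier, isClosed_Icc.closure_eq, hi]
  simp only [mem_sdiff, mem_univ_pi, mem_Ioo, not_forall, and_congr_right_iff]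
  intro hx
  refine exists_congr fun k => ?_
  have h1 : a k ≤ x k := hx.1 k
  have h2 : x k ≤ b k := hx.2 k
  constructor
  · intro h
    by_contra! h'
    exact h ⟨lt_of_le_of_ne h1 (Ne.symm h'.1), lt_of_le_of_ne h2 h'.2⟩
  · rintro (h | h) h'
    · exact h'.1.ne' h
    · exact h'.2.ne h

theorem interior_Icc_pi_nonempty {κ : Type} [Fintype κ] {a b : κ → ℝ} (h : ∀ k, a k < b k) :
    (interior (Icc a b)).Nonempty := by
  rw [← pi_univ_Icc, interior_pi_set finite_univ]
  simpa [univ_pi_nonempty_iff] using h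

variable {T : Type} [TopologicalSpace T]

theorem SphereExt.cell {A : Set T} {c : ι → ℤ} (hA : SphereExt A (cellDim c)) {f : (ι → ℝ) → T}
    (hf : ContinuousOn f {x ∈ cell c | code x ≠ c})
    (hfA : MapsTo f {x ∈ LinkArgument.cell c | code x ≠ c} A) :
    ∃ g, ContinuousOn g (LinkArgument.cell c) ∧ MapsTo g (LinkArgument.cell c) A ∧
      EqOn g f {x ∈ LinkArgument.cell c | code x ≠ c} := by
  classical
  let κ := {k // Odd (c k)}
  let lo : κ → ℝ := fun k => ((c k / 2 : ℤ) : ℝ)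
  let hi : κ → ℝ := fun k => (((c k + 1) / 2 : ℤ) : ℝ)
  let emb : (κ → ℝ) → ι → ℝ := fun y k => if h : Odd (c k) then y ⟨k, h⟩ else ((c k / 2 : ℤ) : ℝ)
  let res : (ι → ℝ) → κ → ℝ := fun x k => x k
  have hemb : Continuous emb := by
    refine continuous_pi fun k => ?_
    by_cases h : Odd (c k)
    · simp only [emb, h, dif_pos]
      exact continuous_apply _
    · simp only [emb, h, dif_neg, not_false_iff]
      exact continuous_const
  have hres : Continuous res := continuous_pi fun k => continuous_apply _
  have hlt : ∀ k, lo k < hi k := fun ⟨k, hk⟩ => by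
    simp only [lo, hi, Int.cast_lt]
    rw [Int.odd_iff] at hk
    omega
  have hembc : MapsTo emb (Icc lo hi) (LinkArgument.cell c) := by
    intro y hy k
    by_cases h : Odd (c k)
    · simp only [emb, h, dif_pos]
      exact ⟨hy.1 ⟨k, h⟩, hy.2 ⟨k, h⟩⟩
    · simp only [emb, h, dif_neg, not_false_iff, le_refl, true_and, Int.cast_le]
      omega
  have hresc : MapsTo res (LinkArgument.cell c) (Icc lo hi) := fun x hx =>
    ⟨fun k => (hx k).1, fun k => (hx k).2⟩
  have hre : ∀ x ∈ LinkArgument.cell c, emb (res x) = x := by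
    intro x hx
    funext k
    by_cases h : Odd (c k)
    · simp [emb, res, h]
    · simp only [emb, h, dif_neg, not_false_iff]
      refine le_antisymm (hx k).1 ((hx k).2.trans ?_)
      rw [Int.cast_le]
      rw [Int.not_odd_iff_even, Int.even_iff] at h
      omega
  have hfr : MapsTo emb (frontier (Icc lo hi)) {x ∈ LinkArgument.cell c | code x ≠ c} := by
    intro y hy
    obtain ⟨hy1, k, hk⟩ := frontier_Icc_pi.1 hy
    refine ⟨hembc hy1, fun heq => ?_⟩
    have h1 : code (emb y) k = c k := congrFun heq k
    have h2 : emb y k = y k := by simp [emb, k.2]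
    have h3 := k.2
    rw [Int.odd_iff] at h3
    unfold code at h1
    rw [h2] at h1
    rcases hk with hk | hk <;> rw [hk] at h1 <;> simp only [lo, hi, Int.floor_intCast,
      Int.ceil_intCast] at h1 <;> omega
  have hrfr : MapsTo res {x ∈ LinkArgument.cell c | code x ≠ c} (frontier (Icc lo hi)) := by
    rintro x ⟨hx, hne⟩
    refine frontier_Icc_pi.2 ⟨hresc hx, ?_⟩
    by_contra! h
    refine hne (code_eq_of_mem_interior hx fun k hk => ?_)
    have h1 := h ⟨k, hk⟩
    exact ⟨lt_of_le_of_ne (hx k).1 (Ne.symm h1.1), lt_of_le_of_ne (hx k).2 h1.2⟩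
  obtain ⟨g, hg, hgA, hgf⟩ := hA.convexBody (E := κ → ℝ) (by simp [κ, cellDim])
    (convex_Icc lo hi) isCompact_Icc (interior_Icc_pi_nonempty hlt) (f ∘ emb)
    (hf.comp hemb.continuousOn hfr) (hfA.comp hfr)
  refine ⟨g ∘ res, hg.comp hres.continuousOn hresc, hgA.comp hresc, fun x hx => ?_⟩
  have := hgf (hrfr hx)
  simpa [hre x hx.1] using this

/-- Extension of maps over finite subcomplexes of the integer grid, subject to a carrier `S`. -/
theorem exists_carried_extension (S : (ι → ℤ) → Set T) (F : Finset (ι → ℤ))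
    (hS : ∀ c ∈ F, ∀ d, Face d c → S d ⊆ S c) (hF : ∀ c ∈ F, ∀ d, Face d c → d ∈ F)
    (F₀ : Finset (ι → ℤ)) (h₀ : F₀ ⊆ F) (hF₀ : ∀ c ∈ F₀, ∀ d, Face d c → d ∈ F₀)
    (hext : ∀ c ∈ F, c ∉ F₀ → SphereExt (S c) (cellDim c))
    (f : (ι → ℝ) → T) (hf : ContinuousOn f (⋃ c ∈ F₀, cell c))
    (hfS : ∀ c ∈ F₀, MapsTo f (cell c) (S c)) :
    ∃ g, ContinuousOn g (⋃ c ∈ F, cell c) ∧ EqOn g f (⋃ c ∈ F₀, cell c) ∧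
      ∀ c ∈ F, MapsTo g (cell c) (S c) := by
  classical
  induction hn : (F \ F₀).card generalizing F₀ f with
  | zero =>
    have h : F = F₀ := by
      rw [Finset.card_eq_zero, Finset.sdiff_eq_empty_iff_subset] at hn
      exact hn.antisymm h₀
    subst h
    exact ⟨f, hf, fun _ _ => rfl, hfS⟩
  | succ n ih =>
    have hne : (F \ F₀).Nonempty := by
      rw [← Finset.card_pos, hn]
      exact n.succ_pos
    obtain ⟨c, hc, hmin⟩ := Finset.exists_min_image (F \ F₀) cellDim hne
    rw [Finset.mem_sdiff] at hc
    have hface : ∀ d, Face d c → d ≠ c → d ∈ F₀ := by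
      intro d hd hdc
      by_contra hd0
      exact absurd (hmin d (Finset.mem_sdiff.2 ⟨hF c hc.1 d hd, hd0⟩))
        (not_le.2 (hd.cellDim_lt hdc))
    have hbd : {x ∈ cell c | code x ≠ c} ⊆ ⋃ c ∈ F₀, cell c := by
      rintro x ⟨hx, hne⟩
      exact mem_biUnion (hface _ (face_code_of_mem hx) hne) (mem_cell_code x)
    have hbd' : ∀ x ∈ cell c, (x ∈ ⋃ c ∈ F₀, cell c) → code x ≠ c := by
      intro x hx hx' heq
      simp only [mem_iUnion, exists_prop] at hx'
      obtain ⟨d, hd, hxd⟩ := hx'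
      exact hc.2 (heq ▸ hF₀ d hd _ (face_code_of_mem hxd))
    obtain ⟨g, hg, hgS, hgf⟩ := (hext c hc.1 hc.2).cell (hf.mono hbd) (by
      rintro x ⟨hx, hne⟩
      have hx' := face_code_of_mem hx
      exact hS c hc.1 _ hx' (hfS _ (hface _ hx' hne) (mem_cell_code x)))
    let G : (ι → ℝ) → T := fun x => if x ∈ cell c then g x else f x
    have hGg : EqOn G g (cell c) := fun x hx => if_pos hx
    have hGf : EqOn G f (⋃ c ∈ F₀, cell c) := fun x hx => by
      by_cases h : x ∈ cell c
      · rw [hGg h, hgf ⟨h, hbd' x h hx⟩]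
      · exact if_neg h
    have hcl : IsClosed (⋃ c ∈ F₀, cell c) :=
      F₀.finite_toSet.isClosed_biUnion fun c _ => isClosed_cell c
    have hsub : insert c F₀ ⊆ F := Finset.insert_subset hc.1 h₀
    obtain ⟨k, hk, hkG, hkS⟩ := ih (insert c F₀) hsub
      (fun d hd e he => by
        rcases Finset.mem_insert.1 hd with rfl | hd
        · by_cases hed : e = d
          · exact hed ▸ Finset.mem_insert_self _ _
          · exact Finset.mem_insert_of_mem (hface e he hed)
        · exact Finset.mem_insert_of_mem (hF₀ d hd e he))
      (fun d hd hd' => hext d hd fun h => hd' (Finset.mem_insert_of_mem h)) G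
      (by
        rw [Finset.set_biUnion_insert]
        exact (hg.congr hGg).union_of_isClosed (hf.congr hGf) (isClosed_cell c) hcl)
      (fun d hd => by
        rcases Finset.mem_insert.1 hd with rfl | hd
        · exact hgS.congr hGg.symm
        · exact (hfS d hd).congr fun x hx => (hGf (mem_biUnion hd hx)).symm)
      (by
        rw [Finset.sdiff_insert, Finset.card_erase_of_mem (Finset.mem_sdiff.2 hc), hn]
        rfl)
    refine ⟨k, hk, fun x hx => ?_, hkS⟩
    rw [hkG (by rw [Finset.set_biUnion_insert]; exact Or.inr hx), hGf hx]

end Grid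

/-- A set that is a union of cells of the grid of mesh `1 / N`, for every `N > 0`. -/
def IsGridSet {j : ℕ} (W : Set (Fin j → ℝ)) : Prop :=
  ∀ N : ℕ, 0 < N → ∀ x ∈ W, ∀ y ∈ cell (code ((N : ℝ) • x)), (N : ℝ)⁻¹ • y ∈ W

theorem cellDim_of_even_zero {j : ℕ} {d : Fin (j + 1) → ℤ} (h : ¬ Odd (d 0)) :
    cellDim d = cellDim (Fin.tail d) := by
  classical
  unfold cellDim
  rw [Fintype.card_subtype, Fintype.card_subtype, Fin.card_filter_univ_succ, if_neg h]
  rfl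

theorem mem_cell_succ {j : ℕ} {d : Fin (j + 1) → ℤ} {x : Fin (j + 1) → ℝ} :
    x ∈ cell d ↔ (((d 0 / 2 : ℤ) : ℝ) ≤ x 0 ∧ x 0 ≤ (((d 0 + 1) / 2 : ℤ) : ℝ)) ∧
      Fin.tail x ∈ cell (Fin.tail d) :=
  Fin.forall_fin_succ

theorem left_mem_cell {ι : Type} (c : ι → ℤ) : (fun k => ((c k / 2 : ℤ) : ℝ)) ∈ cell c := fun k =>
  ⟨le_rfl, by rw [Int.cast_le]; omega⟩

theorem dist_le_one_of_mem_cell {ι : Type} [Fintype ι] {c : ι → ℤ} {x y : ι → ℝ} (hx : x ∈ cell c)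
    (hy : y ∈ cell c) : dist x y ≤ 1 := by
  refine (dist_pi_le_iff zero_le_one).2 fun k => ?_
  have h : (((c k + 1) / 2 : ℤ) : ℝ) ≤ ((c k / 2 : ℤ) : ℝ) + 1 := by
    have : (c k + 1) / 2 ≤ c k / 2 + 1 := by omega
    exact_mod_cast this
  rw [Real.dist_eq, abs_le]
  constructor <;> linarith [(hx k).1, (hx k).2, (hy k).1, (hy k).2]

theorem finite_cells_subset {ι : Type} [Fintype ι] {W : Set (ι → ℝ)} (hW : IsCompact W) (N : ℕ)
    (hN : 0 < N) : {c : ι → ℤ | ∀ y ∈ cell c, (N : ℝ)⁻¹ • y ∈ W}.Finite := by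
  classical
  obtain ⟨R, hR⟩ := hW.isBounded.exists_norm_le
  obtain ⟨M, hM⟩ := exists_nat_ge (N * R)
  refine (finite_Icc (fun _ : ι => -(2 * (M : ℤ)) - 2) (fun _ : ι => 2 * (M : ℤ) + 2)).subset ?_
  intro c hc
  have h1 := hR _ (hc _ (left_mem_cell c))
  have h2 : ∀ k, |((c k / 2 : ℤ) : ℝ)| ≤ M := by
    intro k
    have h3 := (norm_le_pi_norm _ k).trans h1
    have hN' : (0 : ℝ) < N := by exact_mod_cast hN
    simp only [Pi.smul_apply, smul_eq_mul, norm_mul, norm_inv, Real.norm_eq_abs] at h3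
    rw [Nat.abs_cast, inv_mul_le_iff₀ hN'] at h3
    exact h3.trans hM
  have h4 : ∀ k, -(M : ℤ) ≤ c k / 2 ∧ c k / 2 ≤ M := fun k => by
    have := abs_le.1 (h2 k)
    exact ⟨by exact_mod_cast this.1, by exact_mod_cast this.2⟩
  constructor <;> intro k <;> have := h4 k <;> dsimp only <;> omega

variable {T : Type} [TopologicalSpace T]

/-- Compression of maps: if `X` is covered by relatively open sets `U` and `O a` such that
spheres can be filled in `O a` in all dimensions and in `O a ∩ U` in dimensions at most `D`,
then maps of polyhedra of dimension at most `D` to `X` can be deformed into `U`. -/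
theorem exists_homotopy_into_open {j D : ℕ} {W W₀ : Set (Fin j → ℝ)} (hW : IsCompact W)
    (hWg : IsGridSet W) (hW₀ : W₀ ⊆ W) (hW₀g : IsGridSet W₀)
    (hdim : ∀ (N : ℕ) (c : Fin j → ℤ), 0 < N → (∀ y ∈ cell c, (N : ℝ)⁻¹ • y ∈ W) → cellDim c ≤ D)
    {κ : Type} {X U : Set T} {O : κ → Set T} (hUo : ∀ x ∈ U, U ∈ 𝓝[X] x)
    (hOX : ∀ a, O a ⊆ X) (hOo : ∀ a, ∀ x ∈ O a, O a ∈ 𝓝[X] x)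
    (hcov : ∀ x ∈ X, x ∈ U ∨ ∃ a, x ∈ O a) (hdisj : ∀ a b, a ≠ b → O a ∩ O b ⊆ U)
    (hOext : ∀ a m, SphereExt (O a) m) (hOUext : ∀ a m, m ≤ D → SphereExt (O a ∩ U) m)
    {f : (Fin j → ℝ) → T} (hf : ContinuousOn f W) (hfX : MapsTo f W X) (hfU : MapsTo f W₀ U) :
    ∃ H : (Fin j → ℝ) × ℝ → T, ContinuousOn H (W ×ˢ Icc 0 1) ∧ MapsTo H (W ×ˢ Icc 0 1) X ∧
      (∀ x ∈ W, H (x, 0) = f x) ∧ (∀ x ∈ W, H (x, 1) ∈ U) ∧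
      ∀ x ∈ W₀, ∀ t ∈ Icc (0 : ℝ) 1, H (x, t) = f x := by
  classical
  obtain ⟨N, hN, hsmall⟩ : ∃ N : ℕ, 0 < N ∧ ∀ c : Fin j → ℤ, (∀ y ∈ cell c, (N : ℝ)⁻¹ • y ∈ W) →
      (∀ y ∈ cell c, f ((N : ℝ)⁻¹ • y) ∈ U) ∨ ∃ a, ∀ y ∈ cell c, f ((N : ℝ)⁻¹ • y) ∈ O a := by
    let P : (Fin j → ℝ) → Set (Fin j → ℝ) := fun x =>
      if f x ∈ U then f ⁻¹' U else if h : ∃ a, f x ∈ O a then f ⁻¹' (O h.choose) else univ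
    have hP : ∀ x ∈ W, P x ∈ 𝓝[W] x := by
      intro x hx
      have ht : Filter.Tendsto f (𝓝[W] x) (𝓝[X] (f x)) :=
        tendsto_nhdsWithin_iff.2 ⟨hf x hx, eventually_nhdsWithin_of_forall hfX⟩
      by_cases h1 : f x ∈ U
      · simp only [P, h1, if_true]
        exact ht (hUo _ h1)
      · have h2 := (hcov _ (hfX hx)).resolve_left h1
        simp only [P, h1, if_false, h2, dif_pos]
        exact ht (hOo _ _ h2.choose_spec)
    have hP' : ∀ x, (P x ⊆ f ⁻¹' U) ∨ (∃ a, P x ⊆ f ⁻¹' (O a)) ∨ P x = univ := by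
      intro x
      by_cases h1 : f x ∈ U
      · simp [P, h1]
      · by_cases h2 : ∃ a, f x ∈ O a
        · right; left
          exact ⟨h2.choose, by simp only [P, h1, if_false, h2, dif_pos]; exact Subset.rfl⟩
        · right; right
          simp only [P, h1, if_false, h2, dif_neg, not_false_iff]
    let P' : (Fin j → ℝ) → Set (Fin j → ℝ) := fun x => if x ∈ W then P x else ∅
    have hP2 : ∀ x ∈ W, P' x ∈ 𝓝[W] x := fun x hx => by
      simp only [P', hx, if_true]
      exact hP x hx
    obtain ⟨δ, hδ, hδP⟩ := uniformity_basis_dist.lebesgue_number_lemma_nhdsWithin hW hP2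
    obtain ⟨n, hn⟩ := exists_nat_one_div_lt hδ
    refine ⟨n + 1, n.succ_pos, fun c hc => ?_⟩
    have hn0 : (0 : ℝ) < ((n + 1 : ℕ) : ℝ) := by positivity
    set p := fun k => ((c k / 2 : ℤ) : ℝ)
    have hp : p ∈ cell c := left_mem_cell c
    obtain ⟨y, hy⟩ := hδP _ (hc p hp)
    have hcy : ∀ z ∈ cell c, ((n + 1 : ℕ) : ℝ)⁻¹ • z ∈ P' y := by
      intro z hz
      refine hy ⟨?_, hc z hz⟩
      change dist _ _ < δ
      rw [dist_smul₀, norm_inv, Real.norm_natCast]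
      refine lt_of_le_of_lt ?_ hn
      rw [one_div, Nat.cast_add, Nat.cast_one]
      exact mul_le_of_le_one_right (by positivity) (dist_le_one_of_mem_cell hp hz)
    have hyW : y ∈ W := by
      by_contra h
      have := hcy p hp
      simp [P', h] at this
    simp only [P', hyW, if_true] at hcy
    by_cases h1 : f y ∈ U
    · left
      simpa [P, h1] using hcy
    · have h2 := (hcov _ (hfX hyW)).resolve_left h1
      right
      refine ⟨h2.choose, ?_⟩
      simp only [P, h1, if_false, h2, dif_pos] at hcy
      exact hcy
  have hN0 : (0 : ℝ) < N := by exact_mod_cast hN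
  let FW : Finset (Fin j → ℤ) := (finite_cells_subset hW N hN).toFinset
  have memFW : ∀ c, c ∈ FW ↔ ∀ y ∈ cell c, (N : ℝ)⁻¹ • y ∈ W := fun c => by
    simp only [FW, Set.Finite.mem_toFinset]; rfl
  have hFWface : ∀ c ∈ FW, ∀ d, Face d c → d ∈ FW := fun c hc d hd => by
    rw [memFW] at hc ⊢
    exact fun y hy => hc y (hd.cell_subset hy)
  let Q : (Fin j → ℤ) → Prop := fun c => ∀ y ∈ cell c, f ((N : ℝ)⁻¹ • y) ∈ U
  have hQface : ∀ c d, Q c → Face d c → Q d := fun c d hc hd y hy => hc y (hd.cell_subset hy)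
  have hpiece : ∀ c ∈ FW, ¬ Q c → ∃ a, ∀ y ∈ cell c, f ((N : ℝ)⁻¹ • y) ∈ O a := fun c hc hQ =>
    (hsmall c ((memFW c).1 hc)).resolve_left hQ
  have hpiece_unique : ∀ c d, Face d c → ¬ Q d → ∀ a b,
      (∀ y ∈ cell c, f ((N : ℝ)⁻¹ • y) ∈ O a) → (∀ y ∈ cell d, f ((N : ℝ)⁻¹ • y) ∈ O b) →
      a = b := by
    intro c d hd hQ a b ha hb
    by_contra hab
    exact hQ fun y hy => hdisj a b hab ⟨ha y (hd.cell_subset hy), hb y hy⟩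
  let im : (Fin j → ℤ) → Set T := fun c => (fun y => f ((N : ℝ)⁻¹ • y)) '' cell c
  let piece : (Fin j → ℤ) → Set T := fun c => ⋃ a ∈ {a | ∀ y ∈ cell c, f ((N : ℝ)⁻¹ • y) ∈ O a}, O a
  have hpiece_eq : ∀ c, ¬ Q c → ∀ a, (∀ y ∈ cell c, f ((N : ℝ)⁻¹ • y) ∈ O a) → piece c = O a := by
    intro c hc a ha
    refine Subset.antisymm (iUnion₂_subset fun b hb => ?_)
      (subset_biUnion_of_mem (u := O) (show a ∈ {a | ∀ y ∈ cell c, f ((N : ℝ)⁻¹ • y) ∈ O a} from ha))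
    rw [hpiece_unique c c (Face.refl c) hc a b ha hb]
  let S : (Fin (j + 1) → ℤ) → Set T := fun d =>
    if Q (Fin.tail d) ∨ d 0 = 0 then im (Fin.tail d)
    else if d 0 = 1 then piece (Fin.tail d) else piece (Fin.tail d) ∩ U
  let F : Finset (Fin (j + 1) → ℤ) := (({0, 1, 2} : Finset ℤ) ×ˢ FW).image
    fun p => (Fin.cons p.1 p.2 : Fin (j + 1) → ℤ)
  have memF : ∀ d, d ∈ F ↔ (d 0 = 0 ∨ d 0 = 1 ∨ d 0 = 2) ∧ Fin.tail d ∈ FW := by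
    intro d
    simp only [F, Finset.mem_image, Finset.mem_product, Finset.mem_insert, Finset.mem_singleton]
    constructor
    · rintro ⟨⟨a, c⟩, ⟨h1, h2⟩, rfl⟩
      exact ⟨h1, h2⟩
    · rintro ⟨h1, h2⟩
      exact ⟨(d 0, Fin.tail d), ⟨h1, h2⟩, Fin.cons_self_tail d⟩
  let F₀ : Finset (Fin (j + 1) → ℤ) := F.filter fun d => Q (Fin.tail d) ∨ d 0 = 0
  have htail : ∀ {d c : Fin (j + 1) → ℤ}, Face d c → Face (Fin.tail d) (Fin.tail c) :=
    fun h k => h k.succ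
  have hFface : ∀ c ∈ F, ∀ d, Face d c → d ∈ F := by
    intro c hc d hd
    rw [memF] at hc ⊢
    refine ⟨?_, hFWface _ hc.2 _ (htail hd)⟩
    have := hd 0
    omega
  have hSmono : ∀ c ∈ F, ∀ d, Face d c → S d ⊆ S c := by
    intro c hc d hd
    have him : im (Fin.tail d) ⊆ im (Fin.tail c) := image_mono (htail hd).cell_subset
    have hc' := (memF c).1 hc
    have hd' := (memF d).1 (hFface c hc d hd)
    have hd0 := hd 0
    by_cases h1 : Q (Fin.tail c) ∨ c 0 = 0
    · have h2 : Q (Fin.tail d) ∨ d 0 = 0 := by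
        rcases h1 with h1 | h1
        · exact Or.inl (hQface _ _ h1 (htail hd))
        · right; omega
      simp only [S, h1, h2, if_true]
      exact him
    · push Not at h1
      obtain ⟨a, ha⟩ := hpiece _ hc'.2 h1.1
      have hpc := hpiece_eq _ h1.1 a ha
      have hima : im (Fin.tail c) ⊆ O a := image_subset_iff.2 ha
      by_cases h2 : Q (Fin.tail d) ∨ d 0 = 0
      · by_cases h3 : c 0 = 1
        · simp only [S, h1, h2, h3, if_true, if_false, or_self, one_ne_zero, hpc]
          exact him.trans hima
        · have h4 : ¬ (Q (Fin.tail c) ∨ c 0 = 0) := by tauto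
          simp only [S, h4, h2, h3, if_true, if_false, hpc]
          have h5 : Q (Fin.tail d) := h2.resolve_right (by omega)
          exact subset_inter (him.trans hima) (image_subset_iff.2 h5)
      · push Not at h2
        obtain ⟨b, hb⟩ := hpiece _ hd'.2 h2.1
        have hpd := hpiece_eq _ h2.1 b hb
        have hab := hpiece_unique _ _ (htail hd) h2.1 a b ha hb
        subst hab
        have h4 : ¬ (Q (Fin.tail c) ∨ c 0 = 0) := by tauto
        have h5 : ¬ (Q (Fin.tail d) ∨ d 0 = 0) := by tauto
        by_cases h3 : c 0 = 1
        · simp only [S]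
          rw [if_neg h4, if_pos h3, hpc, if_neg h5, hpd]
          split_ifs
          · exact Subset.rfl
          · exact inter_subset_left
        · have h6 : ¬ (d 0 = 1) := by omega
          simp only [S, h4, h5, h3, h6, if_false, hpc, hpd]
          exact Subset.rfl
  let f' : (Fin (j + 1) → ℝ) → T := fun y => f ((N : ℝ)⁻¹ • Fin.tail y)
  have hf' : ContinuousOn f' (⋃ c ∈ F, cell c) := by
    have ht : Continuous fun y : Fin (j + 1) → ℝ => (Fin.tail y : Fin j → ℝ) :=
      continuous_pi fun k => continuous_apply (Fin.succ k)
    have hc : Continuous fun y : Fin (j + 1) → ℝ => (N : ℝ)⁻¹ • (Fin.tail y : Fin j → ℝ) :=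
      (continuous_const_smul ((N : ℝ)⁻¹)).comp ht
    refine hf.comp hc.continuousOn fun y hy => ?_
    simp only [mem_iUnion, exists_prop] at hy
    obtain ⟨c, hc, hy⟩ := hy
    exact (memFW _).1 ((memF _).1 hc).2 _ (mem_cell_succ.1 hy).2
  have hF₀F : F₀ ⊆ F := Finset.filter_subset _ _
  obtain ⟨g, hg, hgf, hgS⟩ := exists_carried_extension S F hSmono hFface F₀ hF₀F
    (by
      intro c hc d hd
      simp only [F₀, Finset.mem_filter] at hc ⊢
      refine ⟨hFface c hc.1 d hd, ?_⟩
      rcases hc.2 with h | h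
      · exact Or.inl (hQface _ _ h (htail hd))
      · right
        have h1 := hd 0
        have h2 := (memF d).1 (hFface c hc.1 d hd)
        omega)
    (by
      intro c hc hc0
      have h4 : ¬ (Q (Fin.tail c) ∨ c 0 = 0) := fun h => hc0 (Finset.mem_filter.2 ⟨hc, h⟩)
      have hc' := (memF c).1 hc
      obtain ⟨a, ha⟩ := hpiece _ hc'.2 (by tauto)
      have hpc := hpiece_eq _ (by tauto) a ha
      by_cases h3 : c 0 = 1
      · simp only [S]
        rw [if_neg h4, if_pos h3, hpc]
        exact hOext a _
      · simp only [S, h4, h3, if_false, hpc]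
        refine hOUext a _ ?_
        have h2 : c 0 = 2 := by tauto
        rw [cellDim_of_even_zero (by rw [h2]; decide)]
        exact hdim N _ hN ((memFW _).1 hc'.2))
    f' (hf'.mono (biUnion_subset_biUnion_left hF₀F))
    (by
      intro c hc y hy
      have h1 := (Finset.mem_filter.1 hc).2
      simp only [S, h1, if_true]
      exact ⟨_, (mem_cell_succ.1 hy).2, rfl⟩)
  have hcell : ∀ x ∈ W, code ((N : ℝ) • x) ∈ FW := fun x hx => (memFW _).2 (hWg N hN x hx)
  have hcons : ∀ (x : Fin j → ℝ) (t : ℝ) (e : ℤ), ((e / 2 : ℤ) : ℝ) ≤ t → t ≤ (((e + 1) / 2 : ℤ) : ℝ) →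
      (Fin.cons t ((N : ℝ) • x) : Fin (j + 1) → ℝ) ∈
        cell (Fin.cons e (code ((N : ℝ) • x)) : Fin (j + 1) → ℤ) := by
    intro x t e h1 h2
    refine mem_cell_succ.2 ⟨⟨by simpa using h1, by simpa using h2⟩, ?_⟩
    simpa only [Fin.tail_cons] using mem_cell_code _
  have hconsF : ∀ x ∈ W, ∀ e : ℤ, (e = 0 ∨ e = 1 ∨ e = 2) →
      (Fin.cons e (code ((N : ℝ) • x)) : Fin (j + 1) → ℤ) ∈ F := fun x hx e he =>
    (memF _).2 ⟨by simpa using he, by simpa only [Fin.tail_cons] using hcell x hx⟩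
  have hfcons : ∀ (x : Fin j → ℝ) (t : ℝ), f' (Fin.cons t ((N : ℝ) • x)) = f x := by
    intro x t
    simp only [f', Fin.tail_cons]
    rw [inv_smul_smul₀ hN0.ne']
  have himU : ∀ c, Q c → im c ⊆ U := fun c hc => image_subset_iff.2 hc
  have himX : ∀ c ∈ FW, im c ⊆ X := fun c hc => image_subset_iff.2 fun y hy =>
    hfX ((memFW c).1 hc y hy)
  have hpX : ∀ c, piece c ⊆ X := fun c => iUnion₂_subset fun a _ => hOX a
  refine ⟨fun p => g (Fin.cons p.2 ((N : ℝ) • p.1)), ?_, ?_, ?_, ?_, ?_⟩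
  · refine hg.comp (Continuous.continuousOn ?_) ?_
    · refine continuous_pi fun k => ?_
      refine Fin.cases ?_ (fun k => ?_) k
      · simpa using continuous_snd
      · simp only [Fin.cons_succ]
        fun_prop
    · rintro ⟨x, t⟩ ⟨hx, ht⟩
      exact mem_biUnion (hconsF x hx 1 (by simp))
        (hcons x t 1 (by norm_num; exact ht.1) (by norm_num; exact ht.2))
  · rintro ⟨x, t⟩ ⟨hx, ht⟩
    have h1 := hgS _ (hconsF x hx 1 (by simp))
      (hcons x t 1 (by norm_num; exact ht.1) (by norm_num; exact ht.2))
    simp only [S, Fin.tail_cons, Fin.cons_zero, one_ne_zero, or_false, if_true] at h1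
    split_ifs at h1
    · exact himX _ (hcell x hx) h1
    · exact hpX _ h1
  · intro x hx
    have h1 := hgf (mem_biUnion (Finset.mem_filter.2 ⟨hconsF x hx 0 (by simp), by simp⟩)
      (hcons x 0 0 (by norm_num) (by norm_num)))
    exact h1.trans (hfcons x 0)
  · intro x hx
    have h1 := hgS _ (hconsF x hx 2 (by simp)) (hcons x 1 2 (by norm_num) (by norm_num))
    simp only [S, Fin.tail_cons, Fin.cons_zero, OfNat.ofNat_ne_zero, or_false,
      OfNat.ofNat_ne_one, if_false] at h1
    split_ifs at h1 with h2
    · exact himU _ h2 h1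
    · exact h1.2
  · intro x hx t ht
    have hQ : Q (code ((N : ℝ) • x)) := fun y hy => hfU (hW₀g N hN x hx y hy)
    have h1 := hgf (mem_biUnion (Finset.mem_filter.2 ⟨hconsF x (hW₀ hx) 1 (by simp),
      by left; simpa only [Fin.tail_cons] using hQ⟩)
      (hcons x t 1 (by norm_num; exact ht.1) (by norm_num; exact ht.2)))
    exact h1.trans (hfcons x t)

theorem code_coord {ι : Type} {x : ι → ℝ} {k : ι} {z : ℤ} (h : x k = z) : code x k = 2 * z := by
  simp only [code, h, Int.floor_intCast, Int.ceil_intCast]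
  ring

theorem isGridSet_empty {j : ℕ} : IsGridSet (∅ : Set (Fin j → ℝ)) := fun _ _ _ hx => hx.elim

theorem isGridSet_cube {j : ℕ} : IsGridSet (Icc (0 : Fin j → ℝ) 1) := by
  intro N hN x hx y hy
  have hN' : (0 : ℝ) < N := by exact_mod_cast hN
  constructor <;> intro k <;> have hk := hy k <;> rw [(code_div _ k).1, (code_div _ k).2] at hk
  · have : (0 : ℤ) ≤ ⌊((N : ℝ) • x) k⌋ := Int.floor_nonneg.2 (mul_nonneg hN'.le (hx.1 k))
    have h2 : (0 : ℝ) ≤ y k := le_trans (by exact_mod_cast this) hk.1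
    exact mul_nonneg (inv_nonneg.2 hN'.le) h2
  · have : ⌈((N : ℝ) • x) k⌉ ≤ (N : ℤ) := Int.ceil_le.2 (by
      have := mul_le_mul_of_nonneg_left (hx.2 k) hN'.le
      simpa using this)
    have h2 : y k ≤ N := hk.2.trans (by exact_mod_cast this)
    change (N : ℝ)⁻¹ * y k ≤ 1
    rw [inv_mul_le_iff₀ hN', mul_one]
    exact h2

theorem mem_frontier_cube {j : ℕ} {x : Fin j → ℝ} :
    x ∈ frontier (Icc (0 : Fin j → ℝ) 1) ↔ x ∈ Icc 0 1 ∧ ∃ k, x k = 0 ∨ x k = 1 :=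
  frontier_Icc_pi

theorem isGridSet_frontier_cube {j : ℕ} : IsGridSet (frontier (Icc (0 : Fin j → ℝ) 1)) := by
  intro N hN x hx y hy
  have hN' : (0 : ℝ) < N := by exact_mod_cast hN
  rw [mem_frontier_cube] at hx ⊢
  refine ⟨isGridSet_cube N hN x hx.1 y hy, ?_⟩
  obtain ⟨k, hk⟩ := hx.2
  refine ⟨k, ?_⟩
  have hyk := hy k
  rcases hk with hk | hk
  · left
    rw [code_coord (z := 0) (by simp [hk])] at hyk
    have : y k = 0 := le_antisymm (by simpa using hyk.2) (by simpa using hyk.1)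
    simp [this]
  · right
    rw [code_coord (z := N) (by simp [hk])] at hyk
    have e1 : (2 * (N : ℤ)) / 2 = N := by omega
    have e2 : (2 * (N : ℤ) + 1) / 2 = N := by omega
    rw [e1, e2] at hyk
    have : y k = N := le_antisymm (by simpa using hyk.2) (by simpa using hyk.1)
    simp [this, hN'.ne']

theorem cellDim_le {j : ℕ} (c : Fin j → ℤ) : cellDim c ≤ j := by
  classical
  exact (Fintype.card_subtype_le fun k => Odd (c k)).trans_eq (Fintype.card_fin j)

theorem cellDim_frontier_cube {i N : ℕ} {c : Fin (i + 1) → ℤ} (hN : 0 < N)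
    (h : ∀ y ∈ cell c, (N : ℝ)⁻¹ • y ∈ frontier (Icc (0 : Fin (i + 1) → ℝ) 1)) :
    cellDim c ≤ i := by
  classical
  have hN' : (0 : ℝ) < N := by exact_mod_cast hN
  by_contra hc
  have hodd : ∀ k, Odd (c k) := by
    have h1 : Fintype.card {k // Odd (c k)} = Fintype.card (Fin (i + 1)) := by
      have := cellDim_le c
      simp only [cellDim] at this hc
      rw [Fintype.card_fin]; omega
    intro k
    by_contra hk
    exact (Fintype.card_subtype_lt (p := fun k => Odd (c k)) hk).ne h1
  have hmid : (fun k => ((c k / 2 : ℤ) : ℝ) + 1 / 2) ∈ cell c := fun k => by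
    have e : (c k + 1) / 2 = c k / 2 + 1 := by
      obtain ⟨m, hm⟩ := hodd k
      omega
    rw [e, Int.cast_add, Int.cast_one]
    constructor <;> linarith
  obtain ⟨k, hk⟩ := (mem_frontier_cube.1 (h _ hmid)).2
  simp only [Pi.smul_apply, smul_eq_mul] at hk
  have key : ∃ z : ℤ, ((c k / 2 : ℤ) : ℝ) + 1 / 2 = z := by
    rcases hk with hk | hk
    · exact ⟨0, by simpa [hN'.ne'] using hk⟩
    · refine ⟨N, ?_⟩
      rw [inv_mul_eq_iff_eq_mul₀ hN'.ne'] at hk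
      simpa using hk
  obtain ⟨z, hz⟩ := key
  have h3 : (2 : ℝ) * ((c k / 2 : ℤ) : ℝ) + 1 = 2 * z := by linarith
  have h4 : 2 * (c k / 2) + 1 = 2 * z := by exact_mod_cast h3
  omega

theorem exists_homeomorph_cube (j : ℕ) : ∃ h : (Fin j → ℝ) ≃ₜ EuclideanSpace ℝ (Fin j),
    (∀ x, h x ∈ closedBall (0 : EuclideanSpace ℝ (Fin j)) 1 ↔ x ∈ Icc 0 1) ∧
    (∀ x, h x ∈ sphere (0 : EuclideanSpace ℝ (Fin j)) 1 ↔ x ∈ frontier (Icc 0 1)) :=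
  exists_homeomorph_euclidean (by simp) (convex_Icc _ _) isCompact_Icc
    (interior_Icc_pi_nonempty fun _ => zero_lt_one)

theorem SphereExt.nonempty {T : Type} [TopologicalSpace T] [Nonempty T] {A : Set T}
    (h : SphereExt A 0) : A.Nonempty := by
  obtain ⟨t⟩ := ‹Nonempty T›
  have he : ∀ x : EuclideanSpace ℝ (Fin 0), x ∉ sphere (0 : EuclideanSpace ℝ (Fin 0)) 1 := by
    intro x hx
    rw [Subsingleton.elim x 0] at hx
    simp at hx
  obtain ⟨g, -, hg, -⟩ := h (fun _ => t) continuousOn_const fun x hx => (he x hx).elim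
  exact ⟨g 0, hg (by simp)⟩

theorem SphereExt.zero {T : Type} [TopologicalSpace T] {A : Set T} (h : A.Nonempty) :
    SphereExt A 0 := by
  obtain ⟨t, ht⟩ := h
  refine fun f _ _ => ⟨fun _ => t, continuousOn_const, fun _ _ => ht, fun x hx => ?_⟩
  rw [Subsingleton.elim x 0] at hx
  simp at hx

/-- Filling spheres in a union of two relatively open sets, one of which is aspherical. -/
theorem SphereExt.union {T : Type} [TopologicalSpace T] [Nonempty T] {X U O : Set T} {j : ℕ}
    (hUX : U ⊆ X) (hUo : ∀ x ∈ U, U ∈ 𝓝[X] x) (hOX : O ⊆ X) (hOo : ∀ x ∈ O, O ∈ 𝓝[X] x)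
    (hcov : ∀ x ∈ X, x ∈ U ∨ x ∈ O) (hU : SphereExt U j) (hO : ∀ m, SphereExt O m)
    (hOU : ∀ m, m < j → SphereExt (O ∩ U) m) : SphereExt X j := by
  rcases j with _ | i
  · exact SphereExt.zero (hU.nonempty.mono hUX)
  intro f hf hfX
  obtain ⟨h, h1, h2⟩ := exists_homeomorph_cube (i + 1)
  have hsymm : ∀ y ∈ sphere (0 : EuclideanSpace ℝ (Fin (i + 1))) 1,
      h.symm y ∈ frontier (Icc (0 : Fin (i + 1) → ℝ) 1) := fun y hy => by
    rw [← h2]; simpa using hy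
  have hmap : MapsTo h (frontier (Icc (0 : Fin (i + 1) → ℝ) 1)) (sphere 0 1) := fun x hx =>
    (h2 x).2 hx
  have hW : IsCompact (frontier (Icc (0 : Fin (i + 1) → ℝ) 1)) :=
    isCompact_Icc.of_isClosed_subset isClosed_frontier isClosed_Icc.frontier_subset
  obtain ⟨H, hH, hHX, hH0, hH1, -⟩ := exists_homotopy_into_open (κ := Unit) (O := fun _ => O)
    (D := i) (W₀ := ∅) (f := f ∘ h) hW
    isGridSet_frontier_cube (empty_subset _) isGridSet_empty
    (fun N c hN hc => cellDim_frontier_cube hN hc) hUo (fun _ => hOX) (fun _ => hOo)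
    (fun x hx => (hcov x hx).imp_right fun h => ⟨(), h⟩) (fun a b hab => (hab rfl).elim)
    (fun _ => hO) (fun _ m hm => hOU m (by omega)) (hf.comp h.continuous.continuousOn hmap)
    (hfX.comp hmap) (mapsTo_empty _ _)
  have hHs : ContinuousOn (fun p : EuclideanSpace ℝ (Fin (i + 1)) × ℝ => H (h.symm p.1, p.2))
      (sphere 0 1 ×ˢ Icc 0 1) :=
    hH.comp (by fun_prop) fun p hp => ⟨hsymm _ hp.1, hp.2⟩
  obtain ⟨g, hg, hgU, hgH⟩ := hU (fun y => H (h.symm y, 1))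
    (hHs.comp (f := fun y => (y, (1 : ℝ))) (by fun_prop) fun y hy => ⟨hy, by simp⟩)
    (fun y hy => hH1 _ (hsymm y hy))
  refine exists_extension_of_homotopy hHs (fun p hp => hHX ⟨hsymm _ hp.1, hp.2⟩) (fun y hy => ?_)
    hg (hgU.mono_right hUX) fun y hy => (hgH hy).symm
  simpa using hH0 _ (hsymm y hy)

section Wrap

variable {E : Type} [NormedAddCommGroup E]

variable (E) in
/-- The north pole of the unit sphere of `E × ℝ`. -/
noncomputable def north : WithLp 2 (E × ℝ) := WithLp.toLp 2 (0, 1)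

theorem norm_north : ‖north E‖ = 1 := by
  have h : ‖north E‖ ^ 2 = 1 := by
    rw [WithLp.prod_norm_sq_eq_of_L2]
    simp [north]
  exact (pow_eq_one_iff_of_nonneg (norm_nonneg _) two_ne_zero).1 h

variable [NormedSpace ℝ E]

/-- The map from the unit ball of `E` to the unit sphere of `E × ℝ` that collapses the boundary of
the ball to the north pole. -/
noncomputable def wrap (x : E) : WithLp 2 (E × ℝ) :=
  WithLp.toLp 2 ((2 * √(1 - ‖x‖ ^ 2)) • x, 2 * ‖x‖ ^ 2 - 1)

theorem continuous_wrap : Continuous (wrap : E → WithLp 2 (E × ℝ)) := by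
  unfold wrap
  exact (WithLp.prod_continuous_toLp 2 E ℝ).comp (by fun_prop)

theorem norm_wrap {x : E} (hx : ‖x‖ ≤ 1) : ‖wrap x‖ = 1 := by
  have h : ‖wrap x‖ ^ 2 = 1 := by
    rw [WithLp.prod_norm_sq_eq_of_L2]
    simp only [wrap, WithLp.toLp_fst, WithLp.toLp_snd, norm_smul, Real.norm_eq_abs, sq_abs, mul_pow]
    rw [Real.sq_sqrt (by nlinarith [norm_nonneg x])]
    ring
  exact (pow_eq_one_iff_of_nonneg (norm_nonneg _) two_ne_zero).1 h

theorem wrap_eq_north_iff {x : E} : wrap x = north E ↔ ‖x‖ = 1 := by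
  constructor
  · intro h
    have h1 := congrArg WithLp.snd h
    simp only [wrap, north, WithLp.toLp_snd] at h1
    exact (pow_eq_one_iff_of_nonneg (norm_nonneg _) two_ne_zero).1 (by linarith)
  · intro h
    simp only [wrap, north, h]
    norm_num

theorem wrap_injective {x y : E} (hx : ‖x‖ < 1) (h : wrap x = wrap y) : x = y := by
  have h1 := congrArg WithLp.snd h
  have h2 := congrArg WithLp.fst h
  simp only [wrap, WithLp.toLp_snd, WithLp.toLp_fst] at h1 h2
  have h3 : ‖y‖ ^ 2 = ‖x‖ ^ 2 := by linarith
  rw [h3] at h2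
  refine smul_right_injective E ?_ h2
  have : 0 < √(1 - ‖x‖ ^ 2) := Real.sqrt_pos.2 (by nlinarith [norm_nonneg x])
  positivity

theorem exists_wrap_eq {z : WithLp 2 (E × ℝ)} (hz : ‖z‖ = 1) :
    z = north E ∨ ∃ x : E, ‖x‖ ≤ 1 ∧ wrap x = z := by
  have h := WithLp.prod_norm_sq_eq_of_L2 z
  rw [hz, Real.norm_eq_abs, sq_abs] at h
  have h0 := sq_nonneg ‖z.fst‖
  have hs : z.snd ≤ 1 := by nlinarith
  rcases hs.eq_or_lt with hs | hs
  · left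
    have h1 : z.fst = 0 := by
      rw [hs] at h
      rw [← norm_eq_zero]
      exact pow_eq_zero_iff two_ne_zero |>.1 (by linarith)
    apply WithLp.ofLp_injective
    exact Prod.ext h1 hs
  · right
    have hpos : 0 < √((1 - z.snd) / 2) := Real.sqrt_pos.2 (by linarith)
    have hsq : √((1 - z.snd) / 2) ^ 2 = (1 - z.snd) / 2 := Real.sq_sqrt (by linarith)
    have hx : ‖(2 * √((1 - z.snd) / 2))⁻¹ • z.fst‖ ^ 2 = (1 + z.snd) / 2 := by
      rw [norm_smul, norm_inv, Real.norm_of_nonneg (by positivity), mul_pow, inv_pow, mul_pow, hsq]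
      have : 1 - z.snd ≠ 0 := by linarith
      field_simp
      nlinarith
    refine ⟨(2 * √((1 - z.snd) / 2))⁻¹ • z.fst, ?_, ?_⟩
    · have : -1 ≤ z.snd := by nlinarith
      exact (pow_le_one_iff_of_nonneg (norm_nonneg _) two_ne_zero).1 (by rw [hx]; linarith)
    · apply WithLp.ofLp_injective
      refine Prod.ext ?_ ?_
      · simp only [wrap]
        rw [hx, show 1 - (1 + z.snd) / 2 = (1 - z.snd) / 2 by ring, smul_inv_smul₀ (by positivity)]
        rfl
      · simp only [wrap]
        rw [hx]
        change _ = z.snd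
        ring

end Wrap

theorem SphereExt.of_homotopyGroup {T : Type} [TopologicalSpace T] {A : Set T} {i : ℕ}
    (hA : ∀ x : A, Subsingleton (HomotopyGroup (Fin i) A x)) : SphereExt A (i + 1) := by
  classical
  intro f hf hfA
  let E := EuclideanSpace ℝ (Fin i)
  let E' := WithLp 2 (E × ℝ)
  obtain ⟨k, hk1, hk2⟩ := exists_homeomorph_euclidean (E := E') (m := i + 1)
    (by simp [E', E, (WithLp.linearEquiv 2 ℝ (EuclideanSpace ℝ (Fin i) × ℝ)).finrank_eq])
    (convex_closedBall (0 : E') 1) (isCompact_closedBall _ _)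
    (by rw [interior_closedBall _ one_ne_zero]; exact nonempty_ball.2 one_pos)
  simp only [frontier_closedBall _ one_ne_zero] at hk2
  obtain ⟨h, hh1, hh2⟩ := exists_homeomorph_cube i
  let p : (Fin i → unitInterval) → E := fun c => h fun l => (c l : ℝ)
  have hp : Continuous p := by fun_prop
  have hp1 : ∀ c, ‖p c‖ ≤ 1 := fun c => by
    have := (hh1 fun l => (c l : ℝ)).2 ⟨fun l => (c l).2.1, fun l => (c l).2.2⟩
    simpa using this
  have hpb : ∀ c, ‖p c‖ = 1 ↔ c ∈ Cube.boundary (Fin i) := fun c => by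
    have := (hh2 fun l => (c l : ℝ)).trans mem_frontier_cube
    rw [mem_sphere_zero_iff_norm] at this
    refine this.trans ⟨fun h => ?_, fun h => ⟨⟨fun l => (c l).2.1, fun l => (c l).2.2⟩, ?_⟩⟩
    · obtain ⟨-, l, hl⟩ := h
      exact ⟨l, hl.imp (fun h => Subtype.ext h) fun h => Subtype.ext h⟩
    · obtain ⟨l, hl⟩ := h
      exact ⟨l, hl.imp (fun h => congrArg Subtype.val h) fun h => congrArg Subtype.val h⟩
  have hpi : Function.Injective p := fun c d hcd => by
    have := h.injective hcd
    funext l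
    exact Subtype.ext (congrFun this l)
  have hps : ∀ x : E, ‖x‖ ≤ 1 → ∃ c, p c = x := fun x hx => by
    have hx' : h.symm x ∈ Icc (0 : Fin i → ℝ) 1 := by rw [← hh1]; simpa using hx
    exact ⟨fun l => ⟨h.symm x l, hx'.1 l, hx'.2 l⟩, by simp [p]⟩
  have hkS : ∀ z : E', ‖z‖ = 1 → k z ∈ sphere (0 : EuclideanSpace ℝ (Fin (i + 1))) 1 :=
    fun z hz => (hk2 z).2 (by simpa using hz)
  let x₀ : A := ⟨f (k (north E)), hfA (hkS _ norm_north)⟩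
  let γ : GenLoop (Fin i) A x₀ := ⟨⟨fun c => ⟨f (k (wrap (p c))), hfA (hkS _ (norm_wrap (hp1 c)))⟩, by
      refine Continuous.subtype_mk ?_ _
      exact hf.comp_continuous (k.continuous.comp (continuous_wrap.comp hp))
        fun c => hkS _ (norm_wrap (hp1 c))⟩, fun c hc => by
      refine Subtype.ext ?_
      change f (k (wrap (p c))) = f (k (north E))
      rw [(wrap_eq_north_iff).2 ((hpb c).2 hc)]⟩
  obtain ⟨N⟩ : GenLoop.Homotopic γ GenLoop.const :=
    Quotient.exact ((hA x₀).elim (Quotient.mk _ γ) (Quotient.mk _ GenLoop.const))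
  have hNb : ∀ t, ∀ c ∈ Cube.boundary (Fin i), N (t, c) = x₀ := fun t c hc =>
    (N.eq_fst t hc).trans (γ.2 c hc)
  have hN1 : ∀ c, N (1, c) = x₀ := fun c => N.apply_one c
  have hN0 : ∀ c, N (0, c) = γ c := fun c => N.apply_zero c
  let base : (Fin i → unitInterval) ⊕ Unit → E' := Sum.elim (fun c => wrap (p c)) fun _ => north E
  have hbase : Continuous base :=
    (continuous_wrap.comp hp).sumElim continuous_const
  have hbase1 : ∀ a, ‖base a‖ = 1 := by
    rintro (c | u)
    · exact norm_wrap (hp1 c)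
    · exact norm_north
  let Φ : unitInterval × ((Fin i → unitInterval) ⊕ Unit) → closedBall (0 : E') 1 := fun a =>
    ⟨(1 - (a.1 : ℝ)) • base a.2, by
      rw [mem_closedBall_zero_iff, norm_smul, hbase1, mul_one, Real.norm_of_nonneg (by
        have := a.1.2.2; linarith)]
      have := a.1.2.1; linarith⟩
  have hΦ : Continuous Φ := by
    refine Continuous.subtype_mk ?_ _
    exact (continuous_const.sub (continuous_subtype_val.comp continuous_fst)).smul
      (hbase.comp continuous_snd)
  have hΦs : Function.Surjective Φ := by
    rintro ⟨z, hz⟩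
    rw [mem_closedBall_zero_iff] at hz
    have key : ∀ w : E', ‖w‖ = 1 → ∃ a, base a = w := by
      intro w hw
      rcases exists_wrap_eq hw with h | ⟨x, hx, h⟩
      · exact ⟨Sum.inr (), h.symm⟩
      · obtain ⟨c, rfl⟩ := hps x hx
        exact ⟨Sum.inl c, h⟩
    rcases eq_or_ne z 0 with rfl | hz0
    · exact ⟨(1, Sum.inr ()), Subtype.ext (by simp [Φ])⟩
    · have hzn : ‖z‖ ≠ 0 := norm_ne_zero_iff.2 hz0
      obtain ⟨a, ha⟩ := key (‖z‖⁻¹ • z) (by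
        rw [norm_smul, norm_inv, norm_norm, inv_mul_cancel₀ hzn])
      refine ⟨(⟨1 - ‖z‖, by linarith, by linarith [norm_nonneg z]⟩, a), Subtype.ext ?_⟩
      simp only [Φ, ha]
      rw [sub_sub_cancel, smul_inv_smul₀ hzn]
  have hq : IsQuotientMap Φ := hΦ.isClosedMap.isQuotientMap hΦ hΦs
  let ψ : C(unitInterval × ((Fin i → unitInterval) ⊕ Unit), A) :=
    ⟨fun a => Sum.elim (fun c => N (a.1, c)) (fun _ => x₀) a.2, by
      have h1 : Continuous fun a : ((Fin i → unitInterval) ⊕ Unit) × unitInterval =>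
          Sum.elim (fun c => N (a.2, c)) (fun _ => x₀) a.1 := by
        rw [← (Homeomorph.sumProdDistrib (X := Fin i → unitInterval) (Y := Unit)
          (Z := unitInterval)).symm.comp_continuous_iff']
        refine continuous_sum_dom.2 ⟨?_, ?_⟩
        · exact N.continuous.comp (continuous_snd.prodMk continuous_fst)
        · exact continuous_const
      exact h1.comp continuous_swap⟩
  have hψb : ∀ t a, base a = north E → ψ (t, a) = x₀ := by
    rintro t (c | u) ha
    · exact hNb t c ((hpb c).1 ((wrap_eq_north_iff).1 ha))
    · rfl
  have hψ1 : ∀ a, ψ (1, a) = x₀ := by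
    rintro (c | u)
    · exact hN1 c
    · rfl
  have hψ0 : ∀ a, (ψ (0, a) : T) = f (k (base a)) := by
    rintro (c | u)
    · exact congrArg Subtype.val (hN0 c)
    · rfl
  have hbasei : ∀ a b, base a = base b → a = b ∨ (base a = north E ∧ base b = north E) := by
    have key : ∀ c c', wrap (p c) = wrap (p c') → c = c' ∨ wrap (p c) = north E := by
      intro c c' h
      rcases (hp1 c).lt_or_eq with h1 | h1
      · exact Or.inl (hpi (wrap_injective h1 h))
      · exact Or.inr ((wrap_eq_north_iff).2 h1)
    rintro (c | u) (c' | u') h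
    · rcases key c c' h with h1 | h1
      · exact Or.inl (congrArg _ h1)
      · exact Or.inr ⟨h1, h ▸ h1⟩
    · exact Or.inr ⟨h, rfl⟩
    · exact Or.inr ⟨rfl, h.symm⟩
    · exact Or.inl rfl
  have hψ : Function.FactorsThrough ψ Φ := by
    rintro ⟨t, a⟩ ⟨t', b⟩ h
    have h' : (1 - (t : ℝ)) • base a = (1 - (t' : ℝ)) • base b := congrArg Subtype.val h
    have hn := congrArg norm h'
    rw [norm_smul, norm_smul, hbase1, hbase1, mul_one, mul_one,
      Real.norm_of_nonneg (by linarith [t.2.2]), Real.norm_of_nonneg (by linarith [t'.2.2])] at hn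
    obtain rfl : t = t' := Subtype.ext (by linarith)
    by_cases ht : t = 1
    · subst ht
      rw [hψ1, hψ1]
    · have h1 : (1 - (t : ℝ)) ≠ 0 := fun h => ht (Subtype.ext (by change (t : ℝ) = 1; linarith))
      rcases hbasei a b (smul_right_injective _ h1 h') with rfl | ⟨ha, hb⟩
      · rfl
      · rw [hψb t a ha, hψb t b hb]
  let G : C(closedBall (0 : E') 1, A) := IsQuotientMap.lift (f := ⟨Φ, hΦ⟩) hq ψ hψ
  have hG : ∀ a, G (Φ a) = ψ a := fun a =>
    DFunLike.congr_fun (IsQuotientMap.lift_comp (f := ⟨Φ, hΦ⟩) hq ψ hψ) a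
  let G' : E' → T := fun z => if hz : z ∈ closedBall (0 : E') 1 then G ⟨z, hz⟩ else x₀
  have hG'c : ContinuousOn G' (closedBall 0 1) := by
    rw [continuousOn_iff_continuous_domRestrict]
    have : (closedBall (0 : E') 1).domRestrict G' = fun z => (G z : T) := by
      funext z
      exact dif_pos z.2
    rw [this]
    exact continuous_subtype_val.comp G.continuous
  have hsymm : MapsTo k.symm (closedBall 0 1) (closedBall (0 : E') 1) := fun y hy => by
    rw [← hk1]; simpa using hy
  refine ⟨G' ∘ k.symm, hG'c.comp k.symm.continuous.continuousOn hsymm, fun y hy => ?_,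
    fun y hy => ?_⟩
  · change G' (k.symm y) ∈ A
    simp only [G', dif_pos (hsymm hy)]
    exact (G _).2
  · have hz : ‖k.symm y‖ = 1 := by
      have : k.symm y ∈ sphere (0 : E') 1 := by rw [← hk2]; simpa using hy
      exact mem_sphere_zero_iff_norm.1 this
    obtain ⟨⟨t, a⟩, ha⟩ := hΦs ⟨k.symm y, hsymm (sphere_subset_closedBall hy)⟩
    have ha' : (1 - (t : ℝ)) • base a = k.symm y := congrArg Subtype.val ha
    have hn := congrArg norm ha'
    rw [norm_smul, hbase1, mul_one, hz, Real.norm_of_nonneg (by linarith [t.2.2])] at hn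
    obtain rfl : t = 0 := Subtype.ext (by change (t : ℝ) = 0; linarith)
    change G' (k.symm y) = f y
    simp only [G', dif_pos (hsymm (sphere_subset_closedBall hy))]
    rw [← ha, hG, hψ0]
    congr 1
    have h0 : base a = k.symm y := by simpa using ha'
    rw [h0, k.apply_symm_apply]

theorem SphereExt.of_isConn {T : Type} [TopologicalSpace T] {A : Set T} {d : ℤ}
    (hA : IsConn A d) {j : ℕ} (hj : (j : ℤ) ≤ d + 1) : SphereExt A j := by
  rcases j with _ | i
  · obtain ⟨x⟩ := hA.1 (by simpa using by linarith)
    exact SphereExt.zero ⟨x, x.2⟩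
  · exact SphereExt.of_homotopyGroup (hA.2 i (by push_cast at hj; linarith))

section Simplex

variable {V : Type}

/-- The closed simplex spanned by a finite set of vertices. -/
def simplex (s : Finset V) : Set (V → ℝ) :=
  {x | (∀ v, 0 ≤ x v) ∧ (∀ v, v ∉ s → x v = 0) ∧ ∑ v ∈ s, x v = 1}

theorem mem_space {K : ASC V} {x : V → ℝ} : x ∈ K.space ↔ ∃ s ∈ K.faces, x ∈ simplex s :=
  ⟨fun ⟨h0, s, hs, h1, h2⟩ => ⟨s, hs, h0, h1, h2⟩, fun ⟨s, hs, h0, h1, h2⟩ => ⟨h0, s, hs, h1, h2⟩⟩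

theorem simplex_mono {s t : Finset V} (h : s ⊆ t) : simplex s ⊆ simplex t := fun _ hx =>
  ⟨hx.1, fun v hv => hx.2.1 v fun hs => hv (h hs), by
    rw [← hx.2.2]; exact (Finset.sum_subset h fun v _ hv => hx.2.1 v hv).symm⟩

theorem lineMap_mem_simplex {s : Finset V} {x y : V → ℝ} (hx : x ∈ simplex s) (hy : y ∈ simplex s)
    {t : ℝ} (ht : t ∈ Icc (0 : ℝ) 1) : (1 - t) • x + t • y ∈ simplex s := by
  refine ⟨fun v => ?_, fun v hv => ?_, ?_⟩
  · exact add_nonneg (mul_nonneg (by linarith [ht.2]) (hx.1 v)) (mul_nonneg ht.1 (hy.1 v))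
  · simp [hx.2.1 v hv, hy.2.1 v hv]
  · simp only [Pi.add_apply, Pi.smul_apply, smul_eq_mul, Finset.sum_add_distrib, ← Finset.mul_sum,
      hx.2.2, hy.2.2]
    ring

theorem le_one_of_mem_simplex {s : Finset V} {x : V → ℝ} (hx : x ∈ simplex s) (v : V) :
    x v ≤ 1 := by
  by_cases hv : v ∈ s
  · rw [← hx.2.2]
    exact Finset.single_le_sum (fun w _ => hx.1 w) hv
  · rw [hx.2.1 v hv]; exact zero_le_one

theorem exists_support {s : Finset V} {x : V → ℝ} (hx : x ∈ simplex s) :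
    ∃ t ⊆ s, t.Nonempty ∧ x ∈ simplex t ∧ ∀ v, 0 < x v ↔ v ∈ t := by
  classical
  have hsum : ∑ v ∈ s.filter (fun v => x v ≠ 0), x v = 1 := by
    rw [Finset.sum_filter_ne_zero]; exact hx.2.2
  refine ⟨s.filter fun v => x v ≠ 0, Finset.filter_subset _ _, ?_, ⟨hx.1, fun v hv => ?_, hsum⟩,
    fun v => ?_⟩
  · by_contra h
    rw [Finset.not_nonempty_iff_eq_empty.1 h] at hsum
    simp at hsum
  · by_contra h
    exact hv (Finset.mem_filter.2 ⟨by by_contra h'; exact h (hx.2.1 v h'), h⟩)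
  · rw [Finset.mem_filter]
    refine ⟨fun h => ⟨by by_contra h'; exact h.ne' (hx.2.1 v h'), h.ne'⟩,
      fun h => (hx.1 v).lt_of_ne h.2.symm⟩

theorem exists_support_of_mem_space {K : ASC V} {x : V → ℝ} (hx : x ∈ K.space) :
    ∃ t ∈ K.faces, x ∈ simplex t ∧ ∀ v, 0 < x v ↔ v ∈ t := by
  obtain ⟨s, hs, hxs⟩ := mem_space.1 hx
  obtain ⟨t, hts, hne, hxt, h⟩ := exists_support hxs
  exact ⟨t, K.down_closed hs hts hne, hxt, h⟩

theorem single_mem_simplex [DecidableEq V] {s : Finset V} {v : V} (hv : v ∈ s) :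
    (Pi.single v 1 : V → ℝ) ∈ simplex s := by
  refine ⟨fun w => ?_, fun w hw => ?_, ?_⟩
  · by_cases h : w = v
    · subst h; simp
    · simp [h]
  · exact Pi.single_eq_of_ne (fun h : w = v => hw (h.symm ▸ hv)) _
  · rw [Finset.sum_pi_single']
    simp [hv]

variable (V) in
/-- The finitely supported probability distributions on `V`. -/
def simplices : Set (V → ℝ) := {x | ∃ s, x ∈ simplex s}

theorem space_subset_simplices (K : ASC V) : K.space ⊆ simplices V := fun _ hx => by
  obtain ⟨s, -, h⟩ := mem_space.1 hx
  exact ⟨s, h⟩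

theorem sum_sdiff_le [DecidableEq V] {s t : Finset V} {x : V → ℝ} (hx : x ∈ simplex t) :
    ∑ v ∈ t \ s, x v ≤ 1 - ∑ v ∈ s, x v := by
  have h := (simplex_mono (Finset.subset_union_left (s₂ := s)) hx).2.2
  rw [← Finset.sum_sdiff (Finset.subset_union_right (s₁ := t) (s₂ := s))] at h
  rw [Finset.union_sdiff_right] at h
  linarith

/-- The product topology on the realization agrees with the uniform one. -/
theorem eventually_forall_abs_sub_lt {x₀ : V → ℝ} (hx₀ : x₀ ∈ simplices V) {δ : ℝ} (hδ : 0 < δ) :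
    ∀ᶠ x in 𝓝[simplices V] x₀, ∀ v, |x v - x₀ v| < δ := by
  classical
  obtain ⟨s, hs⟩ := hx₀
  have h1 : ∀ᶠ x in 𝓝[simplices V] x₀, ∑ v ∈ s, x v > 1 - δ := by
    have : Continuous fun x : V → ℝ => ∑ v ∈ s, x v := by fun_prop
    exact (this.continuousAt.continuousWithinAt).eventually (lt_mem_nhds (by
      dsimp only; rw [hs.2.2]; linarith))
  have h2 : ∀ᶠ x in 𝓝[simplices V] x₀, ∀ v ∈ s, |x v - x₀ v| < δ := by
    rw [Filter.eventually_all_finset]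
    intro v _
    have : Continuous fun x : V → ℝ => |x v - x₀ v| := by fun_prop
    exact (this.continuousAt.continuousWithinAt).eventually (gt_mem_nhds (by simpa using hδ))
  filter_upwards [h1, h2, self_mem_nhdsWithin] with x hx1 hx2 ⟨t, ht⟩ v
  by_cases hv : v ∈ s
  · exact hx2 v hv
  · rw [hs.2.1 v hv, sub_zero, abs_of_nonneg (ht.1 v)]
    by_cases hvt : v ∈ t
    · have := Finset.single_le_sum (f := x) (fun w _ => ht.1 w)
        (Finset.mem_sdiff.2 ⟨hvt, hv⟩)
      linarith [sum_sdiff_le (s := s) ht]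
    · rw [ht.2.1 v hvt]; exact hδ

theorem finsum_eq_sum_of_le {s : Finset V} {x y : V → ℝ} (hx : x ∈ simplex s)
    (hy : ∀ v, 0 ≤ y v ∧ y v ≤ x v) : ∑ᶠ v, y v = ∑ v ∈ s, y v := by
  refine finsum_eq_sum_of_support_subset _ fun v hv => ?_
  by_contra h
  exact hv (le_antisymm ((hy v).2.trans (hx.2.1 v h).le) (hy v).1)

theorem continuousOn_finsum_of_le {h : (V → ℝ) → V → ℝ}
    (hc : ∀ v, ContinuousOn (fun x => h x v) (simplices V))
    (hle : ∀ x ∈ simplices V, ∀ v, 0 ≤ h x v ∧ h x v ≤ x v) :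
    ContinuousOn (fun x => ∑ᶠ v, h x v) (simplices V) := by
  classical
  intro x₀ hx₀
  obtain ⟨s, hs⟩ := hx₀
  have hx₀ : x₀ ∈ simplices V := ⟨s, hs⟩
  have h1 : Filter.Tendsto (fun x : V → ℝ => ∑ v ∈ s, h x v) (𝓝[simplices V] x₀)
      (𝓝 (∑ᶠ v, h x₀ v)) := by
    rw [finsum_eq_sum_of_le hs (hle x₀ hx₀)]
    exact tendsto_finsetSum _ fun v _ => hc v x₀ hx₀
  have h2 : Filter.Tendsto (fun x : V → ℝ => ∑ v ∈ s, h x v + (1 - ∑ v ∈ s, x v))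
      (𝓝[simplices V] x₀) (𝓝 (∑ᶠ v, h x₀ v)) := by
    have h3 : Filter.Tendsto (fun x : V → ℝ => 1 - ∑ v ∈ s, x v) (𝓝[simplices V] x₀) (𝓝 0) := by
      have : Continuous fun x : V → ℝ => 1 - ∑ v ∈ s, x v := by fun_prop
      have h4 := this.continuousAt.continuousWithinAt (s := simplices V) (x := x₀)
      unfold ContinuousWithinAt at h4
      dsimp only at h4
      rwa [hs.2.2, sub_self] at h4
    simpa using h1.add h3
  have key : ∀ x ∈ simplices V, ∑ v ∈ s, h x v ≤ ∑ᶠ v, h x v ∧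
      ∑ᶠ v, h x v ≤ ∑ v ∈ s, h x v + (1 - ∑ v ∈ s, x v) := by
    rintro x ⟨t, ht⟩
    have hx : x ∈ simplices V := ⟨t, ht⟩
    rw [finsum_eq_sum_of_le (simplex_mono (Finset.subset_union_left (s₂ := s)) ht) (hle x hx),
      ← Finset.sum_sdiff (Finset.subset_union_right (s₁ := t) (s₂ := s)), Finset.union_sdiff_right]
    have h4 : 0 ≤ ∑ v ∈ t \ s, h x v := Finset.sum_nonneg fun v _ => (hle x hx v).1
    have h5 : ∑ v ∈ t \ s, h x v ≤ ∑ v ∈ t \ s, x v :=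
      Finset.sum_le_sum fun v _ => (hle x hx v).2
    constructor <;> linarith [sum_sdiff_le (s := s) ht]
  exact tendsto_of_tendsto_of_tendsto_of_le_of_le' h1 h2
    (eventually_nhdsWithin_of_forall fun x hx => (key x hx).1)
    (eventually_nhdsWithin_of_forall fun x hx => (key x hx).2)

end Simplex

section Truncation

variable {V : Type} {F : Set (Finset V)} {ε : ℝ} {x : V → ℝ}

/-- The largest weight of a member of `F` through `v`, where the weight of a simplex is the
smallest barycentric coordinate of `x` on it. -/
noncomputable def weight (F : Set (Finset V)) (x : V → ℝ) (v : V) : ℝ :=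
  ⨆ u : {u : Finset V // u ∈ F ∧ v ∈ u}, u.1.inf' ⟨v, u.2.2⟩ x

theorem weight_le (hx : ∀ v, 0 ≤ x v) (v : V) : weight F x v ≤ x v :=
  Real.iSup_le (fun u => Finset.inf'_le _ u.2.2) (hx v)

theorem weight_nonneg (hx : ∀ v, 0 ≤ x v) (v : V) : 0 ≤ weight F x v :=
  Real.iSup_nonneg fun _ => Finset.le_inf' _ _ fun w _ => hx w

theorem inf'_le_weight {u : Finset V} {v : V} (hu : u ∈ F) (hv : v ∈ u) :
    u.inf' ⟨v, hv⟩ x ≤ weight F x v :=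
  le_ciSup (f := fun u : {u : Finset V // u ∈ F ∧ v ∈ u} => u.1.inf' ⟨v, u.2.2⟩ x)
    ⟨x v, by rintro _ ⟨u, rfl⟩; exact Finset.inf'_le _ u.2.2⟩ ⟨u, hu, hv⟩

theorem weight_le_add {y : V → ℝ} {δ : ℝ} (hδ : 0 ≤ δ) (hy : ∀ v, 0 ≤ y v)
    (h : ∀ v, x v ≤ y v + δ) (v : V) : weight F x v ≤ weight F y v + δ := by
  refine Real.iSup_le (fun u => ?_) (add_nonneg (weight_nonneg hy v) hδ)
  rw [← sub_le_iff_le_add]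
  refine le_trans (Finset.le_inf' _ _ fun w hw => ?_) (inf'_le_weight u.2.1 u.2.2)
  rw [sub_le_iff_le_add]
  exact (Finset.inf'_le _ hw).trans (h w)

theorem exists_pos_of_weight_pos {v : V} (h : 0 < weight F x v) :
    ∃ u ∈ F, v ∈ u ∧ ∀ w ∈ u, 0 < x w := by
  by_contra! hc
  refine h.not_ge (Real.iSup_le (fun u => ?_) le_rfl)
  obtain ⟨w, hw, hxw⟩ := hc u.1 u.2.1 u.2.2
  exact (Finset.inf'_le _ hw).trans hxw

theorem continuousOn_weight (v : V) : ContinuousOn (fun x => weight F x v) (simplices V) := by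
  intro x₀ hx₀
  rw [ContinuousWithinAt, Metric.tendsto_nhds]
  intro δ hδ
  filter_upwards [eventually_forall_abs_sub_lt hx₀ (half_pos hδ), self_mem_nhdsWithin] with x hx hxs
  obtain ⟨s, hs⟩ := hx₀
  obtain ⟨t, ht⟩ := hxs
  have h1 := weight_le_add (F := F) (x := x) (half_pos hδ).le hs.1
    (fun w => by linarith [(abs_lt.1 (hx w)).2]) v
  have h2 := weight_le_add (F := F) (x := x₀) (half_pos hδ).le ht.1
    (fun w => by linarith [(abs_lt.1 (hx w)).1]) v
  rw [Real.dist_eq, abs_lt]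
  constructor <;> linarith

/-- Subtract from each coordinate its weight, but at most `ε`. -/
noncomputable def trunc (F : Set (Finset V)) (ε : ℝ) (x : V → ℝ) (v : V) : ℝ :=
  x v - min (weight F x v) ε

theorem trunc_bounds (hε : 0 ≤ ε) (hx : ∀ v, 0 ≤ x v) (v : V) :
    0 ≤ trunc F ε x v ∧ trunc F ε x v ≤ x v := by
  have h1 := weight_le (F := F) hx v
  have h2 := weight_nonneg (F := F) hx v
  constructor
  · exact sub_nonneg.2 ((min_le_left _ _).trans h1)
  · exact sub_le_self _ (le_min h2 hε)

theorem continuousOn_trunc (v : V) : ContinuousOn (fun x => trunc F ε x v) (simplices V) :=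
  (continuous_apply v).continuousOn.sub (ContinuousOn.inf (continuousOn_weight v) continuousOn_const)

/-- The total mass of the truncation. -/
noncomputable def mass (F : Set (Finset V)) (ε : ℝ) (x : V → ℝ) : ℝ := ∑ᶠ v, trunc F ε x v

theorem continuousOn_mass (hε : 0 ≤ ε) : ContinuousOn (mass F ε) (simplices V) :=
  continuousOn_finsum_of_le continuousOn_trunc fun _ ⟨_, hs⟩ v => trunc_bounds hε hs.1 v

theorem mass_eq (hε : 0 ≤ ε) {s : Finset V} (hx : x ∈ simplex s) :
    mass F ε x = ∑ v ∈ s, trunc F ε x v :=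
  finsum_eq_sum_of_le hx fun v => trunc_bounds hε hx.1 v

theorem mass_pos_iff (hε : 0 ≤ ε) {s : Finset V} (hx : x ∈ simplex s) :
    0 < mass F ε x ↔ ∃ v, 0 < trunc F ε x v := by
  rw [mass_eq hε hx, Finset.sum_pos_iff_of_nonneg fun v _ => (trunc_bounds hε hx.1 v).1]
  refine ⟨fun ⟨v, _, h⟩ => ⟨v, h⟩, fun ⟨v, h⟩ => ⟨v, ?_, h⟩⟩
  by_contra hv
  have := (trunc_bounds (F := F) hε hx.1 v).2
  rw [hx.2.1 v hv] at this
  exact absurd this h.not_ge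

/-- The renormalized truncation, which moves points away from the simplices in `F`. -/
noncomputable def pushAway (F : Set (Finset V)) (ε : ℝ) (x : V → ℝ) : V → ℝ :=
  (mass F ε x)⁻¹ • trunc F ε x

theorem continuousOn_pushAway (hε : 0 ≤ ε) :
    ContinuousOn (pushAway F ε) {x ∈ simplices V | 0 < mass F ε x} := by
  refine ContinuousOn.smul (((continuousOn_mass hε).mono (sep_subset _ _)).inv₀ fun x hx => hx.2.ne')
    (continuousOn_pi.2 fun v => (continuousOn_trunc v).mono (sep_subset _ _))

theorem pushAway_mem_simplex (hε : 0 ≤ ε) {s : Finset V} (hx : x ∈ simplex s)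
    (h : 0 < mass F ε x) : pushAway F ε x ∈ simplex s := by
  refine ⟨fun v => mul_nonneg (inv_nonneg.2 h.le) (trunc_bounds hε hx.1 v).1, fun v hv => ?_, ?_⟩
  · have h1 := trunc_bounds (F := F) hε hx.1 v
    rw [hx.2.1 v hv] at h1
    simp [pushAway, le_antisymm h1.2 h1.1]
  · simp only [pushAway, Pi.smul_apply, smul_eq_mul, ← Finset.mul_sum]
    rw [← mass_eq hε hx, inv_mul_cancel₀ h.ne']

theorem pushAway_pos_iff (h : 0 < mass F ε x) {v : V} :
    0 < pushAway F ε x v ↔ 0 < trunc F ε x v := by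
  simp only [pushAway, Pi.smul_apply, smul_eq_mul]
  exact mul_pos_iff_of_pos_left (inv_pos.2 h)

/-- The vertex of `u ∈ F` with the smallest coordinate survives the truncation only if this
coordinate exceeds `ε`. -/
theorem exists_min_trunc (hx : ∀ v, 0 ≤ x v) {u : Finset V} (hu : u ∈ F) (hne : u.Nonempty) :
    ∃ v ∈ u, (∀ w ∈ u, x v ≤ x w) ∧ (0 < trunc F ε x v → ε < x v) := by
  obtain ⟨v, hv, hmin⟩ := u.exists_min_image x hne
  refine ⟨v, hv, hmin, fun h => ?_⟩
  have h1 : x v ≤ weight F x v := (Finset.le_inf' _ _ hmin).trans (inf'_le_weight hu hv)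
  have h2 : weight F x v = x v := le_antisymm (weight_le hx v) h1
  rw [trunc, h2] at h
  by_contra hc
  rw [min_eq_left (not_lt.1 hc), sub_self] at h
  exact h.false

theorem trunc_eq_self (hε : 0 ≤ ε) (hx : ∀ v, 0 ≤ x v) (h : ∀ u ∈ F, ¬ ∀ w ∈ u, 0 < x w) :
    trunc F ε x = x := by
  funext v
  have : weight F x v = 0 := by
    refine le_antisymm (not_lt.1 fun hp => ?_) (weight_nonneg hx v)
    obtain ⟨u, hu, -, h'⟩ := exists_pos_of_weight_pos hp
    exact h u hu h'
  rw [trunc, this, min_eq_left hε, sub_zero]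

theorem mass_eq_one (hε : 0 ≤ ε) {s : Finset V} (hx : x ∈ simplex s)
    (h : ∀ u ∈ F, ¬ ∀ w ∈ u, 0 < x w) : mass F ε x = 1 := by
  rw [mass_eq hε hx, trunc_eq_self hε hx.1 h, hx.2.2]

theorem pushAway_eq_self (hε : 0 ≤ ε) {s : Finset V} (hx : x ∈ simplex s)
    (h : ∀ u ∈ F, ¬ ∀ w ∈ u, 0 < x w) : pushAway F ε x = x := by
  rw [pushAway, mass_eq_one hε hx h, trunc_eq_self hε hx.1 h, inv_one, one_smul]

end Truncation

section Suspension

variable {V : Type} [DecidableEq V] (K : ASC V) (Bad : Set (Finset V)) (σ : Finset V)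

/-- The simplices `s` such that every bad face of `s ∪ σ` is contained in `σ`, and which meet `σ`
in a proper face of `ρ`. For `ρ = σ` this is the join of `∂σ` with `goodFor K Bad σ`. -/
def goodJoin (ρ : Finset V) : ASC V where
  faces := {s | s.Nonempty ∧ ¬ ρ ⊆ s ∧ s ∩ σ ⊆ ρ ∧ s ∪ σ ∈ K.faces ∧
    ∀ u ⊆ s ∪ σ, u ∈ Bad → u ⊆ σ}
  nonempty_of_mem := fun _ h => h.1
  down_closed := by
    rintro s t ⟨-, h2, h3, h4, h5⟩ hts hne
    have h := Finset.union_subset_union_left (t := σ) hts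
    exact ⟨hne, fun h => h2 (h.trans hts), (Finset.inter_subset_inter_right hts).trans h3,
      K.down_closed h4 h (hne.mono Finset.subset_union_left), fun u hu => h5 u (hu.trans h)⟩

/-- The simplices `s` such that every bad face of `s ∪ σ` is contained in `σ`, and which meet `σ`
in a face of `ρ`. -/
def goodCone (ρ : Finset V) : ASC V where
  faces := {s | s.Nonempty ∧ s ∩ σ ⊆ ρ ∧ s ∪ σ ∈ K.faces ∧ ∀ u ⊆ s ∪ σ, u ∈ Bad → u ⊆ σ}
  nonempty_of_mem := fun _ h => h.1
  down_closed := by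
    rintro s t ⟨-, h3, h4, h5⟩ hts hne
    have h := Finset.union_subset_union_left (t := σ) hts
    exact ⟨hne, (Finset.inter_subset_inter_right hts).trans h3,
      K.down_closed h4 h (hne.mono Finset.subset_union_left), fun u hu => h5 u (hu.trans h)⟩

variable {K Bad σ}

theorem goodJoin_singleton_faces (hBad : ∀ s ∈ Bad, s.Nonempty) {v : V} (hv : v ∈ σ) :
    (goodJoin K Bad σ {v}).faces = (goodFor K Bad σ).faces := by
  ext s
  constructor
  · rintro ⟨h1, h2, h3, h4, h5⟩
    have hd : Disjoint σ s := by
      rw [Finset.disjoint_left]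
      intro w hw hws
      have := Finset.mem_singleton.1 (h3 (Finset.mem_inter.2 ⟨hws, hw⟩))
      subst this
      exact h2 (Finset.singleton_subset_iff.2 hws)
    exact ⟨⟨K.down_closed h4 Finset.subset_union_left h1, hd, Finset.union_comm s σ ▸ h4⟩,
      fun u hu _ hb => h5 u hu hb⟩
  · rintro ⟨⟨h1, h2, h3⟩, h4⟩
    refine ⟨K.nonempty_of_mem h1, fun h => Finset.disjoint_left.1 h2 hv
      (Finset.singleton_subset_iff.1 h), fun w hw => ?_, Finset.union_comm s σ ▸ h3,
      fun u hu hb => h4 u hu (hBad u hb) hb⟩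
    rw [Finset.mem_inter] at hw
    exact (Finset.disjoint_left.1 h2 hw.2 hw.1).elim

theorem sphereExt_goodCone {ρ : Finset V} (hρσ : ρ ⊆ σ) (hρ : ρ.Nonempty) (hσ : σ ∈ K.faces)
    (m : ℕ) : SphereExt (goodCone K Bad σ ρ).space m := by
  obtain ⟨u, hu⟩ := hρ
  have hins : ∀ s : Finset V, insert u s ∪ σ = s ∪ σ := fun s => by
    rw [Finset.insert_union, Finset.insert_eq_of_mem (Finset.mem_union_right _ (hρσ hu))]
  refine SphereExt.of_starConvex (p := Pi.single u 1) ?_ ?_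
  · refine mem_space.2 ⟨{u}, ⟨Finset.singleton_nonempty u, ?_, ?_, ?_⟩, single_mem_simplex (by simp)⟩
    · exact Finset.inter_subset_left.trans (Finset.singleton_subset_iff.2 hu)
    · rw [Finset.union_eq_right.2 (Finset.singleton_subset_iff.2 (hρσ hu))]
      exact hσ
    · rw [Finset.union_eq_right.2 (Finset.singleton_subset_iff.2 (hρσ hu))]
      exact fun w hw _ => hw
  · intro x hx t ht
    obtain ⟨s, ⟨h1, h2, h3, h4⟩, hs⟩ := mem_space.1 hx
    refine mem_space.2 ⟨insert u s, ⟨Finset.insert_nonempty _ _, ?_, ?_, ?_⟩,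
      lineMap_mem_simplex (simplex_mono (Finset.subset_insert _ _) hs)
        (single_mem_simplex (Finset.mem_insert_self _ _)) ht⟩
    · intro w hw
      rw [Finset.mem_inter, Finset.mem_insert] at hw
      rcases hw with ⟨rfl | hw, hwσ⟩
      · exact hu
      · exact h2 (Finset.mem_inter.2 ⟨hw, hwσ⟩)
    · rw [hins]; exact h3
    · rw [hins]; exact h4

/-- Radial projection away from the vertex `v`. -/
noncomputable def project (v : V) (x : V → ℝ) : V → ℝ :=
  (1 - x v)⁻¹ • (x - x v • (Pi.single v 1 : V → ℝ))

theorem continuousOn_project (v : V) : ContinuousOn (project v) {x | x v ≠ 1} := by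
  refine ContinuousOn.smul (ContinuousOn.inv₀
    (continuous_const.sub (continuous_apply v)).continuousOn fun x hx => ?_) ?_
  · exact sub_ne_zero.2 (Ne.symm hx)
  · exact Continuous.continuousOn (continuous_id.sub ((continuous_apply v).smul continuous_const))

theorem project_mem_simplex {v : V} {s : Finset V} {x : V → ℝ} (hx : x ∈ simplex s)
    (hv : x v ≠ 1) : project v x ∈ simplex (s.erase v) ∧ (s.erase v).Nonempty := by
  have h1 : 0 < 1 - x v := sub_pos.2 ((le_one_of_mem_simplex hx v).lt_of_ne hv)
  have hval : ∀ w, w ≠ v → project v x w = (1 - x v)⁻¹ * x w := fun w hw => by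
    simp [project, hw]
  have hv0 : project v x v = 0 := by simp [project]
  have hsum : ∑ w ∈ s.erase v, x w = 1 - x v := by
    by_cases hvs : v ∈ s
    · rw [← hx.2.2, ← Finset.add_sum_erase s x hvs]; ring
    · rw [Finset.erase_eq_of_notMem hvs, hx.2.1 v hvs, hx.2.2]; ring
  refine ⟨⟨fun w => ?_, fun w hw => ?_, ?_⟩, ?_⟩
  · by_cases h : w = v
    · rw [h, hv0]
    · rw [hval w h]
      exact mul_nonneg (inv_nonneg.2 h1.le) (hx.1 w)
  · by_cases h : w = v
    · rw [h, hv0]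
    · rw [hval w h, hx.2.1 w fun hws => hw (Finset.mem_erase.2 ⟨h, hws⟩), mul_zero]
  · rw [Finset.sum_congr rfl fun w hw => hval w (Finset.ne_of_mem_erase hw), ← Finset.mul_sum, hsum,
      inv_mul_cancel₀ h1.ne']
  · by_contra h
    rw [Finset.not_nonempty_iff_eq_empty] at h
    rw [h, Finset.sum_empty] at hsum
    linarith

theorem project_apply_self (v : V) (x : V → ℝ) : project v x v = 0 := by simp [project]

theorem sphereExt_goodJoin_insert {ρ : Finset V} {v : V} (hv : v ∉ ρ) (hσ : insert v ρ ⊆ σ)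
    (hρ : ρ.Nonempty) (hσK : σ ∈ K.faces) {j : ℕ}
    (hj : ∀ m, m < j → SphereExt (goodJoin K Bad σ ρ).space m) :
    SphereExt (goodJoin K Bad σ (insert v ρ)).space j := by
  have hvσ : v ∈ σ := hσ (Finset.mem_insert_self _ _)
  have hρσ : ρ ⊆ σ := (Finset.subset_insert _ _).trans hσ
  set X := (goodJoin K Bad σ (insert v ρ)).space
  have hins : ∀ s : Finset V, insert v s ∪ σ = s ∪ σ := fun s => by
    rw [Finset.insert_union, Finset.insert_eq_of_mem (Finset.mem_union_right _ hvσ)]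
  have hers : ∀ s : Finset V, s.erase v ∪ σ = s ∪ σ := fun s => by
    ext w
    by_cases hw : w = v
    · simp [hw, hvσ]
    · simp [hw]
  have hmem : ∀ {x : V → ℝ}, x ∈ X → 0 < x v → ∃ s ∈ (goodJoin K Bad σ (insert v ρ)).faces,
      x ∈ simplex s ∧ v ∈ s := by
    intro x hx hxv
    obtain ⟨s, hs, hxs⟩ := mem_space.1 hx
    refine ⟨s, hs, hxs, ?_⟩
    by_contra h
    exact hxv.ne' (hxs.2.1 v h)
  have hinter : ∀ {s : Finset V}, s ∩ σ ⊆ insert v ρ → s.erase v ∩ σ ⊆ ρ := by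
    intro s hs w hw
    rw [Finset.mem_inter, Finset.mem_erase] at hw
    exact (Finset.mem_insert.1 (hs (Finset.mem_inter.2 ⟨hw.1.2, hw.2⟩))).resolve_left hw.1.1
  have hle : ∀ {x : V → ℝ}, x ∈ X → x v ≤ 1 := fun hx => by
    obtain ⟨s, -, hs⟩ := mem_space.1 hx
    exact le_one_of_mem_simplex hs v
  have hnn : ∀ {x : V → ℝ}, x ∈ X → 0 ≤ x v := fun hx => hx.1 v
  refine SphereExt.union (U := {x ∈ X | x v ≠ 1}) (O := {x ∈ X | 0 < x v}) (sep_subset _ _) ?_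
    (sep_subset _ _) ?_ ?_ ?_ ?_ ?_
  · rintro x ⟨-, hx⟩
    exact Filter.inter_mem self_mem_nhdsWithin (mem_nhdsWithin_of_mem_nhds
      ((isOpen_ne.preimage (continuous_apply v)).mem_nhds hx))
  · rintro x ⟨-, hx⟩
    exact Filter.inter_mem self_mem_nhdsWithin (mem_nhdsWithin_of_mem_nhds
      ((isOpen_Ioi.preimage (continuous_apply v)).mem_nhds hx))
  · intro x hx
    by_cases h : x v = 1
    · exact Or.inr ⟨hx, by rw [h]; exact one_pos⟩
    · exact Or.inl ⟨hx, h⟩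
  · refine SphereExt.of_linear_homotopy (φ := project v) (ψ := id)
      (sphereExt_goodCone (Bad := Bad) hρσ hρ hσK j)
      ((continuousOn_project v).mono fun x hx => hx.2) ?_ continuousOn_id ?_ ?_
    · rintro x ⟨hx, hxv⟩
      obtain ⟨s, ⟨-, -, h3, h4, h5⟩, hs⟩ := mem_space.1 hx
      obtain ⟨h6, h7⟩ := project_mem_simplex hs hxv
      exact mem_space.2 ⟨s.erase v, ⟨h7, hinter h3, by rwa [hers], by rwa [hers]⟩, h6⟩
    · intro x hx
      obtain ⟨s, ⟨h1, h3, h4, h5⟩, hs⟩ := mem_space.1 hx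
      have hvs : v ∉ s := fun h => hv (h3 (Finset.mem_inter.2 ⟨h, hvσ⟩))
      refine ⟨mem_space.2 ⟨s, ⟨h1, fun h => hvs (h (Finset.mem_insert_self _ _)),
        h3.trans (Finset.subset_insert _ _), h4, h5⟩, hs⟩, ?_⟩
      change x v ≠ 1
      rw [hs.2.1 v hvs]
      exact zero_ne_one
    · rintro x ⟨hx, hxv⟩ t ht
      obtain ⟨s, hsf, hs⟩ := mem_space.1 hx
      obtain ⟨h6, h7⟩ := project_mem_simplex hs hxv
      refine ⟨mem_space.2 ⟨s, hsf, lineMap_mem_simplex hs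
        (simplex_mono (Finset.erase_subset _ _) h6) ht⟩, ?_⟩
      simp only [Pi.add_apply, Pi.smul_apply, smul_eq_mul, id, project_apply_self, mul_zero, add_zero]
      have h8 := (hle hx).lt_of_ne hxv
      have h9 := hnn hx
      nlinarith [ht.1, ht.2]
  · intro m
    refine SphereExt.of_starConvex (p := Pi.single v 1) ⟨mem_space.2 ⟨{v},
      ⟨Finset.singleton_nonempty v, fun h => ?_, ?_, ?_, ?_⟩, single_mem_simplex (by simp)⟩, by simp⟩ ?_
    · obtain ⟨u, hu⟩ := hρ
      have := Finset.mem_singleton.1 (h (Finset.mem_insert_of_mem hu))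
      exact hv (this ▸ hu)
    · exact Finset.inter_subset_left.trans (by simp)
    · rw [Finset.union_eq_right.2 (Finset.singleton_subset_iff.2 hvσ)]
      exact hσK
    · rw [Finset.union_eq_right.2 (Finset.singleton_subset_iff.2 hvσ)]
      exact fun w hw _ => hw
    · rintro x ⟨hx, hxv⟩ t ht
      obtain ⟨s, hsf, hs, hvs⟩ := hmem hx hxv
      refine ⟨mem_space.2 ⟨s, hsf, lineMap_mem_simplex hs (single_mem_simplex hvs) ht⟩, ?_⟩
      simp only [Pi.add_apply, Pi.smul_apply, smul_eq_mul, Pi.single_eq_same, mul_one]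
      rcases ht.1.eq_or_lt with h | h
      · rw [← h]; simpa using hxv
      · exact add_pos_of_nonneg_of_pos (mul_nonneg (by linarith [ht.2]) hxv.le) h
  · intro m hm
    refine SphereExt.of_linear_homotopy (φ := project v)
      (ψ := fun y => (1 - (1 / 2 : ℝ)) • y + (1 / 2 : ℝ) • (Pi.single v 1 : V → ℝ)) (hj m hm)
      ((continuousOn_project v).mono fun x hx => hx.2.2) ?_ (Continuous.continuousOn (by fun_prop))
      ?_ ?_
    · rintro x ⟨⟨hx, hxv⟩, -, hxv'⟩
      obtain ⟨s, ⟨-, h2, h3, h4, h5⟩, hs, hvs⟩ := hmem hx hxv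
      obtain ⟨h6, h7⟩ := project_mem_simplex hs hxv'
      refine mem_space.2 ⟨s.erase v, ⟨h7, fun h => h2 ?_, hinter h3, by rwa [hers], by rwa [hers]⟩,
        h6⟩
      exact Finset.insert_subset hvs (h.trans (Finset.erase_subset _ _))
    · intro y hy
      obtain ⟨s, ⟨h1, h2, h3, h4, h5⟩, hs⟩ := mem_space.1 hy
      have hvs : v ∉ s := fun h => hv (h3 (Finset.mem_inter.2 ⟨h, hvσ⟩))
      have hX : (1 - (1 / 2 : ℝ)) • y + (1 / 2 : ℝ) • (Pi.single v 1 : V → ℝ) ∈ X := by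
        refine mem_space.2 ⟨insert v s, ⟨Finset.insert_nonempty _ _, fun h => h2 fun w hw => ?_, ?_,
          by rwa [hins], by rwa [hins]⟩,
          lineMap_mem_simplex (simplex_mono (Finset.subset_insert _ _) hs)
            (single_mem_simplex (Finset.mem_insert_self _ _)) ⟨by norm_num, by norm_num⟩⟩
        · have hwv : w ≠ v := fun h => hv (h ▸ hw)
          exact (Finset.mem_insert.1 (h (Finset.mem_insert_of_mem hw))).resolve_left hwv
        · rw [Finset.insert_inter_of_mem hvσ]
          exact Finset.insert_subset_insert _ h3
      refine ⟨⟨hX, ?_⟩, hX, ?_⟩ <;>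
        simp only [Pi.add_apply, Pi.smul_apply, smul_eq_mul, Pi.single_eq_same, hs.2.1 v hvs] <;>
        norm_num
    · rintro x ⟨⟨hx, hxv⟩, -, hxv'⟩ t ht
      obtain ⟨s, hsf, hs, hvs⟩ := hmem hx hxv
      obtain ⟨h6, h7⟩ := project_mem_simplex hs hxv'
      have hX := lineMap_mem_simplex hs (lineMap_mem_simplex
        (simplex_mono (Finset.erase_subset _ _) h6) (single_mem_simplex hvs)
        (t := 1 / 2) ⟨by norm_num, by norm_num⟩) ht
      have hX' := mem_space.2 ⟨s, hsf, hX⟩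
      have h8 := (hle hx).lt_of_ne hxv'
      refine ⟨⟨hX', ?_⟩, hX', ne_of_lt ?_⟩ <;>
        simp only [Pi.add_apply, Pi.smul_apply, smul_eq_mul, project_apply_self, mul_zero, zero_add,
          Pi.single_eq_same, mul_one]
      · rcases ht.1.eq_or_lt with h | h
        · rw [← h]; simpa using hxv
        · exact add_pos_of_nonneg_of_pos (mul_nonneg (by linarith [ht.2]) hxv.le) (by linarith)
      · rcases ht.1.eq_or_lt with h | h
        · rw [← h]; simpa using h8
        · nlinarith [ht.2]

theorem sphereExt_goodJoin (hBad : ∀ s ∈ Bad, s.Nonempty) (hσK : σ ∈ K.faces) {n : ℕ}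
    (hG : IsConn (↥(goodFor K Bad σ).space) ((n : ℤ) - σ.card)) {ρ : Finset V}
    (hρ : ρ.Nonempty) : ρ ⊆ σ → ∀ j : ℕ, j + σ.card ≤ n + ρ.card →
      SphereExt (goodJoin K Bad σ ρ).space j := by
  induction hρ using Finset.Nonempty.cons_induction with
  | singleton v =>
    intro hρσ j hj
    have hfaces := goodJoin_singleton_faces (K := K) hBad (hρσ (Finset.mem_singleton_self v))
    have : (goodJoin K Bad σ {v}).space = (goodFor K Bad σ).space := by
      unfold ASC.space
      rw [hfaces]
    rw [this]
    rw [Finset.card_singleton] at hj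
    exact SphereExt.of_isConn hG (by omega)
  | cons v ρ hv hρ ih =>
    intro hρσ j hj
    rw [Finset.cons_eq_insert] at hρσ ⊢
    rw [Finset.card_cons] at hj
    exact sphereExt_goodJoin_insert hv hρσ hρ hσK fun m hm =>
      ih ((Finset.subset_insert _ _).trans hρσ) m (by omega)

end Suspension

theorem exists_homotopicRel {B Z T : Type} [TopologicalSpace B] [TopologicalSpace Z]
    [TopologicalSpace T] {A : Set T} {f : C(B, A)} {S : Set B} {e : B → Z} (he : Continuous e)
    {W : Set Z} (heW : ∀ b, e b ∈ W) {H : Z × ℝ → T} (hH : ContinuousOn H (W ×ˢ Icc 0 1))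
    (hHA : ∀ b, ∀ t ∈ Icc (0 : ℝ) 1, H (e b, t) ∈ A) (h0 : ∀ b, H (e b, 0) = f b)
    (hS : ∀ b ∈ S, ∀ t ∈ Icc (0 : ℝ) 1, H (e b, t) = f b) :
    ∃ g : C(B, A), f.HomotopicRel g S ∧ ∀ b, (g b : T) = H (e b, 1) := by
  have hc : Continuous fun p : unitInterval × B => H (e p.2, p.1) :=
    hH.comp_continuous (by fun_prop) fun p => ⟨heW _, p.1.2⟩
  refine ⟨⟨fun b => ⟨H (e b, 1), hHA b 1 (by simp)⟩, Continuous.subtype_mk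
    (hH.comp_continuous (by fun_prop) fun b => ⟨heW b, by simp⟩) _⟩, ⟨?_⟩, fun b => rfl⟩
  exact
    { toFun := fun p => ⟨H (e p.2, p.1), hHA _ _ p.1.2⟩
      continuous_toFun := hc.subtype_mk _
      map_zero_left := fun b => Subtype.ext (h0 b)
      map_one_left := fun b => rfl
      prop' := fun t b hb => Subtype.ext (hS b hb t t.2) }

section Filtration

variable {V : Type} {K : ASC V} {Bad : Set (Finset V)} {c : ℕ}

variable (K Bad c) in
/-- The points whose supporting simplex has no bad face with more than `c` vertices. -/
def filtration : Set (V → ℝ) :=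
  {x | x ∈ K.space ∧ ∀ u ∈ Bad, (∀ w ∈ u, 0 < x w) → u.card ≤ c}

theorem simplex_subset_filtration {t : Finset V} (ht : t ∈ K.faces)
    (h : ∀ u ∈ Bad, u ⊆ t → u.card ≤ c) : simplex t ⊆ filtration K Bad c := fun x hx =>
  ⟨mem_space.2 ⟨t, ht, hx⟩, fun u hu hp => h u hu fun w hw => by
    by_contra hwt
    exact (hp w hw).ne' (hx.2.1 w hwt)⟩

theorem exists_support_of_mem_filtration {x : V → ℝ} (hx : x ∈ filtration K Bad c) :
    ∃ t ∈ K.faces, x ∈ simplex t ∧ (∀ v, 0 < x v ↔ v ∈ t) ∧ ∀ u ∈ Bad, u ⊆ t → u.card ≤ c := by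
  obtain ⟨t, ht, hxt, h⟩ := exists_support_of_mem_space hx.1
  exact ⟨t, ht, hxt, h, fun u hu hut => hx.2 u hu fun w hw => (h w).2 (hut hw)⟩

theorem filtration_zero {L : ASC V} (hLK : L.faces ⊆ K.faces)
    (hBad : ∀ s ∈ Bad, s ∈ K.faces ∧ s ∉ L.faces)
    (h1 : ∀ s ∈ K.faces, (∀ t, t ⊆ s → t.Nonempty → t ∉ Bad) → s ∈ L.faces) :
    filtration K Bad 0 = L.space := by
  ext x
  constructor
  · intro hx
    obtain ⟨t, ht, hxt, -, h⟩ := exists_support_of_mem_filtration hx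
    refine mem_space.2 ⟨t, h1 t ht fun u hut hne hu => ?_, hxt⟩
    have := h u hu hut
    have := hne.card_pos
    omega
  · intro hx
    obtain ⟨t, ht, hxt⟩ := mem_space.1 hx
    refine simplex_subset_filtration (hLK ht) (fun u hu hut => ?_) hxt
    exact ((hBad u hu).2 (L.down_closed ht hut (K.nonempty_of_mem (hBad u hu).1))).elim

/-- The straight-line homotopy from the identity to `pushAway`. -/
theorem exists_homotopicRel_pushAway {B : Type} [TopologicalSpace B] {f : C(B, K.space)}
    {S : Set B} {F : Set (Finset V)} {ε : ℝ} (hε : 0 ≤ ε) (hf : ∀ b, 0 < mass F ε (f b))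
    (hS : ∀ b ∈ S, ∀ u ∈ F, ¬ ∀ w ∈ u, 0 < (f b : V → ℝ) w) :
    ∃ g : C(B, K.space), f.HomotopicRel g S ∧ ∀ b, (g b : V → ℝ) = pushAway F ε (f b) := by
  have hmem : ∀ b, (f b : V → ℝ) ∈ {x ∈ simplices V | 0 < mass F ε x} := fun b =>
    ⟨space_subset_simplices K (f b).2, hf b⟩
  have key := exists_homotopicRel (f := f) (S := S) (e := fun b => (f b : V → ℝ))
    (by fun_prop) hmem (H := fun p => (1 - p.2) • p.1 + p.2 • pushAway F ε p.1) ?_ ?_ ?_ ?_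
  · obtain ⟨g, hg, hg1⟩ := key
    exact ⟨g, hg, fun b => by rw [hg1]; simp⟩
  · refine ContinuousOn.add (Continuous.continuousOn (by fun_prop)) (ContinuousOn.smul
      continuousOn_snd ((continuousOn_pushAway hε).comp continuousOn_fst fun p hp => hp.1))
  · intro b t ht
    obtain ⟨s, hs, hx⟩ := mem_space.1 (f b).2
    exact mem_space.2 ⟨s, hs, lineMap_mem_simplex hx (pushAway_mem_simplex hε hx (hf b)) ht⟩
  · simp
  · intro b hb t _
    obtain ⟨s, hx⟩ := (hmem b).1
    simp only
    rw [pushAway_eq_self hε hx (hS b hb), ← add_smul]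
    simp

theorem exists_homotopicRel_filtration_of_compact {B : Type} [TopologicalSpace B] [CompactSpace B]
    {f : C(B, K.space)} {S : Set B} (hBad : ∀ s ∈ Bad, s.Nonempty)
    (hS : ∀ b ∈ S, (f b : V → ℝ) ∈ filtration K Bad 0) :
    ∃ (g : C(B, K.space)) (c : ℕ), f.HomotopicRel g S ∧
      ∀ b, (g b : V → ℝ) ∈ filtration K Bad c := by
  obtain ⟨k, hk⟩ : ∃ k : ℕ, ∀ b, ∃ v, ((k : ℝ) + 1)⁻¹ < (f b : V → ℝ) v := by
    have key := isCompact_univ.elim_directed_cover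
      (fun k : ℕ => {b : B | ∃ v, ((k : ℝ) + 1)⁻¹ < (f b : V → ℝ) v}) (fun k => ?_) (fun b _ => ?_)
      (directed_of_isDirected_le fun k l hkl b hb => ?_)
    · obtain ⟨k, hk⟩ := key
      exact ⟨k, fun b => hk (mem_univ b)⟩
    · rw [ofPred_exists]
      exact isOpen_iUnion fun v => isOpen_lt continuous_const
        ((continuous_apply v).comp (continuous_subtype_val.comp f.continuous))
    · obtain ⟨t, ht, -, h⟩ := exists_support_of_mem_space (f b).2
      obtain ⟨v, hv⟩ := K.nonempty_of_mem ht
      obtain ⟨k, hk⟩ := exists_nat_one_div_lt ((h v).2 hv)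
      exact mem_iUnion.2 ⟨k, v, by simpa using hk⟩
    · obtain ⟨v, hv⟩ := hb
      exact ⟨v, lt_of_le_of_lt (by gcongr) hv⟩
  have hε : (0 : ℝ) < ((k : ℝ) + 1)⁻¹ := by positivity
  have key := exists_homotopicRel_pushAway (f := f) (S := S) (F := Bad) hε.le
    (fun b => ?_) (fun b hb u hu hp => ?_)
  · obtain ⟨g, hg, hg1⟩ := key
    refine ⟨g, k + 1, hg, fun b => ⟨(g b).2, fun u hu hp => ?_⟩⟩
    obtain ⟨s, -, hx⟩ := mem_space.1 (f b).2
    have hm : 0 < mass Bad ((k : ℝ) + 1)⁻¹ (f b) := by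
      obtain ⟨v, hv⟩ := hk b
      exact (mass_pos_iff hε.le hx).2 ⟨v, sub_pos.2 ((min_le_right _ _).trans_lt hv)⟩
    obtain ⟨v, hv, hmin, h⟩ := exists_min_trunc (F := Bad) (ε := ((k : ℝ) + 1)⁻¹) hx.1 hu (hBad u hu)
    have hlt := h ((pushAway_pos_iff hm).1 (by rw [← hg1]; exact hp v hv))
    classical
    have h1 : (u.card : ℝ) * ((k : ℝ) + 1)⁻¹ ≤ 1 := by
      have h2 : ∑ w ∈ u, ((k : ℝ) + 1)⁻¹ ≤ ∑ w ∈ u, (f b : V → ℝ) w :=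
        Finset.sum_le_sum fun w hw => hlt.le.trans (hmin w hw)
      have h3 : 0 ≤ ∑ w ∈ s \ u, (f b : V → ℝ) w := Finset.sum_nonneg fun w _ => hx.1 w
      have h4 := sum_sdiff_le (s := u) hx
      rw [Finset.sum_const, nsmul_eq_mul] at h2
      linarith
    rw [← div_eq_mul_inv, div_le_one (by positivity)] at h1
    exact_mod_cast h1
  · obtain ⟨s, -, hx⟩ := mem_space.1 (f b).2
    obtain ⟨v, hv⟩ := hk b
    exact (mass_pos_iff hε.le hx).2 ⟨v, sub_pos.2 ((min_le_right _ _).trans_lt hv)⟩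
  · have := (hS b hb).2 u hu hp
    have := (hBad u hu).card_pos
    omega

end Filtration

section Stage

variable {V : Type} {K : ASC V} {Bad : Set (Finset V)} {c : ℕ}

variable (Bad c) in
/-- The bad simplices with exactly `c + 1` vertices. -/
def topBad : Set (Finset V) := {σ | σ ∈ Bad ∧ σ.card = c + 1}

theorem eq_of_topBad [DecidableEq V]
    (h2 : ∀ s ∈ K.faces, ∀ t u, t ⊆ s → u ⊆ s → t ∈ Bad → u ∈ Bad → t ∪ u ∈ Bad)
    {t : Finset V} (ht : t ∈ K.faces) (hc : ∀ u ∈ Bad, u ⊆ t → u.card ≤ c + 1) {σ τ : Finset V}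
    (hσ : σ ∈ topBad Bad c) (hσt : σ ⊆ t) (hτ : τ ∈ Bad) (hτt : τ ⊆ t) : τ ⊆ σ := by
  have h := hc _ (h2 t ht σ τ hσt hτt hσ.1 hτ) (Finset.union_subset hσt hτt)
  have h' := Finset.eq_of_subset_of_card_le (Finset.subset_union_left (s₁ := σ) (s₂ := τ))
    (hσ.2 ▸ h)
  rw [h']
  exact Finset.subset_union_right

theorem mass_topBad_pos_iff [DecidableEq V]
    (h2 : ∀ s ∈ K.faces, ∀ t u, t ⊆ s → u ⊆ s → t ∈ Bad → u ∈ Bad → t ∪ u ∈ Bad)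
    {x : V → ℝ} (hx : x ∈ filtration K Bad (c + 1)) :
    0 < mass (topBad Bad c) 1 x ↔ ∀ σ ∈ topBad Bad c, ∃ v ∈ σ, x v < ((c : ℝ) + 1)⁻¹ := by
  obtain ⟨t, ht, hxt, hpos, hc⟩ := exists_support_of_mem_filtration hx
  have hc0 : (0 : ℝ) < ((c : ℝ) + 1)⁻¹ := by positivity
  have hsum : ∀ σ ∈ topBad Bad c, ∑ _v ∈ σ, ((c : ℝ) + 1)⁻¹ = 1 := fun σ hσ => by
    rw [Finset.sum_const, hσ.2, nsmul_eq_mul]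
    push_cast
    exact mul_inv_cancel₀ (by positivity)
  rw [mass_pos_iff zero_le_one hxt]
  constructor
  · contrapose!
    rintro ⟨σ, hσ, hle⟩ v
    have h3 := sum_sdiff_le (s := σ) hxt
    by_cases hv : v ∈ σ
    · have h4 : 0 ≤ ∑ w ∈ t \ σ, x w := Finset.sum_nonneg fun w _ => hxt.1 w
      have h5 := Finset.single_le_sum (f := fun w => x w - ((c : ℝ) + 1)⁻¹)
        (fun w hw => sub_nonneg.2 (hle w hw)) hv
      rw [Finset.sum_sub_distrib, hsum σ hσ] at h5
      have h6 : ((c : ℝ) + 1)⁻¹ ≤ weight (topBad Bad c) x v :=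
        (Finset.le_inf' _ _ hle).trans (inf'_le_weight hσ hv)
      have h7 : ((c : ℝ) + 1)⁻¹ ≤ 1 := inv_le_one_of_one_le₀ (by linarith [c.cast_nonneg (α := ℝ)])
      have h8 := le_min h6 h7
      unfold trunc
      linarith
    · refine (trunc_bounds zero_le_one hxt.1 v).2.trans ?_
      by_cases hvt : v ∈ t
      · have h4 := Finset.single_le_sum (f := x) (fun w _ => hxt.1 w) (Finset.mem_sdiff.2 ⟨hvt, hv⟩)
        have h5 := Finset.sum_le_sum hle
        rw [hsum σ hσ] at h5
        linarith
      · exact (hxt.2.1 v hvt).le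
  · intro h
    by_contra! hle
    have key : ∀ v ∈ t, ∃ σ ∈ topBad Bad c, v ∈ σ ∧ σ ⊆ t ∧ x v ≤ weight (topBad Bad c) x v := by
      intro v hv
      have h3 : x v ≤ weight (topBad Bad c) x v :=
        (sub_nonpos.1 (hle v)).trans (min_le_left _ _)
      obtain ⟨σ, hσ, hvσ, hσp⟩ := exists_pos_of_weight_pos (((hpos v).2 hv).trans_le h3)
      exact ⟨σ, hσ, hvσ, fun w hw => (hpos w).1 (hσp w hw), h3⟩
    obtain ⟨v, hv⟩ := K.nonempty_of_mem ht
    obtain ⟨σ, hσ, -, hσt, -⟩ := key v hv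
    have htσ : t ⊆ σ := fun w hw => by
      obtain ⟨τ, hτ, hwτ, hτt, -⟩ := key w hw
      exact eq_of_topBad h2 ht hc hσ hσt hτ.1 hτt hwτ
    obtain rfl := htσ.antisymm hσt
    obtain ⟨v₀, hv₀, hlt⟩ := h t hσ
    have hlt' : ∀ w ∈ t, x w < ((c : ℝ) + 1)⁻¹ := by
      intro w hw
      obtain ⟨-, -, -, -, h3⟩ := key w hw
      refine (h3.trans (Real.iSup_le (fun u => ?_) (hxt.1 v₀))).trans_lt hlt
      by_cases hu : u.1 ⊆ t
      · have : u.1 = t := Finset.eq_of_subset_of_card_le hu (by rw [u.2.1.2, hσ.2])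
        exact Finset.inf'_le _ (this ▸ hv₀)
      · obtain ⟨w', hw', hw't⟩ := Finset.not_subset.1 hu
        exact (Finset.inf'_le _ hw').trans ((hxt.2.1 w' hw't).le.trans (hxt.1 v₀))
    have := Finset.sum_lt_sum_of_nonempty (K.nonempty_of_mem ht) hlt'
    rw [hsum t hσ, hxt.2.2] at this
    exact this.false

/-- The barycenter of a simplex with `c + 1` vertices. -/
noncomputable def barycenter [DecidableEq V] (c : ℕ) (σ : Finset V) (v : V) : ℝ :=
  if v ∈ σ then ((c : ℝ) + 1)⁻¹ else 0

theorem barycenter_mem_simplex [DecidableEq V] {σ : Finset V} (hσ : σ.card = c + 1) :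
    barycenter c σ ∈ simplex σ := by
  refine ⟨fun v => ?_, fun v hv => if_neg hv, ?_⟩
  · unfold barycenter
    split_ifs <;> positivity
  · unfold barycenter
    rw [Finset.sum_ite_mem, Finset.inter_self, Finset.sum_const, hσ, nsmul_eq_mul]
    push_cast
    exact mul_inv_cancel₀ (by positivity)

variable (K Bad c) in
/-- The open star in `filtration K Bad (c + 1)` of a simplex. -/
def openStar (σ : Finset V) : Set (V → ℝ) :=
  {x | x ∈ filtration K Bad (c + 1) ∧ ∀ v ∈ σ, 0 < x v}

theorem exists_support_of_mem_openStar {σ : Finset V} {x : V → ℝ} (hx : x ∈ openStar K Bad c σ) :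
    ∃ t ∈ K.faces, x ∈ simplex t ∧ σ ⊆ t ∧ ∀ u ∈ Bad, u ⊆ t → u.card ≤ c + 1 := by
  obtain ⟨t, ht, hxt, hpos, hc⟩ := exists_support_of_mem_filtration hx.1
  exact ⟨t, ht, hxt, fun v hv => (hpos v).1 (hx.2 v hv), hc⟩

theorem mass_topBad_pos_iff_of_mem_openStar [DecidableEq V]
    (h2 : ∀ s ∈ K.faces, ∀ t u, t ⊆ s → u ⊆ s → t ∈ Bad → u ∈ Bad → t ∪ u ∈ Bad)
    {σ : Finset V} (hσ : σ ∈ topBad Bad c) {x : V → ℝ} (hx : x ∈ openStar K Bad c σ) :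
    0 < mass (topBad Bad c) 1 x ↔ ∃ v ∈ σ, x v < ((c : ℝ) + 1)⁻¹ := by
  rw [mass_topBad_pos_iff h2 hx.1]
  refine ⟨fun h => h σ hσ, fun h τ hτ => ?_⟩
  obtain ⟨t, ht, hxt, hσt, hc⟩ := exists_support_of_mem_openStar hx
  by_cases hτt : τ ⊆ t
  · have := Finset.eq_of_subset_of_card_le (eq_of_topBad h2 ht hc hσ hσt hτ.1 hτt)
      (by rw [hσ.2, hτ.2])
    rwa [this]
  · obtain ⟨v, hv, hvt⟩ := Finset.not_subset.1 hτt
    exact ⟨v, hv, by rw [hxt.2.1 v hvt]; positivity⟩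

theorem lineMap_mem_openStar {σ t : Finset V} (ht : t ∈ K.faces)
    (hc : ∀ u ∈ Bad, u ⊆ t → u.card ≤ c + 1) {x y : V → ℝ} (hx : x ∈ simplex t) (hy : y ∈ simplex t)
    (hx0 : ∀ v ∈ σ, 0 < x v) (hy0 : ∀ v ∈ σ, 0 < y v) {r : ℝ} (hr : r ∈ Icc (0 : ℝ) 1) :
    (1 - r) • x + r • y ∈ openStar K Bad c σ := by
  refine ⟨simplex_subset_filtration ht hc (lineMap_mem_simplex hx hy hr), fun v hv => ?_⟩
  simp only [Pi.add_apply, Pi.smul_apply, smul_eq_mul]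
  rcases hr.1.eq_or_lt with h | h
  · rw [← h]; simpa using hx0 v hv
  · exact add_pos_of_nonneg_of_pos (mul_nonneg (by linarith [hr.2]) (hx0 v hv).le)
      (mul_pos h (hy0 v hv))

theorem barycenter_pos [DecidableEq V] {σ : Finset V} : ∀ v ∈ σ, 0 < barycenter c σ v :=
  fun v hv => by rw [barycenter, if_pos hv]; positivity

theorem sphereExt_openStar {σ : Finset V} (hσ : σ ∈ topBad Bad c) (hσK : σ ∈ K.faces) (m : ℕ) :
    SphereExt (openStar K Bad c σ) m := by
  classical
  have hb := barycenter_mem_simplex hσ.2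
  refine SphereExt.of_starConvex (p := barycenter c σ)
    ⟨simplex_subset_filtration hσK (fun u _ h => (Finset.card_le_card h).trans hσ.2.le) hb,
      barycenter_pos⟩ fun x hx r hr => ?_
  obtain ⟨t, ht, hxt, hσt, hc⟩ := exists_support_of_mem_openStar hx
  exact lineMap_mem_openStar ht hc hxt (simplex_mono hσt hb) hx.2 barycenter_pos hr

theorem sphereExt_openStar_inter [DecidableEq V] (hBad : ∀ s ∈ Bad, s ∈ K.faces)
    (h2 : ∀ s ∈ K.faces, ∀ t u, t ⊆ s → u ⊆ s → t ∈ Bad → u ∈ Bad → t ∪ u ∈ Bad) {n : ℕ}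
    {σ : Finset V} (hσ : σ ∈ topBad Bad c)
    (hG : IsConn (↥(goodFor K Bad σ).space) ((n : ℤ) - σ.card)) {m : ℕ} (hm : m ≤ n) :
    SphereExt (openStar K Bad c σ ∩
      {x | x ∈ filtration K Bad (c + 1) ∧ 0 < mass (topBad Bad c) 1 x}) m := by
  have hne : σ.Nonempty := K.nonempty_of_mem (hBad σ hσ.1)
  have hb := barycenter_mem_simplex hσ.2
  have hc0 : (0 : ℝ) < ((c : ℝ) + 1)⁻¹ := by positivity
  refine SphereExt.of_linear_homotopy (φ := pushAway (topBad Bad c) 1)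
    (ψ := fun y => (1 - (1 / 2 : ℝ)) • y + (1 / 2 : ℝ) • barycenter c σ)
    (sphereExt_goodJoin (fun s hs => K.nonempty_of_mem (hBad s hs)) (hBad σ hσ.1) hG hne
      subset_rfl m (by omega))
    ((continuousOn_pushAway zero_le_one).mono fun x hx =>
      ⟨space_subset_simplices K hx.1.1.1, hx.2.2⟩) ?_ (Continuous.continuousOn (by fun_prop)) ?_ ?_
  · rintro x ⟨hx, -, hm⟩
    obtain ⟨t, ht, hxt, hσt, hc⟩ := exists_support_of_mem_openStar hx
    obtain ⟨s, hst, hsne, hys, hs⟩ := exists_support (pushAway_mem_simplex zero_le_one hxt hm)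
    have hu : s ∪ σ ⊆ t := Finset.union_subset hst hσt
    refine mem_space.2 ⟨s, ⟨hsne, fun h => ?_, Finset.inter_subset_right,
      K.down_closed ht hu (hsne.mono Finset.subset_union_left), fun u hu' hub =>
        eq_of_topBad h2 ht hc hσ hσt hub (hu'.trans hu)⟩, hys⟩
    obtain ⟨v, hv, -, hv1⟩ := exists_min_trunc (ε := 1) hxt.1 hσ hne
    exact ((hv1 ((pushAway_pos_iff hm).1 ((hs v).2 (h hv)))).trans_le
      (le_one_of_mem_simplex hxt v)).false
  · intro y hy
    obtain ⟨s, ⟨-, hσs, -, hsK, hsb⟩, hys⟩ := mem_space.1 hy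
    have hc : ∀ u ∈ Bad, u ⊆ s ∪ σ → u.card ≤ c + 1 := fun u hu hus =>
      (Finset.card_le_card (hsb u hus hu)).trans hσ.2.le
    have hmem : (1 - (1 / 2 : ℝ)) • y + (1 / 2 : ℝ) • barycenter c σ ∈ openStar K Bad c σ := by
      refine ⟨simplex_subset_filtration hsK hc (lineMap_mem_simplex
        (simplex_mono Finset.subset_union_left hys) (simplex_mono Finset.subset_union_right hb)
        ⟨by norm_num, by norm_num⟩), fun v hv => ?_⟩
      have h3 := barycenter_pos (c := c) v hv
      have h4 := hys.1 v
      simp only [Pi.add_apply, Pi.smul_apply, smul_eq_mul]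
      linarith
    refine ⟨hmem, hmem.1, (mass_topBad_pos_iff_of_mem_openStar h2 hσ hmem).2 ?_⟩
    obtain ⟨v, hv, hvs⟩ := Finset.not_subset.1 hσs
    refine ⟨v, hv, ?_⟩
    simp only [Pi.add_apply, Pi.smul_apply, smul_eq_mul, hys.2.1 v hvs, barycenter, if_pos hv]
    linarith
  · rintro x ⟨hx, -, hm⟩ r hr
    obtain ⟨t, ht, hxt, hσt, hc⟩ := exists_support_of_mem_openStar hx
    have hy := pushAway_mem_simplex zero_le_one hxt hm
    have hmem := lineMap_mem_openStar (σ := σ) ht hc hxt (lineMap_mem_simplex hy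
      (simplex_mono hσt hb) (t := 1 / 2) ⟨by norm_num, by norm_num⟩) hx.2 (fun v hv => ?_) hr
    · refine ⟨hmem, hmem.1, (mass_topBad_pos_iff_of_mem_openStar h2 hσ hmem).2 ?_⟩
      obtain ⟨v, hv, hvmin, hv1⟩ := exists_min_trunc (ε := 1) hxt.1 hσ hne
      have hy0 : pushAway (topBad Bad c) 1 x v = 0 := by
        refine le_antisymm (not_lt.1 fun h => ?_) (hy.1 v)
        exact ((hv1 ((pushAway_pos_iff hm).1 h)).trans_le (le_one_of_mem_simplex hxt v)).false
      obtain ⟨w, hw, hlt⟩ := (mass_topBad_pos_iff_of_mem_openStar h2 hσ hx).1 hm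
      have hvlt := (hvmin w hw).trans_lt hlt
      refine ⟨v, hv, ?_⟩
      simp only [Pi.add_apply, Pi.smul_apply, smul_eq_mul, hy0, barycenter, if_pos hv]
      rcases hr.1.eq_or_lt with h | h
      · rw [← h]; simpa using hvlt
      · nlinarith [hr.2]
    · have h3 := barycenter_pos (c := c) v hv
      have h4 := hy.1 v
      simp only [Pi.add_apply, Pi.smul_apply, smul_eq_mul]
      linarith

theorem exists_homotopicRel_filtration [DecidableEq V] (hBad : ∀ s ∈ Bad, s ∈ K.faces)
    (h2 : ∀ s ∈ K.faces, ∀ t u, t ⊆ s → u ⊆ s → t ∈ Bad → u ∈ Bad → t ∪ u ∈ Bad) {n : ℕ}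
    (hG : ∀ σ ∈ Bad, IsConn (↥(goodFor K Bad σ).space) ((n : ℤ) - σ.card)) {i : ℕ} (hi : i ≤ n)
    {f : C(closedBall (0 : EuclideanSpace ℝ (Fin i)) 1, K.space)}
    (hS : ∀ b : closedBall (0 : EuclideanSpace ℝ (Fin i)) 1,
      (b : EuclideanSpace ℝ (Fin i)) ∈ sphere (0 : EuclideanSpace ℝ (Fin i)) 1 →
      (f b : V → ℝ) ∈ filtration K Bad 0)
    (hf : ∀ b, (f b : V → ℝ) ∈ filtration K Bad (c + 1)) :
    ∃ g : C(closedBall (0 : EuclideanSpace ℝ (Fin i)) 1, K.space),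
      f.HomotopicRel g {b | (b : EuclideanSpace ℝ (Fin i)) ∈
        sphere (0 : EuclideanSpace ℝ (Fin i)) 1} ∧
      ∀ b, (g b : V → ℝ) ∈ filtration K Bad c := by
  classical
  have hne : ∀ s ∈ Bad, s.Nonempty := fun s hs => K.nonempty_of_mem (hBad s hs)
  have hnotBad : ∀ {x : V → ℝ}, x ∈ filtration K Bad 0 → ∀ u ∈ topBad Bad c, ¬ ∀ w ∈ u, 0 < x w := by
    intro x hx u hu hp
    have := hx.2 u hu.1 hp
    have := hu.2
    omega
  obtain ⟨h, hh⟩ := exists_homeomorph_cube i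
  set X := filtration K Bad (c + 1)
  have hXs : X ⊆ simplices V := fun x hx => space_subset_simplices K hx.1
  set U := {x | x ∈ filtration K Bad (c + 1) ∧ 0 < mass (topBad Bad c) 1 x}
  let f' : (Fin i → ℝ) → V → ℝ := fun z =>
    if hz : h z ∈ closedBall (0 : EuclideanSpace ℝ (Fin i)) 1 then f ⟨h z, hz⟩ else 0
  have hf' : ∀ z, ∀ hz : h z ∈ closedBall (0 : EuclideanSpace ℝ (Fin i)) 1, f' z = f ⟨h z, hz⟩ :=
    fun z hz => dif_pos hz
  have hf'c : ContinuousOn f' (Icc 0 1) := by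
    rw [continuousOn_iff_continuous_domRestrict]
    have : (Icc (0 : Fin i → ℝ) 1).domRestrict f' =
        fun z : Icc (0 : Fin i → ℝ) 1 => (f ⟨h z, (hh.1 z).2 z.2⟩ : V → ℝ) := funext fun z => hf' z _
    rw [this]
    exact continuous_subtype_val.comp (f.continuous.comp (by fun_prop))
  obtain ⟨H, hHc, hHX, hH0, hH1, hHrel⟩ := exists_homotopy_into_open (D := i) (W := Icc 0 1)
    (W₀ := frontier (Icc (0 : Fin i → ℝ) 1)) isCompact_Icc isGridSet_cube
    isClosed_Icc.frontier_subset isGridSet_frontier_cube (fun _ c _ _ => cellDim_le c)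
    (κ := topBad Bad c) (X := X) (U := U) (O := fun σ => openStar K Bad c σ)
    (by
      rintro x ⟨hx, hm⟩
      have h3 := ((continuousOn_mass (F := topBad Bad c) zero_le_one).mono hXs x hx).eventually
        (lt_mem_nhds hm)
      filter_upwards [h3, self_mem_nhdsWithin] with y hy hyX using ⟨hyX, hy⟩)
    (fun σ x hx => hx.1)
    (by
      rintro σ x ⟨hx, hp⟩
      have h3 : ∀ᶠ y in 𝓝[X] x, ∀ v ∈ σ.1, 0 < y v := by
        rw [Filter.eventually_all_finset]
        exact fun v hv => ((continuous_apply v).continuousAt.continuousWithinAt).eventually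
          (lt_mem_nhds (hp v hv))
      filter_upwards [h3, self_mem_nhdsWithin] with y hy hyX using ⟨hyX, hy⟩)
    (by
      intro x hx
      by_cases hm : 0 < mass (topBad Bad c) 1 x
      · exact Or.inl ⟨hx, hm⟩
      · rw [mass_topBad_pos_iff h2 hx] at hm
        push Not at hm
        obtain ⟨σ, hσ, hle⟩ := hm
        exact Or.inr ⟨⟨σ, hσ⟩, hx, fun v hv => lt_of_lt_of_le (by positivity) (hle v hv)⟩)
    (by
      rintro σ τ hστ x ⟨hxσ, hxτ⟩
      refine (hστ (Subtype.ext ?_)).elim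
      obtain ⟨t, ht, -, hpos, hc⟩ := exists_support_of_mem_filtration hxσ.1
      have hσt : σ.1 ⊆ t := fun v hv => (hpos v).1 (hxσ.2 v hv)
      have hτt : τ.1 ⊆ t := fun v hv => (hpos v).1 (hxτ.2 v hv)
      exact (eq_of_topBad h2 ht hc τ.2 hτt σ.2.1 hσt).antisymm
        (eq_of_topBad h2 ht hc σ.2 hσt τ.2.1 hτt))
    (fun σ m => sphereExt_openStar σ.2 (hBad _ σ.2.1) m)
    (fun σ m hm => sphereExt_openStar_inter hBad h2 σ.2 (hG _ σ.2.1) (hm.trans hi))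
    hf'c
    (by
      intro z hz
      rw [hf' z ((hh.1 z).2 hz)]
      exact hf _)
    (by
      intro z hz
      have hz' := (hh.2 z).2 hz
      have h3 := hS ⟨h z, sphere_subset_closedBall hz'⟩ hz'
      rw [hf' z (sphere_subset_closedBall hz')]
      refine ⟨hf _, ?_⟩
      obtain ⟨s, hs⟩ := hXs (hf ⟨h z, sphere_subset_closedBall hz'⟩)
      rw [mass_eq_one zero_le_one hs (hnotBad h3)]
      exact one_pos)
  have hsymm : ∀ b : closedBall (0 : EuclideanSpace ℝ (Fin i)) 1, h.symm b ∈ Icc (0 : Fin i → ℝ) 1 :=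
    fun b => (hh.1 _).1 (by rw [h.apply_symm_apply]; exact b.2)
  have hval : ∀ b : closedBall (0 : EuclideanSpace ℝ (Fin i)) 1, f' (h.symm b) = f b := fun b => by
    rw [hf' _ (by rw [h.apply_symm_apply]; exact b.2)]
    simp
  obtain ⟨g, hfg, hg⟩ := exists_homotopicRel (f := f)
    (S := {b | (b : EuclideanSpace ℝ (Fin i)) ∈ sphere (0 : EuclideanSpace ℝ (Fin i)) 1})
    (e := fun b => h.symm b) (by fun_prop) hsymm hHc
    (fun b t ht => (hHX ⟨hsymm b, ht⟩).1) (fun b => by rw [hH0 _ (hsymm b), hval])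
    (fun b hb t ht => by
      rw [hHrel _ ((hh.2 _).1 (by rw [h.apply_symm_apply]; exact hb)) t ht, hval])
  have hgU : ∀ b, (g b : V → ℝ) ∈ U := fun b => by
    rw [hg]
    exact hH1 _ (hsymm b)
  have hgS : ∀ b : closedBall (0 : EuclideanSpace ℝ (Fin i)) 1,
      (b : EuclideanSpace ℝ (Fin i)) ∈ sphere (0 : EuclideanSpace ℝ (Fin i)) 1 →
      (g b : V → ℝ) ∈ filtration K Bad 0 := fun b hb => by
    rw [hg, hHrel _ ((hh.2 _).1 (by rw [h.apply_symm_apply]; exact hb)) 1 (by simp), hval]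
    exact hS b hb
  obtain ⟨g', hgg', hg'⟩ := exists_homotopicRel_pushAway (f := g)
    (S := {b | (b : EuclideanSpace ℝ (Fin i)) ∈ sphere (0 : EuclideanSpace ℝ (Fin i)) 1})
    zero_le_one (fun b => (hgU b).2) (fun b hb => hnotBad (hgS b hb))
  refine ⟨g', hfg.trans hgg', fun b => ⟨(g' b).2, fun u hu hp => ?_⟩⟩
  obtain ⟨t, ht, hxt, hpos, hc⟩ := exists_support_of_mem_filtration (hgU b).1
  rw [hg'] at hp
  have hut : u ⊆ t := fun w hw => by
    by_contra hwt
    exact (hp w hw).ne' ((pushAway_mem_simplex zero_le_one hxt (hgU b).2).2.1 w hwt)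
  by_contra hcu
  have huF : u ∈ topBad Bad c := ⟨hu, le_antisymm (hc u hu hut) (not_le.1 hcu)⟩
  obtain ⟨v, hv, -, hv1⟩ := exists_min_trunc (ε := 1) hxt.1 huF (hne u hu)
  exact ((hv1 ((pushAway_pos_iff (hgU b).2).1 (hp v hv))).trans_le
    (le_one_of_mem_simplex hxt v)).false

end Stage

end LinkArgument

/-- **The link argument.** Let `Y ⊆ X` be simplicial complexes with a set of bad simplices in
`X − Y` such that (1) every simplex of `X` all of whose faces are not bad lies in `Y`, and
(2) the join of two bad faces of a simplex is bad.  If for some `n ≥ 0` the complex `G_σ` is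
`(n − dim σ − 1)`-connected for every bad simplex `σ`, then the pair `(X, Y)` is `n`-connected. -/
theorem link_argument {V : Type} [DecidableEq V] (K L : ASC V) (hLK : L.faces ⊆ K.faces)
    (Bad : Set (Finset V)) (hBad : ∀ s ∈ Bad, s ∈ K.faces ∧ s ∉ L.faces)
    (h1 : ∀ s ∈ K.faces, (∀ t, t ⊆ s → t.Nonempty → t ∉ Bad) → s ∈ L.faces)
    (h2 : ∀ s ∈ K.faces, ∀ t u, t ⊆ s → u ⊆ s → t ∈ Bad → u ∈ Bad → t ∪ u ∈ Bad)
    (n : ℕ)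
    (hG : ∀ σ ∈ Bad, IsConn (↥(goodFor K Bad σ).space) ((n : ℤ) - σ.card)) :
    PairConnUpTo (↥K.space) {x : ↥K.space | (x : V → ℝ) ∈ L.space} n := by
  intro i hi f hf
  have hL := LinkArgument.filtration_zero hLK hBad h1
  have hBadK : ∀ s ∈ Bad, s ∈ K.faces := fun s hs => (hBad s hs).1
  have hstep : ∀ (c : ℕ) (g : C(Metric.closedBall (0 : EuclideanSpace ℝ (Fin i)) 1, K.space)),
      f.HomotopicRel g {b | (b : EuclideanSpace ℝ (Fin i)) ∈
        Metric.sphere (0 : EuclideanSpace ℝ (Fin i)) 1} →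
      (∀ b, (g b : V → ℝ) ∈ LinkArgument.filtration K Bad c) →
      ∃ g' : C(Metric.closedBall (0 : EuclideanSpace ℝ (Fin i)) 1, K.space),
        (∀ b, (g' b : V → ℝ) ∈ L.space) ∧ f.HomotopicRel g' {b | (b : EuclideanSpace ℝ (Fin i)) ∈
          Metric.sphere (0 : EuclideanSpace ℝ (Fin i)) 1} := by
    intro c
    induction c with
    | zero => exact fun g hfg hg => ⟨g, fun b => hL ▸ hg b, hfg⟩
    | succ c ih =>
      intro g hfg hg
      obtain ⟨g', hgg', hg'⟩ := LinkArgument.exists_homotopicRel_filtration hBadK h2 hG hi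
        (fun b hb => by
          obtain ⟨F⟩ := hfg
          rw [← F.fst_eq_snd hb, hL]
          exact hf b hb) hg
      exact ih g' (hfg.trans hgg') hg'
  obtain ⟨g, c, hfg, hg⟩ := LinkArgument.exists_homotopicRel_filtration_of_compact (f := f)
    (S := {b | (b : EuclideanSpace ℝ (Fin i)) ∈ Metric.sphere (0 : EuclideanSpace ℝ (Fin i)) 1})
    (fun s hs => K.nonempty_of_mem (hBadK s hs)) (fun b hb => by rw [hL]; exact hf b hb)
  exact hstep c g hfg hg
end
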